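/- arXiv:1909.10668 — 8 statements merged into one kernel-verified Lean document; each statement's English description precedes it below -/
import Mathlib

section
/- There is an absolute constant C > 0 such that for all integers n ≥ 2 and k ≥ 1, there exist an integer s with s ≤ C·(1 + min{n, n·log(2k+1)/log n}) and query vectors x₁,…,x_s ∈ {−k,−k+1,…,k−1,k}^n ⊆ ℤ^n such that the map y ↦ (‖y−x₁‖₁, …, ‖y−x_s‖₁) is injective on {−k,−k+1,…,k−1,k}^n. (That is, s nonadaptive ℓ₁ distance queries suffice to determine any hidden vector y exactly.) -/
open Finset in
/-- Corner queries realise any family of subset sums, at the cost of one extra query. -/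
theorem mm_corner (n k : ℕ) (ι : Type) [Fintype ι] (A : ι → Finset (Fin n))
    (hA : ∀ z : Fin n → ℤ, (∀ i, |z i| ≤ 2 * (k : ℤ)) → (∀ j, ∑ i ∈ A j, z i = 0) → z = 0) :
    ∃ x : Fin (Fintype.card ι + 1) → Fin n → ℤ,
        (∀ j i, |x j i| ≤ (k : ℤ)) ∧
        Set.InjOn
          (fun y : Fin n → ℤ => fun j : Fin (Fintype.card ι + 1) =>
            ∑ i, |(y i : ℝ) - (x j i : ℝ)|)
          {y : Fin n → ℤ | ∀ i, |y i| ≤ (k : ℤ)} := by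
  classical
  let E : Fin (Fintype.card ι + 1) ≃ Option ι :=
    (Fintype.equivFinOfCardEq (by simp)).symm
  let X : Option ι → Fin n → ℤ := fun o i =>
    match o with
    | none => (k : ℤ)
    | some j => if i ∈ A j then -(k : ℤ) else k
  refine ⟨fun j => X (E j), ?_, ?_⟩
  · have hX : ∀ o i, |X o i| ≤ (k : ℤ) := by
      intro o i
      rcases o with _ | j'
      · simp [X]
      · simp only [X]
        split_ifs <;> simp
    exact fun j i => hX (E j) i
  · intro y hy y' hy' hyy
    have key : ∀ o, ∑ i, |y i - X o i| = ∑ i, |y' i - X o i| := by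
      intro o
      have := congrFun hyy (E.symm o)
      simp only [Equiv.apply_symm_apply] at this
      exact_mod_cast this
    have h1 : ∀ u : Fin n → ℤ, (∀ i, |u i| ≤ (k : ℤ)) → ∀ j,
        ∑ i, |u i - X (some j) i| - ∑ i, |u i - X none i| = 2 * ∑ i ∈ A j, u i := by
      intro u hu j
      rw [← Finset.sum_sub_distrib, Finset.mul_sum,
        ← Finset.sum_filter_add_sum_filter_not univ (fun i => i ∈ A j)]
      have e2 : ∑ i with i ∉ A j, (|u i - X (some j) i| - |u i - X none i|) = 0 := by
        apply Finset.sum_eq_zero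
        intro i hi
        simp at hi
        simp [X, hi]
      have e3 : (univ.filter fun i => i ∈ A j) = A j := by ext; simp
      rw [e2, e3, add_zero]
      apply Finset.sum_congr rfl
      intro i hi
      have := abs_le.1 (hu i)
      simp only [X, hi, if_true]
      rw [abs_of_nonneg (by linarith), abs_of_nonpos (by linarith)]
      ring
    have h2 := hA (fun i => y i - y' i) (fun i => by
      have a := abs_le.1 (hy i)
      have b := abs_le.1 (hy' i)
      rw [abs_le]; constructor <;> linarith) (fun j => by
      have a := h1 y hy j
      have b := h1 y' hy' j
      have c1 := key (some j)
      have c2 := key none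
      rw [Finset.sum_sub_distrib]; linarith)
    funext i
    have := congrFun h2 i
    simp at this
    linarith

open Finset in
theorem mm_even_family {α : Type} [DecidableEq α] (S : Finset α) (hS : S.Nonempty) (w : ℕ)
    (hw : w ≤ 2 ^ (S.card - 1)) :
    ∃ F : Finset (Finset α), (∀ T ∈ F, T ⊆ S ∧ Even T.card) ∧ F.card = w := by
  have h0 := Finset.sum_powerset_neg_one_pow_card_of_nonempty hS
  rw [← Finset.sum_filter_add_sum_filter_not _ (fun T : Finset α => Even T.card)] at h0
  have a1 : ∑ T ∈ S.powerset with Even T.card, (-1 : ℤ) ^ T.card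
      = (#{T ∈ S.powerset | Even T.card} : ℤ) := by
    rw [Finset.card_eq_sum_ones]; push_cast
    apply Finset.sum_congr rfl
    intro T hT
    exact (Finset.mem_filter.1 hT).2.neg_one_pow
  have a2 : ∑ T ∈ S.powerset with ¬ Even T.card, (-1 : ℤ) ^ T.card
      = -(#{T ∈ S.powerset | ¬ Even T.card} : ℤ) := by
    rw [Finset.card_eq_sum_ones]; push_cast
    rw [← Finset.sum_neg_distrib]
    apply Finset.sum_congr rfl
    intro T hT
    exact (Nat.not_even_iff_odd.1 (Finset.mem_filter.1 hT).2).neg_one_pow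
  have a3 := Finset.card_filter_add_card_filter_not (s := S.powerset)
    (fun T : Finset α => Even T.card)
  rw [Finset.card_powerset] at a3
  have hc := hS.card_pos
  obtain ⟨c, hc'⟩ : ∃ c, S.card = c + 1 := ⟨S.card - 1, by omega⟩
  rw [hc'] at a3 hw
  simp only [Nat.add_sub_cancel] at hw
  rw [pow_succ] at a3
  rw [a1, a2] at h0
  obtain ⟨F, hF, hFc⟩ := Finset.exists_subset_card_eq
    (s := {T ∈ S.powerset | Even T.card}) (n := w) (by omega)
  refine ⟨F, fun T hT => ?_, hFc⟩
  have := Finset.mem_filter.1 (hF hT)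
  exact ⟨Finset.mem_powerset.1 this.1, this.2⟩

open Finset in
theorem mm_toggle {α : Type} [DecidableEq α] (S0 S : Finset α) (h : ¬ S0 ⊆ S)
    (f : Finset α → ℤ) :
    ∑ T ∈ S0.powerset, (-1 : ℤ) ^ T.card * f (T ∩ S) = 0 := by
  obtain ⟨a, ha, haS⟩ := Finset.not_subset.1 h
  rw [← Finset.insert_erase ha, Finset.sum_powerset_insert (Finset.notMem_erase a S0),
    ← Finset.sum_add_distrib]
  apply Finset.sum_eq_zero
  intro T hT
  have haT : a ∉ T := fun h' => Finset.notMem_erase a S0 (Finset.mem_powerset.1 hT h')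
  rw [Finset.card_insert_of_notMem haT, Finset.insert_inter_of_notMem haS, pow_succ]
  ring

open Finset in
theorem mm_half (m : ℕ) (hm : 1 ≤ m) :
    2 ^ (m - 1) ≤ #{S : Finset (Fin m) | m ≤ 2 * S.card} := by
  have a := Finset.card_filter_add_card_filter_not (s := (univ : Finset (Finset (Fin m))))
    (fun S => m ≤ 2 * S.card)
  have b : #{S : Finset (Fin m) | ¬ m ≤ 2 * S.card} ≤ #{S : Finset (Fin m) | m ≤ 2 * S.card} := by
    apply Finset.card_le_card_of_injOn (fun S => Sᶜ)
    · intro S hS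
      simp at hS ⊢
      rw [Finset.card_compl, Fintype.card_fin]
      omega
    · exact fun _ _ _ _ h => compl_injective h
  obtain ⟨c, rfl⟩ : ∃ c, m = c + 1 := ⟨m - 1, by omega⟩
  rw [Finset.card_univ, Fintype.card_finset, Fintype.card_fin, pow_succ] at a
  simp only [Nat.add_sub_cancel]
  omega

open Finset in
/-- Lindström-type detecting matrix. -/
theorem mm_detect (n k m r : ℕ) (hm : 1 ≤ m) (hn : n ≤ 2 ^ (m - 1) * r)
    (hw : ∀ h i : ℕ, m ≤ 2 * h → i < r → (2 * k + 1) ^ i ≤ 2 ^ (h - 1)) :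
    ∃ A : Finset (Fin m) → Finset (Fin n),
      ∀ z : Fin n → ℤ, (∀ i, |z i| ≤ 2 * (k : ℤ)) → (∀ j, ∑ i ∈ A j, z i = 0) → z = 0 := by
  classical
  obtain ⟨e⟩ : Nonempty (Fin n ↪ {S : Finset (Fin m) // m ≤ 2 * S.card} × Fin r) := by
    apply Function.Embedding.nonempty_of_card_le
    rw [Fintype.card_prod, Fintype.card_fin, Fintype.card_fin, Fintype.card_subtype]
    exact hn.trans (Nat.mul_le_mul_right _ (mm_half m hm))
  have hF : ∀ p : {S : Finset (Fin m) // m ≤ 2 * S.card} × Fin r,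
      ∃ F : Finset (Finset (Fin m)), (∀ T ∈ F, T ⊆ p.1.1 ∧ Even T.card) ∧
        F.card = (2 * k + 1) ^ (p.2 : ℕ) := by
    intro p
    apply mm_even_family
    · rw [← Finset.card_pos]; have := p.1.2; omega
    · exact hw _ _ p.1.2 p.2.2
  choose F hF1 hF2 using hF
  refine ⟨fun T => {c | T ∩ (e c).1.1 ∈ F (e c)}, ?_⟩
  intro z hz hA
  by_contra hne
  obtain ⟨c', hc'⟩ : ∃ c, z c ≠ 0 := by
    by_contra! h
    exact hne (funext h)
  obtain ⟨c0, hc0, hmax⟩ := Finset.exists_max_image {c | z c ≠ 0}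
    (fun c => (e c).1.1.card) ⟨c', by simpa using hc'⟩
  obtain ⟨c1, hc1, hmin⟩ := Finset.exists_min_image {c | z c ≠ 0 ∧ (e c).1 = (e c0).1}
    (fun c => ((e c).2 : ℕ)) ⟨c0, by simpa using hc0⟩
  simp only [Finset.mem_filter, Finset.mem_univ, true_and] at hc0 hmax hc1 hmin
  have hsum : ∑ c, z c * (if (e c).1 = (e c0).1 then (2 * (k : ℤ) + 1) ^ ((e c).2 : ℕ) else 0)
      = 0 := by
    have h0 : ∑ T ∈ (e c0).1.1.powerset, (-1 : ℤ) ^ T.card *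
        ∑ c, (if T ∩ (e c).1.1 ∈ F (e c) then z c else 0) = 0 := by
      apply Finset.sum_eq_zero
      intro T _
      rw [← Finset.sum_filter, hA T, mul_zero]
    refine Eq.trans ?_ h0
    simp_rw [Finset.mul_sum]
    rw [Finset.sum_comm]
    apply Finset.sum_congr rfl
    intro c _
    by_cases hzc : z c = 0
    · simp [hzc]
    have e1 : ∀ T : Finset (Fin m), (-1 : ℤ) ^ T.card *
        (if T ∩ (e c).1.1 ∈ F (e c) then z c else 0) =
        z c * ((-1 : ℤ) ^ T.card * (if T ∩ (e c).1.1 ∈ F (e c) then 1 else 0)) := by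
      intro T; split_ifs <;> ring
    simp_rw [e1]
    rw [← Finset.mul_sum]
    congr 1
    split_ifs with hS
    · rw [← hS]
      have e2 : ∑ T ∈ (e c).1.1.powerset, (-1 : ℤ) ^ T.card *
          (if T ∩ (e c).1.1 ∈ F (e c) then 1 else 0) =
          ∑ T ∈ (e c).1.1.powerset, if T ∈ F (e c) then (1 : ℤ) else 0 := by
        apply Finset.sum_congr rfl
        intro T hT
        rw [Finset.inter_eq_left.2 (Finset.mem_powerset.1 hT)]
        split_ifs with h
        · rw [(hF1 _ T h).2.neg_one_pow, one_mul]
        · simp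
      rw [e2, ← Finset.sum_filter]
      have e3 : ((e c).1.1.powerset.filter fun T => T ∈ F (e c)) = F (e c) := by
        ext T
        simp only [Finset.mem_filter, Finset.mem_powerset]
        exact ⟨fun h => h.2, fun h => ⟨(hF1 _ T h).1, h⟩⟩
      rw [e3, Finset.sum_const, hF2]
      simp
    · symm
      refine mm_toggle _ _ (fun hsub => hS ?_) (fun U => if U ∈ F (e c) then (1 : ℤ) else 0)
      exact Subtype.ext (Finset.eq_of_subset_of_card_le hsub (hmax c hzc)).symm
  rw [← Finset.add_sum_erase _ _ (Finset.mem_univ c1), if_pos hc1.2] at hsum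
  have hdvd : (2 * (k : ℤ) + 1) ^ (((e c1).2 : ℕ) + 1) ∣ ∑ c ∈ univ.erase c1,
      z c * (if (e c).1 = (e c0).1 then (2 * (k : ℤ) + 1) ^ ((e c).2 : ℕ) else 0) := by
    apply Finset.dvd_sum
    intro c hc
    have hcc := Finset.ne_of_mem_erase hc
    by_cases hzc : z c = 0
    · simp [hzc]
    split_ifs with hS
    · apply Dvd.dvd.mul_left
      apply pow_dvd_pow
      have h1 := hmin c ⟨hzc, hS⟩
      have h2 : ((e c).2 : ℕ) ≠ (e c1).2 := by
        intro h
        exact hcc (e.injective (Prod.ext (hS.trans hc1.2.symm) (Fin.ext h)))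
      omega
    · simp
  have hd2 : (2 * (k : ℤ) + 1) ^ (((e c1).2 : ℕ) + 1) ∣
      z c1 * (2 * (k : ℤ) + 1) ^ ((e c1).2 : ℕ) := by
    rw [eq_neg_of_add_eq_zero_left hsum]
    exact (dvd_neg).2 hdvd
  rw [pow_succ, mul_comm (z c1)] at hd2
  have hd3 := (mul_dvd_mul_iff_left (pow_ne_zero _ (by positivity))).1 hd2
  exact hc1.1 (Int.eq_zero_of_abs_lt_dvd hd3 (by have := hz c1; linarith))

/-- Nonadaptive ℓ₁-query Mastermind upper bound. -/
theorem mastermind_l1_upper :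
    ∃ C : ℝ, 0 < C ∧ ∀ n k : ℕ, 2 ≤ n → 1 ≤ k →
      ∃ (s : ℕ) (x : Fin s → Fin n → ℤ),
        (s : ℝ) ≤ C * (1 + min (n : ℝ)
            ((n : ℝ) * Real.log (2 * (k : ℝ) + 1) / Real.log (n : ℝ))) ∧
        (∀ j i, |x j i| ≤ (k : ℤ)) ∧
        Set.InjOn
          (fun y : Fin n → ℤ => fun j : Fin s =>
            ∑ i, |(y i : ℝ) - (x j i : ℝ)|)
          {y : Fin n → ℤ | ∀ i, |y i| ≤ (k : ℤ)} := by
  refine ⟨64, by norm_num, fun n k hn hk => ?_⟩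
  have hn1 : (2 : ℝ) ≤ n := by exact_mod_cast hn
  have hlogn : 0 < Real.log n := Real.log_pos (by linarith)
  have hk1 : (1 : ℝ) ≤ k := by exact_mod_cast hk
  have hlogq : 0 < Real.log (2 * (k : ℝ) + 1) := Real.log_pos (by linarith)
  have hlog : ∀ t : ℕ, n ≤ (2 * k + 1) ^ t →
      Real.log n ≤ t * Real.log (2 * (k : ℝ) + 1) := by
    intro t ht
    rw [← Real.log_pow]
    apply Real.log_le_log (by linarith)
    exact_mod_cast ht
  by_cases hA : n < (2 * k + 1) ^ 8
  · obtain ⟨x, hx1, hx2⟩ := mm_corner n k (Fin n) (fun j => {j}) (fun z _ h => by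
      funext i; simpa using h i)
    refine ⟨_, x, ?_, hx1, hx2⟩
    have h1 := hlog 8 hA.le
    have h2 : (n : ℝ) / 8 ≤ min (n : ℝ)
        ((n : ℝ) * Real.log (2 * (k : ℝ) + 1) / Real.log (n : ℝ)) := by
      apply le_min (by linarith)
      rw [le_div_iff₀ hlogn]
      push_cast at h1
      nlinarith
    rw [Fintype.card_fin]
    push_cast
    linarith
  · push Not at hA
    set q := 2 * k + 1 with hq
    have hq3 : 3 ≤ q := by omega
    have hQ1 : 1 < q ^ 8 := Nat.one_lt_pow (by norm_num) (by omega)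
    set r := Nat.log (q ^ 8) n with hr
    have hr1 : 1 ≤ r := Nat.log_pos hQ1 hA
    have hrle : (q ^ 8) ^ r ≤ n := Nat.pow_log_le_self _ (by omega)
    have hrlt : n < (q ^ 8) ^ (r + 1) := Nat.lt_pow_succ_log_self hQ1 _
    -- choose m
    have hex : ∃ t, n ≤ 2 ^ t * r :=
      ⟨n, (Nat.lt_two_pow_self).le.trans (Nat.le_mul_of_pos_right _ hr1)⟩
    classical
    obtain ⟨t, ht, htmin⟩ : ∃ t, n ≤ 2 ^ t * r ∧ ∀ u < t, ¬ n ≤ 2 ^ u * r :=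
      ⟨Nat.find hex, Nat.find_spec hex, fun u hu => Nat.find_min hex hu⟩
    have hrQ : r ≤ q ^ r := (Nat.lt_pow_self (by omega)).le
    have hQ3 : 3 ≤ q ^ r := hq3.trans (Nat.le_self_pow (by omega) _)
    have hQ7 : (q ^ r) ^ 7 ≤ 2 ^ t := by
      have h1 : (q ^ r) ^ 7 * q ^ r ≤ 2 ^ t * q ^ r := by
        calc (q ^ r) ^ 7 * q ^ r = (q ^ 8) ^ r := by rw [← pow_succ, ← pow_mul, ← pow_mul, mul_comm]
          _ ≤ n := hrle
          _ ≤ 2 ^ t * r := ht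
          _ ≤ _ := Nat.mul_le_mul_left _ hrQ
      exact Nat.le_of_mul_le_mul_right h1 (by omega)
    have ht7 : 7 ≤ t := by
      have h2 : 2 ^ 7 ≤ 2 ^ t := le_trans (Nat.pow_le_pow_left (by omega) 7) hQ7
      exact (Nat.pow_le_pow_iff_right (by norm_num)).1 h2
    obtain ⟨A, hdet⟩ := mm_detect n k (t + 1) r (by omega) (by simpa using ht) (by
      intro h i hh hi
      have h1 : q ^ i ≤ q ^ r := Nat.pow_le_pow_right (by omega) hi.le
      refine h1.trans ?_
      have h2 : (q ^ r) ^ 7 ≤ (2 ^ (h - 1)) ^ 7 := by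
        rw [← pow_mul 2]
        exact hQ7.trans (Nat.pow_le_pow_right (by norm_num) (show t ≤ (h - 1) * 7 by omega))
      exact (Nat.pow_le_pow_iff_left (by norm_num)).1 h2)
    obtain ⟨x, hx1, hx2⟩ := mm_corner n k _ A hdet
    refine ⟨_, x, ?_, hx1, hx2⟩
    rw [Fintype.card_finset, Fintype.card_fin]
    obtain ⟨u, rfl⟩ : ∃ u, t = u + 1 := ⟨t - 1, by omega⟩
    have hu := htmin u (by omega)
    push Not at hu
    have hu' : (2 : ℝ) ^ u * r ≤ n := by exact_mod_cast hu.le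
    have hr1' : (1 : ℝ) ≤ r := by exact_mod_cast hr1
    have h1 := hlog (8 * (r + 1)) (by rw [pow_mul]; exact hrlt.le)
    have hp : (0 : ℝ) < 2 ^ u := by positivity
    have h2 : (2 : ℝ) ^ u / 16 ≤ min (n : ℝ)
        ((n : ℝ) * Real.log (2 * (k : ℝ) + 1) / Real.log (n : ℝ)) := by
      apply le_min
      · have h4 := le_mul_of_one_le_right hp.le hr1'
        linarith
      · rw [le_div_iff₀ hlogn]
        push_cast at h1
        have h3 : Real.log n ≤ 16 * r * Real.log (2 * (k : ℝ) + 1) := by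
          refine h1.trans (mul_le_mul_of_nonneg_right ?_ hlogq.le)
          linarith
        calc (2 : ℝ) ^ u / 16 * Real.log n
            ≤ (2 : ℝ) ^ u / 16 * (16 * r * Real.log (2 * (k : ℝ) + 1)) := by gcongr
          _ = (2 : ℝ) ^ u * r * Real.log (2 * (k : ℝ) + 1) := by ring
          _ ≤ _ := by gcongr
    push_cast
    rw [pow_succ, pow_succ]
    linarith
end

section
/- Let n ≥ 2 and k ≥ 1 be integers and let g₁,…,g_n : ℝ → ℝ be arbitrary functions. Define f : ℝ^n → ℝ by f(x) = Σᵢ gᵢ(|x_i|). For each i set hᵢ(x) = gᵢ(k − x) and (hᵢ)_odd(x) = (hᵢ(x) − hᵢ(−x))/2; let Mᵢ^min and Mᵢ^max be the minimum and maximum of (hᵢ)_odd over the integers in [−k,k]; let Δᵢ be the minimum of |(hᵢ)_odd(x₁) − (hᵢ)_odd(x₂)| over distinct integers x₁ ≠ x₂ in [−k,k]; let Δ = minᵢ Δᵢ and dᵢ = ⌈(Mᵢ^max − Mᵢ^min)/Δ⌉ + 1. Then there is an absolute constant C > 0 such that if Δ > 0, there exist an integer s with s ≤ C·(1 + min{n,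 (Σᵢ log dᵢ)/log n}) and query vectors x₁,…,x_s ∈ {−k,…,k}^n such that the map y ↦ (f(y − x₁), …, f(y − x_s)) is injective on {−k,−k+1,…,k−1,k}^n. -/
open Finset in
lemma mm_lo {ι : Type*} [Fintype ι] [DecidableEq ι] (w : ι → ℝ) (hw : ∀ i, w i ≠ 0) :
    (univ.filter (fun A : Finset ι => ∑ i ∈ A, w i = 0)).card
      ≤ (Fintype.card ι).choose (Fintype.card ι / 2) := by
  classical
  set N : Finset ι := univ.filter (fun i => w i < 0) with hN
  set G := univ.filter (fun A : Finset ι => ∑ i ∈ A, w i = 0) with hG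
  have key : ∀ A : Finset ι, ∑ i ∈ symmDiff A N, |w i| = ∑ i ∈ A, w i + ∑ i ∈ N, |w i| := by
    intro A
    have e : ∀ (B : Finset ι) (f : ι → ℝ), ∑ i ∈ B, f i = ∑ i, if i ∈ B then f i else 0 := by
      intro B f
      simp
    rw [e, e A, e N, ← Finset.sum_add_distrib]
    apply Finset.sum_congr rfl
    intro i _
    by_cases hA : i ∈ A <;> by_cases hi : w i < 0 <;>
      simp [Finset.mem_symmDiff, hA, hN, hi, abs_of_neg, abs_of_nonneg, le_of_not_gt]
  have hinj : Function.Injective (fun A : Finset ι => symmDiff A N) := symmDiff_left_injective N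
  rw [← Finset.card_image_of_injective G hinj]
  apply IsAntichain.sperner
  intro A hA B hB hne hle
  simp only [coe_image, Set.mem_image, mem_coe] at hA hB
  obtain ⟨A', hA', rfl⟩ := hA
  obtain ⟨B', hB', rfl⟩ := hB
  simp only [hG, mem_filter, mem_univ, true_and] at hA' hB'
  have h1 := key A'
  have h2 := key B'
  rw [hA'] at h1
  rw [hB'] at h2
  have hss : symmDiff A' N ⊂ symmDiff B' N := lt_of_le_of_ne hle hne
  obtain ⟨i, hi, hi'⟩ := Finset.exists_of_ssubset hss
  have := Finset.sum_lt_sum_of_subset (f := fun i => |w i|) hss.1 hi hi' (abs_pos.mpr (hw i))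
    (fun j _ _ => abs_nonneg _)
  linarith

lemma mm_central (t : ℕ) : (t.centralBinom) ^ 2 * (2 * t + 1) ≤ 16 ^ t := by
  induction t with
  | zero => simp
  | succ t ih =>
    have h := Nat.succ_mul_centralBinom_succ t
    have h2 : (t + 1) ^ 2 * ((t + 1).centralBinom ^ 2 * (2 * (t + 1) + 1))
        ≤ (t + 1) ^ 2 * 16 ^ (t + 1) := by
      calc (t + 1) ^ 2 * ((t + 1).centralBinom ^ 2 * (2 * (t + 1) + 1))
          = ((t + 1) * (t + 1).centralBinom) ^ 2 * (2 * t + 3) := by ring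
        _ = 4 * ((2 * t + 1) * (2 * t + 3)) * (t.centralBinom ^ 2 * (2 * t + 1)) := by
            rw [h]; ring
        _ ≤ 4 * (4 * (t + 1) ^ 2) * 16 ^ t := by
            refine Nat.mul_le_mul (Nat.mul_le_mul_left 4 ?_) ih
            nlinarith
        _ = _ := by ring
    exact Nat.le_of_mul_le_mul_left h2 (by positivity)

lemma mm_choose (m : ℕ) : (m.choose (m / 2)) ^ 2 * (m + 1) ≤ 4 ^ m := by
  rcases Nat.even_or_odd' m with ⟨t, rfl | rfl⟩
  · have := mm_central t
    rw [Nat.centralBinom] at this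
    rw [Nat.mul_div_cancel_left _ (by norm_num), pow_mul]
    simpa using this
  · have h := mm_central (t + 1)
    have h2 : (t + 1).centralBinom = 2 * (2 * t + 1).choose t := by
      rw [Nat.centralBinom, show 2 * (t + 1) = 2 * t + 1 + 1 by ring, Nat.choose_succ_succ,
        Nat.choose_symm_half]
      ring
    rw [h2] at h
    rw [show (2 * t + 1) / 2 = t by omega]
    have h3 : (4 : ℕ) ^ (2 * t + 1) * 4 = 16 ^ (t + 1) := by
      rw [← pow_succ, show 2 * t + 1 + 1 = 2 * (t + 1) by ring, pow_mul]; norm_num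
    have h4 : (2 * (2 * t + 1).choose t) ^ 2 * (2 * (t + 1) + 1) =
      4 * ((2 * t + 1).choose t ^ 2 * (2 * t + 1 + 1)) + 4 * (2 * t + 1).choose t ^ 2 := by ring
    omega

open Finset in
lemma mm_count {n : ℕ} (w : Fin n → ℝ) :
    (univ.filter (fun A : Finset (Fin n) => ∑ i ∈ A, w i = 0)).card ^ 2 *
      ((univ.filter (fun i => w i ≠ 0)).card + 1) ≤ 4 ^ n := by
  classical
  set S := {i // w i ≠ 0}
  set T := {i // ¬ (w i ≠ 0)}
  have hS : (univ.filter (fun i => w i ≠ 0)).card = Fintype.card S := by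
    rw [Fintype.card_subtype]
  have hST : Fintype.card S + Fintype.card T = n := by
    have := Fintype.card_subtype_compl (fun i => w i ≠ 0)
    have h2 := Fintype.card_subtype_le (fun i => w i ≠ 0)
    simp only [Fintype.card_fin] at this h2
    show Fintype.card {i // w i ≠ 0} + Fintype.card {i // ¬ (w i ≠ 0)} = n
    omega
  have hlo := mm_lo (fun i : S => w i.1) (fun i => i.2)
  have hle : (univ.filter (fun A : Finset (Fin n) => ∑ i ∈ A, w i = 0)).card ≤
      (Fintype.card S).choose (Fintype.card S / 2) * 2 ^ Fintype.card T := by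
    have h1 : (univ.filter (fun A : Finset (Fin n) => ∑ i ∈ A, w i = 0)).card ≤
      ((univ.filter (fun A : Finset S => ∑ i ∈ A, w i.1 = 0)) ×ˢ
        (univ : Finset (Finset T))).card := by
      apply Finset.card_le_card_of_injOn
        (fun A => (A.subtype (fun i => w i ≠ 0), A.subtype (fun i => ¬ (w i ≠ 0))))
      · intro A hA
        simp only [coe_filter, mem_univ, true_and, Set.mem_ofPred_eq] at hA
        simp only [mem_coe, mem_product, mem_filter, mem_univ, true_and, and_true]
        refine Eq.trans ?_ hA
        exact (Finset.sum_subtype_eq_sum_filter w).trans (Finset.sum_filter_ne_zero A)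
      · intro A _ B _ hAB
        simp only [Prod.mk.injEq] at hAB
        ext i
        by_cases hi : w i ≠ 0
        · have := Finset.ext_iff.mp hAB.1 ⟨i, hi⟩
          rwa [Finset.mem_subtype, Finset.mem_subtype] at this
        · have := Finset.ext_iff.mp hAB.2 ⟨i, hi⟩
          rwa [Finset.mem_subtype, Finset.mem_subtype] at this
    rw [card_product, card_univ, Fintype.card_finset] at h1
    exact h1.trans (Nat.mul_le_mul_right _ hlo)
  rw [hS]
  calc _ ≤ ((Fintype.card S).choose (Fintype.card S / 2) * 2 ^ Fintype.card T) ^ 2 *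
        (Fintype.card S + 1) := by gcongr
    _ = ((Fintype.card S).choose (Fintype.card S / 2) ^ 2 * (Fintype.card S + 1)) *
        4 ^ Fintype.card T := by
        rw [mul_pow, ← pow_mul, mul_comm _ 2, pow_mul]; norm_num; ring
    _ ≤ 4 ^ Fintype.card S * 4 ^ Fintype.card T := by
        gcongr; exact mm_choose _
    _ = 4 ^ n := by rw [← pow_add, hST]

lemma mm_num (n r s : ℝ) (hn : 2 ≤ n) (hr : 9 ≤ r)
    (hs : 100 * n * Real.log r ≤ s * Real.log n) :
    Real.sqrt n * Real.log (n * r) + 3 ≤ s * Real.log 2 / 2 ∧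
    n * Real.log r + 2 ≤ s * Real.log n / 4 := by
  have hL : 2 ≤ Real.log r := by
    have h3 : Real.exp 1 < 3 := by have := Real.exp_one_lt_d9; linarith
    rw [Real.le_log_iff_exp_le (by linarith)]
    have : Real.exp 2 = Real.exp 1 * Real.exp 1 := by rw [← Real.exp_add]; norm_num
    have := Real.exp_pos 1
    nlinarith
  have hln : 0 < Real.log n := Real.log_pos (by linarith)
  constructor
  · set t := Real.sqrt (Real.sqrt n) with ht
    have ht0 : 0 < t := by positivity
    have ht2 : Real.sqrt n = t ^ 2 := by rw [ht, Real.sq_sqrt (by positivity)]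
    have hn4 : n = t ^ 4 := by
      have : n = (Real.sqrt n) ^ 2 := by rw [Real.sq_sqrt (by linarith)]
      rw [this, ht2]; ring
    have ht1 : 1 ≤ t := by
      by_contra h
      push Not at h
      have : t ^ 4 ≤ 1 := pow_le_one₀ ht0.le h.le
      linarith
    have hlt : Real.log n ≤ 4 * t := by
      rw [hn4, Real.log_pow]
      have := Real.log_le_sub_one_of_pos ht0
      push_cast; linarith
    rw [Real.log_mul (by linarith) (by linarith), ht2]
    have hl2 : 0.69 ≤ Real.log 2 := by have := Real.log_two_gt_d9; linarith
    set l := Real.log n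
    set L := Real.log r
    refine le_of_mul_le_mul_right ?_ hln
    have e1 : t ^ 2 * l * l ≤ 16 * t ^ 4 := by
      have : l * l ≤ (4 * t) * (4 * t) := by gcongr
      nlinarith [sq_nonneg t]
    have t34 : t ^ 3 ≤ t ^ 4 := pow_le_pow_right₀ ht1 (by norm_num)
    have t14 : t ≤ t ^ 4 := le_self_pow₀ ht1 (by norm_num)
    have e2 : t ^ 2 * L * l ≤ 4 * t ^ 4 * L := by
      have : t ^ 2 * L * l ≤ t ^ 2 * L * (4 * t) := by gcongr
      nlinarith
    have e3 : 3 * l ≤ 12 * t ^ 4 := by linarith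
    have e4 : 2 * t ^ 4 ≤ t ^ 4 * L := by nlinarith [pow_pos ht0 4]
    have e5 : 100 * t ^ 4 * L * 0.69 ≤ s * l * Real.log 2 := by
      rw [← hn4]
      have : 0 ≤ 100 * n * L := by positivity
      nlinarith
    nlinarith
  · nlinarith

open Finset in
lemma mm_detect_s3 (n r s : ℕ) (hn : 2 ≤ n) (hr : 9 ≤ r)
    (hs : 100 * (n : ℝ) * Real.log r ≤ s * Real.log n)
    (D : Fin n → Finset ℝ) (h0 : ∀ i, 0 ∈ D i) (hD : ∀ i, (D i).card ≤ r) :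
    ∃ A : Fin s → Finset (Fin n), ∀ w ∈ Fintype.piFinset D,
      (∀ j, ∑ i ∈ A j, w i = 0) → w = 0 := by
  classical
  obtain ⟨hnum1, hnum2⟩ := mm_num n r s (by exact_mod_cast hn) (by exact_mod_cast hr) hs
  by_contra hcon
  push Not at hcon
  set G : (Fin n → ℝ) → Finset (Finset (Fin n)) :=
    fun w => univ.filter (fun A => ∑ i ∈ A, w i = 0) with hG
  set m : (Fin n → ℝ) → ℕ := fun w => (univ.filter (fun i => w i ≠ 0)).card with hm
  set W := (Fintype.piFinset D).filter (fun w => w ≠ 0) with hW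
  have hn0 : (0 : ℝ) < n := by positivity
  have hr0 : (0 : ℝ) < r := by positivity
  have hcover : (univ : Finset (Fin s → Finset (Fin n))) ⊆
      W.biUnion (fun w => Fintype.piFinset (fun _ => G w)) := by
    intro A _
    obtain ⟨w, hw, hA, hne⟩ := hcon A
    simp only [mem_biUnion, Fintype.mem_piFinset, hG, mem_filter, mem_univ, true_and, hW]
    exact ⟨w, ⟨Fintype.mem_piFinset.mp hw, hne⟩, hA⟩
  have hcard : (2 ^ n) ^ s ≤ ∑ w ∈ W, (G w).card ^ s := by
    have := (card_le_card hcover).trans card_biUnion_le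
    simpa [Fintype.card_piFinset] using this
  -- probabilities
  set P : (Fin n → ℝ) → ℝ := fun w => (G w).card / 2 ^ n with hP
  have hP0 : ∀ w, 0 ≤ P w := fun w => by positivity
  have hPm : ∀ w, P w ^ 2 * (m w + 1) ≤ 1 := by
    intro w
    have h := mm_count w
    have hcast : ((G w).card : ℝ) ^ 2 * (m w + 1) ≤ 4 ^ n := by exact_mod_cast h
    have h4 : ((2 : ℝ) ^ n) ^ 2 = 4 ^ n := by rw [← pow_mul, mul_comm, pow_mul]; norm_num
    simp only [hP]
    rw [div_pow, h4, div_mul_eq_mul_div, div_le_one (by positivity)]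
    exact hcast
  have hsum : 1 ≤ ∑ w ∈ W, P w ^ s := by
    have hcast : (((2 : ℝ) ^ n) ^ s) ≤ ∑ w ∈ W, ((G w).card : ℝ) ^ s := by exact_mod_cast hcard
    simp only [hP, div_pow]
    rw [← Finset.sum_div, le_div_iff₀ (by positivity), one_mul]
    exact hcast
  -- general bound: if a ≤ m+1 then P^s ≤ exp(-s log a/2)
  have hPexp : ∀ w (a : ℝ), 0 < a → a ≤ m w + 1 → P w ^ s ≤ Real.exp (-(s * Real.log a / 2)) := by
    intro w a ha ham
    have h1 : P w ^ 2 ≤ (Real.exp (-(Real.log a / 2))) ^ 2 := by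
      rw [← Real.exp_nat_mul]
      have : ((2 : ℕ) : ℝ) * -(Real.log a / 2) = - Real.log a := by push_cast; ring
      rw [this, Real.exp_neg, Real.exp_log ha, ← one_div, le_div_iff₀ ha]
      have := hPm w
      nlinarith [sq_nonneg (P w)]
    have h2 : P w ≤ Real.exp (-(Real.log a / 2)) :=
      le_of_sq_le_sq h1 (Real.exp_pos _).le
    calc P w ^ s ≤ (Real.exp (-(Real.log a / 2))) ^ s := pow_le_pow_left₀ (hP0 w) h2 s
      _ = _ := by rw [← Real.exp_nat_mul]; congr 1; ring
  have hlarge : ∀ w ∈ W, n ≤ (m w) ^ 2 → P w ^ s ≤ Real.exp (-(n * Real.log r + 2)) := by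
    intro w hw hmw
    have h1 : Real.sqrt n ≤ m w + 1 := by
      have : Real.sqrt n ≤ m w := by
        rw [Real.sqrt_le_left (by positivity)]
        exact_mod_cast hmw
      linarith
    refine (hPexp w (Real.sqrt n) (by positivity) h1).trans ?_
    rw [Real.log_sqrt hn0.le]
    apply Real.exp_le_exp.mpr
    linarith
  have hsmall : ∀ w ∈ W, (m w) ^ 2 < n →
      P w ^ s ≤ Real.exp (-3) * ∏ i, (if w i = 0 then (1 : ℝ) else 1 / (n * r)) := by
    intro w hw hmw
    have hprod : ∏ i, (if w i = 0 then (1 : ℝ) else 1 / (n * r)) = (1 / (n * r : ℝ)) ^ (m w) := by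
      rw [Finset.prod_ite]
      simp [hm]
    have hm1 : 1 ≤ m w := by
      have hne : w ≠ 0 := (mem_filter.mp hw).2
      obtain ⟨i, hi⟩ := Function.ne_iff.mp hne
      exact Finset.card_pos.mpr ⟨i, by simpa using hi⟩
    have h2 : (2 : ℝ) ≤ m w + 1 := by
      have : (1 : ℝ) ≤ m w := by exact_mod_cast hm1
      linarith
    refine (hPexp w 2 (by norm_num) h2).trans ?_
    have hmn : (m w : ℝ) ≤ Real.sqrt n := by
      apply Real.le_sqrt_of_sq_le
      exact_mod_cast hmw.le
    have hnr : 0 ≤ Real.log (n * r) := by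
      apply Real.log_nonneg
      have : 1 ≤ n * r := Nat.one_le_iff_ne_zero.mpr (by positivity)
      exact_mod_cast this
    rw [hprod]
    have : (1 / (n * r : ℝ)) = Real.exp (-Real.log (n * r)) := by
      rw [Real.exp_neg, Real.exp_log (by positivity), one_div]
    rw [this, ← Real.exp_nat_mul, ← Real.exp_add]
    apply Real.exp_le_exp.mpr
    have := mul_le_mul_of_nonneg_right hmn hnr
    linarith
  have hgen : ∑ w ∈ Fintype.piFinset D, ∏ i, (if w i = 0 then (1 : ℝ) else 1 / (n * r))
      ≤ Real.exp 1 := by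
    rw [← Finset.prod_univ_sum D (fun i x => if x = 0 then (1 : ℝ) else 1 / (n * r))]
    have h1 : ∀ i ∈ (univ : Finset (Fin n)),
        ∑ x ∈ D i, (if x = 0 then (1 : ℝ) else 1 / (n * r)) ≤ Real.exp (1 / n) := by
      intro i _
      have h2 : ∑ x ∈ D i, (if x = 0 then (1 : ℝ) else 1 / (n * r)) ≤
          ∑ x ∈ D i, ((if x = 0 then (1 : ℝ) else 0) + 1 / (n * r)) := by
        apply Finset.sum_le_sum
        intro x _
        have : (0 : ℝ) ≤ 1 / (n * r) := by positivity
        split_ifs <;> linarith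
      refine h2.trans ?_
      rw [Finset.sum_add_distrib, Finset.sum_ite_eq', if_pos (h0 i), sum_const, nsmul_eq_mul]
      have h3 : ((D i).card : ℝ) * (1 / (n * r)) ≤ r * (1 / (n * r)) := by
        gcongr
        exact_mod_cast hD i
      have h4 : (r : ℝ) * (1 / (n * r)) = 1 / n := by field_simp
      have := Real.add_one_le_exp (1 / (n : ℝ))
      linarith
    refine (Finset.prod_le_prod (fun i _ => ?_) h1).trans ?_
    · apply Finset.sum_nonneg
      intro x _
      split_ifs <;> positivity
    · rw [prod_const, ← Real.exp_nat_mul, card_univ, Fintype.card_fin]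
      apply Real.exp_le_exp.mpr
      field_simp
      exact le_refl _
  have hWcard : (W.card : ℝ) ≤ Real.exp (n * Real.log r) := by
    rw [Real.exp_nat_mul, Real.exp_log hr0]
    have : W.card ≤ r ^ n := by
      refine (card_filter_le _ _).trans ?_
      rw [Fintype.card_piFinset]
      refine (Finset.prod_le_prod' (fun i _ => hD i)).trans ?_
      simp
    exact_mod_cast this
  have hfin : ∑ w ∈ W, P w ^ s ≤ Real.exp (-2) + Real.exp (-2) := by
    calc ∑ w ∈ W, P w ^ s ≤ ∑ w ∈ W, (Real.exp (-(n * Real.log r + 2)) +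
          Real.exp (-3) * ∏ i, (if w i = 0 then (1 : ℝ) else 1 / (n * r))) := by
          apply Finset.sum_le_sum
          intro w hw
          have p1 : 0 ≤ Real.exp (-(n * Real.log r + 2)) := (Real.exp_pos _).le
          have p2 : 0 ≤ Real.exp (-3) * ∏ i, (if w i = 0 then (1 : ℝ) else 1 / (n * r)) := by
            apply mul_nonneg (Real.exp_pos _).le
            apply Finset.prod_nonneg
            intro i _
            split_ifs <;> positivity
          rcases le_or_gt n ((m w) ^ 2) with h | h
          · have := hlarge w hw h
            linarith
          · have := hsmall w hw h
            linarith
      _ = W.card * Real.exp (-(n * Real.log r + 2)) + Real.exp (-3) *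
          ∑ w ∈ W, ∏ i, (if w i = 0 then (1 : ℝ) else 1 / (n * r)) := by
          rw [Finset.sum_add_distrib, sum_const, nsmul_eq_mul, Finset.mul_sum]
      _ ≤ Real.exp (n * Real.log r) * Real.exp (-(n * Real.log r + 2)) +
          Real.exp (-3) * Real.exp 1 := by
          gcongr
          refine le_trans ?_ hgen
          apply Finset.sum_le_sum_of_subset_of_nonneg (filter_subset _ _)
          intro w _ _
          apply Finset.prod_nonneg
          intro i _
          split_ifs <;> positivity
      _ = _ := by
          rw [← Real.exp_add, ← Real.exp_add]
          congr 2 <;> ring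
  have he : Real.exp (-2) < 1 / 2 := by
    rw [Real.exp_neg, ← one_div]
    apply one_div_lt_one_div_of_lt (by norm_num)
    have := Real.add_one_lt_exp (x := 2) (by norm_num)
    linarith
  linarith

open Finset in
/-- A set of `2k+1` reals with gaps at least `Δ` has diameter at least `2kΔ`. -/
lemma mm_dk (k : ℕ) (h : ℤ → ℝ) (Δ : ℝ) (hΔ : 0 < Δ)
    (hsep : ∀ a ∈ Set.Icc (-(k : ℤ)) (k : ℤ), ∀ b ∈ Set.Icc (-(k : ℤ)) (k : ℤ),
      a ≠ b → Δ ≤ |h a - h b|) (a b : ℝ)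
    (ha : IsLeast (h '' Set.Icc (-(k : ℤ)) (k : ℤ)) a)
    (hb : IsGreatest (h '' Set.Icc (-(k : ℤ)) (k : ℤ)) b) (d : ℤ)
    (hd : d = ⌈(b - a) / Δ⌉ + 1) : (2 * k + 1 : ℤ) ≤ d := by
  -- the floors of `(h x - a)/Δ` are distinct integers in `[0, ⌊(b-a)/Δ⌋]`
  have hcard : (Finset.Icc (-(k : ℤ)) (k : ℤ)).card ≤
      (Finset.Icc (0 : ℤ) ⌊(b - a) / Δ⌋).card := by
    apply Finset.card_le_card_of_injOn (fun x => ⌊(h x - a) / Δ⌋)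
    · intro x hx
      have hx' : x ∈ Set.Icc (-(k : ℤ)) (k : ℤ) := by simpa using hx
      have h1 := ha.2 ⟨x, hx', rfl⟩
      have h2 := hb.2 ⟨x, hx', rfl⟩
      simp only [coe_Icc, Set.mem_Icc]
      constructor
      · apply Int.floor_nonneg.mpr
        apply div_nonneg (by linarith) hΔ.le
      · apply Int.floor_le_floor
        gcongr
    · intro x hx y hy hxy
      by_contra hne
      have h1 := hsep x (by simpa using hx) y (by simpa using hy) hne
      have h2 := Int.abs_sub_lt_one_of_floor_eq_floor hxy
      rw [← sub_div, abs_div, abs_of_pos hΔ, div_lt_one hΔ] at h2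
      have h3 : h x - a - (h y - a) = h x - h y := by ring
      rw [h3] at h2
      linarith
  rw [Int.card_Icc, Int.card_Icc] at hcard
  have := Int.floor_le_ceil ((b - a) / Δ)
  omega

open Finset in
lemma mm_red (n k : ℕ) (g : Fin n → ℝ → ℝ) (hodd : Fin n → ℤ → ℝ)
    (hh : ∀ i (x : ℤ), hodd i x = (g i ((k : ℝ) - (x : ℝ)) - g i ((k : ℝ) + (x : ℝ))) / 2)
    (s : ℕ) (A : Fin s → Finset (Fin n))
    (hA : ∀ y z : Fin n → ℤ, (∀ i, |y i| ≤ (k : ℤ)) → (∀ i, |z i| ≤ (k : ℤ)) →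
        (∀ j, ∑ i ∈ A j, (hodd i (y i) - hodd i (z i)) = 0) → y = z) :
      ∃ x : Fin (s + 1) → Fin n → ℤ, (∀ j i, |x j i| ≤ (k : ℤ)) ∧
        Set.InjOn
        (fun y : Fin n → ℤ => fun j : Fin (s + 1) => ∑ i, g i |(y i : ℝ) - (x j i : ℝ)|)
        {y : Fin n → ℤ | ∀ i, |y i| ≤ (k : ℤ)} := by
  classical
  let B : Fin (s + 1) → Finset (Fin n) := Fin.cons ∅ A
  refine ⟨fun j i => if i ∈ B j then (k : ℤ) else -(k : ℤ), ?_, ?_⟩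
  · intro j i
    dsimp only
    split_ifs <;> simp
  · have key : ∀ y : Fin n → ℤ, (∀ i, |y i| ≤ (k : ℤ)) → ∀ j : Fin (s + 1),
        ∑ i, g i |(y i : ℝ) - ((if i ∈ B j then (k : ℤ) else -(k : ℤ) : ℤ) : ℝ)| =
        ∑ i, g i ((k : ℝ) + y i) + 2 * ∑ i ∈ B j, hodd i (y i) := by
      intro y hy j
      have e : ∑ i ∈ B j, hodd i (y i) = ∑ i, if i ∈ B j then hodd i (y i) else 0 := by simp
      rw [e, Finset.mul_sum, ← Finset.sum_add_distrib]
      apply Finset.sum_congr rfl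
      intro i _
      have h1 := abs_le.mp (hy i)
      have h2 : -(k : ℝ) ≤ y i := by exact_mod_cast h1.1
      have h3 : (y i : ℝ) ≤ k := by exact_mod_cast h1.2
      split_ifs with hi
      · have : |(y i : ℝ) - ((k : ℤ) : ℝ)| = k - y i := by
          rw [abs_of_nonpos (by push_cast; linarith)]; push_cast; ring
        rw [this, hh]; ring
      · have : |(y i : ℝ) - ((-(k : ℤ) : ℤ) : ℝ)| = k + y i := by
          rw [abs_of_nonneg (by push_cast; linarith)]; push_cast; ring
        rw [this]; ring
    intro y hy z hz hyz
    refine hA y z hy hz ?_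
    intro j
    have h0 := congrFun hyz 0
    have hj := congrFun hyz j.succ
    dsimp only at h0 hj
    rw [key y hy, key z hz] at h0 hj
    have hB0 : B 0 = ∅ := rfl
    have hBj : B j.succ = A j := rfl
    rw [hB0] at h0
    rw [hBj] at hj
    simp only [sum_empty] at h0
    rw [Finset.sum_sub_distrib]
    linarith

/-- Nonadaptive recovery for separable distance queries `f(x) = Σᵢ gᵢ(|xᵢ|)`.
`hodd i` is the odd part of `x ↦ gᵢ(k − x)`, `Mmin i`/`Mmax i` its min/max over the
integers of `[-k, k]`, `Δi i` the minimal gap of `hodd i` over distinct integers of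
`[-k, k]`, `Δ = minᵢ Δi i`, and `d i = ⌈(Mmax i − Mmin i)/Δ⌉ + 1`. If `Δ > 0` then
`O(1 + min{n, (Σᵢ log dᵢ)/log n})` nonadaptive queries in `{-k,…,k}^n` determine any
hidden vector `y ∈ {-k,…,k}^n` exactly. -/
theorem mastermind_separable_upper :
    ∃ C : ℝ, 0 < C ∧
    ∀ (n k : ℕ), 2 ≤ n → 1 ≤ k →
    ∀ g : Fin n → ℝ → ℝ,
    ∀ hodd : Fin n → ℤ → ℝ,
    (∀ i (x : ℤ), hodd i x = (g i ((k : ℝ) - (x : ℝ)) - g i ((k : ℝ) + (x : ℝ))) / 2) →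
    ∀ (Mmin Mmax Δi : Fin n → ℝ) (Δ : ℝ) (d : Fin n → ℤ),
    (∀ i, IsLeast (hodd i '' Set.Icc (-(k : ℤ)) (k : ℤ)) (Mmin i)) →
    (∀ i, IsGreatest (hodd i '' Set.Icc (-(k : ℤ)) (k : ℤ)) (Mmax i)) →
    (∀ i, IsLeast {r : ℝ | ∃ x₁ ∈ Set.Icc (-(k : ℤ)) (k : ℤ),
        ∃ x₂ ∈ Set.Icc (-(k : ℤ)) (k : ℤ),
        x₁ ≠ x₂ ∧ r = |hodd i x₁ - hodd i x₂|} (Δi i)) →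
    IsLeast (Set.range Δi) Δ →
    (∀ i, d i = ⌈(Mmax i - Mmin i) / Δ⌉ + 1) →
    0 < Δ →
    ∃ (s : ℕ) (x : Fin s → Fin n → ℤ),
      (s : ℝ) ≤ C * (1 + min (n : ℝ) ((∑ i, Real.log ((d i : ℝ))) / Real.log (n : ℝ))) ∧
      (∀ j i, |x j i| ≤ (k : ℤ)) ∧
      Set.InjOn
        (fun y : Fin n → ℤ => fun j : Fin s => ∑ i, g i |(y i : ℝ) - (x j i : ℝ)|)
        {y : Fin n → ℤ | ∀ i, |y i| ≤ (k : ℤ)} := by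
  refine ⟨202, by norm_num, ?_⟩
  intro n k hn hk g hodd hh Mmin Mmax Δi Δ d hMin hMax hΔi hΔ hd hΔ0
  -- separation
  have hsep : ∀ i, ∀ a ∈ Set.Icc (-(k : ℤ)) (k : ℤ), ∀ b ∈ Set.Icc (-(k : ℤ)) (k : ℤ),
      a ≠ b → Δ ≤ |hodd i a - hodd i b| := by
    intro i a ha b hb hab
    exact (hΔ.2 ⟨i, rfl⟩).trans ((hΔi i).2 ⟨a, ha, b, hb, hab, rfl⟩)
  have hinj : ∀ i, ∀ a ∈ Set.Icc (-(k : ℤ)) (k : ℤ), ∀ b ∈ Set.Icc (-(k : ℤ)) (k : ℤ),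
      hodd i a - hodd i b = 0 → a = b := by
    intro i a ha b hb hab
    by_contra hne
    have := hsep i a ha b hb hne
    rw [hab, abs_zero] at this
    linarith
  have hdk : ∀ i, (2 * k + 1 : ℤ) ≤ d i := by
    intro i
    exact mm_dk k (hodd i) Δ hΔ0 (hsep i) _ _ (hMin i) (hMax i) _ (hd i)
  have hln : 0 < Real.log n := Real.log_pos (by exact_mod_cast (by omega : 1 < n))
  set q : ℝ := 2 * (k : ℝ) + 1 with hq
  have hk1 : (1 : ℝ) ≤ k := by exact_mod_cast hk
  have hX : (n : ℝ) * Real.log q ≤ ∑ i, Real.log (d i : ℝ) := by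
    have : ∑ i : Fin n, Real.log q ≤ ∑ i, Real.log (d i : ℝ) := by
      apply Finset.sum_le_sum
      intro i _
      apply Real.log_le_log (by positivity)
      have := hdk i
      rw [hq]
      exact_mod_cast this
    simpa using this
  -- any detecting family gives queries
  have hred : ∀ (s : ℕ) (A : Fin s → Finset (Fin n)),
      (∀ y z : Fin n → ℤ, (∀ i, |y i| ≤ (k : ℤ)) → (∀ i, |z i| ≤ (k : ℤ)) →
        (∀ j, ∑ i ∈ A j, (hodd i (y i) - hodd i (z i)) = 0) → y = z) →
      ∃ x : Fin (s + 1) → Fin n → ℤ, (∀ j i, |x j i| ≤ (k : ℤ)) ∧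
        Set.InjOn
        (fun y : Fin n → ℤ => fun j : Fin (s + 1) => ∑ i, g i |(y i : ℝ) - (x j i : ℝ)|)
        {y : Fin n → ℤ | ∀ i, |y i| ≤ (k : ℤ)} :=
    fun s A hA => mm_red n k g hodd hh s A hA
  rcases le_or_gt (n : ℝ) ((∑ i, Real.log (d i : ℝ)) / Real.log n) with hc | hc
  · obtain ⟨x, hx1, hx2⟩ := hred n (fun j => {j}) (by
      intro y z hy hz h
      funext i
      have := h i
      rw [Finset.sum_singleton] at this
      exact hinj i _ (abs_le.mp (hy i)) _ (abs_le.mp (hz i)) this)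
    refine ⟨n + 1, x, ?_, hx1, hx2⟩
    rw [min_eq_left hc]
    push_cast
    have : (0 : ℝ) ≤ n := by positivity
    linarith
  · set s := ⌈200 * ((n : ℝ) * Real.log q) / Real.log n⌉₊ with hs
    have hq0 : 0 ≤ Real.log q := Real.log_nonneg (by linarith)
    have hs1 : 200 * ((n : ℝ) * Real.log q) / Real.log n ≤ s := Nat.le_ceil _
    have hs2 : (s : ℝ) < 200 * ((n : ℝ) * Real.log q) / Real.log n + 1 :=
      Nat.ceil_lt_add_one (by positivity)
    have hsr : 100 * (n : ℝ) * Real.log (((2 * k + 1) ^ 2 : ℕ) : ℝ) ≤ s * Real.log n := by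
      rw [div_le_iff₀ hln] at hs1
      push_cast
      rw [← hq, Real.log_pow]
      push_cast
      linarith
    let I : Finset ℤ := Finset.Icc (-(k : ℤ)) (k : ℤ)
    let D : Fin n → Finset ℝ := fun i => (I ×ˢ I).image (fun p => hodd i p.1 - hodd i p.2)
    have hmem : ∀ a : ℤ, |a| ≤ (k : ℤ) → a ∈ I := fun a ha => Finset.mem_Icc.mpr (abs_le.mp ha)
    obtain ⟨A, hA⟩ := mm_detect_s3 n ((2 * k + 1) ^ 2) s hn
      (by have : 3 ≤ 2 * k + 1 := by omega
          nlinarith) hsr D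
      (by intro i
          refine Finset.mem_image.mpr ⟨(0, 0), ?_, by simp⟩
          have : (0 : ℤ) ∈ I := hmem 0 (by simp)
          exact Finset.mem_product.mpr ⟨this, this⟩)
      (by intro i
          refine Finset.card_image_le.trans ?_
          have : I.card = 2 * k + 1 := by
            simp only [I, Int.card_Icc]; omega
          rw [Finset.card_product, this, sq])
    obtain ⟨x, hx1, hx2⟩ := hred s A (by
      intro y z hy hz h
      have h1 := hA (fun i => hodd i (y i) - hodd i (z i)) (by
        rw [Fintype.mem_piFinset]
        intro i
        exact Finset.mem_image.mpr ⟨(y i, z i),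
          Finset.mem_product.mpr ⟨hmem _ (hy i), hmem _ (hz i)⟩, rfl⟩) h
      funext i
      exact hinj i _ (abs_le.mp (hy i)) _ (abs_le.mp (hz i)) (congrFun h1 i))
    refine ⟨s + 1, x, ?_, hx1, hx2⟩
    rw [min_eq_right hc.le]
    have h3 : (n : ℝ) * Real.log q / Real.log n ≤ (∑ i, Real.log (d i : ℝ)) / Real.log n := by
      gcongr
    have h4 : 0 ≤ (n : ℝ) * Real.log q / Real.log n := by positivity
    have h5 : 200 * ((n : ℝ) * Real.log q) / Real.log n
        = 200 * ((n : ℝ) * Real.log q / Real.log n) := by ring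
    push_cast
    linarith
end

section
/- For every real p with 1 ≤ p < ∞ there is a constant C_p > 0 (depending only on p) such that for all integers n ≥ 2 and k ≥ 1, there exist an integer s with s ≤ C_p·(1 + min{n, n·log(2k+1)/log n}) and query vectors x₁,…,x_s ∈ {−k,−k+1,…,k−1,k}^n such that the map y ↦ (‖y−x₁‖_p, …, ‖y−x_s‖_p) is injective on {−k,−k+1,…,k−1,k}^n. -/
/-- Upper bound on central binomial coefficients. -/
lemma aux_central (t : ℕ) : (2 * t + 1) * (Nat.centralBinom t) ^ 2 ≤ 16 ^ t := by
  induction t with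
  | zero => simp
  | succ t ih =>
    have h := Nat.succ_mul_centralBinom_succ t
    set a := Nat.centralBinom t
    set b := Nat.centralBinom (t + 1)
    have h2 : (t + 1) ^ 2 * b ^ 2 = 4 * (2 * t + 1) * ((2 * t + 1) * a ^ 2) := by
      calc (t + 1) ^ 2 * b ^ 2 = ((t + 1) * b) ^ 2 := by ring
        _ = _ := by rw [h]; ring
    have h3 : (t + 1) ^ 2 * ((2 * (t + 1) + 1) * b ^ 2) ≤ (t + 1) ^ 2 * 16 ^ (t + 1) := by
      calc (t + 1) ^ 2 * ((2 * (t + 1) + 1) * b ^ 2) = (2 * t + 3) * ((t + 1) ^ 2 * b ^ 2) := by ring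
        _ = (2 * t + 3) * (4 * (2 * t + 1)) * ((2 * t + 1) * a ^ 2) := by rw [h2]; ring
        _ ≤ (2 * t + 3) * (4 * (2 * t + 1)) * 16 ^ t := Nat.mul_le_mul_left _ ih
        _ ≤ ((t + 1) ^ 2 * 16) * 16 ^ t := by
            apply Nat.mul_le_mul_right
            nlinarith
        _ = _ := by ring
    exact Nat.le_of_mul_le_mul_left h3 (by positivity)

lemma aux_middle (m : ℕ) : (m + 1) * (m.choose (m / 2)) ^ 2 ≤ 4 ^ m := by
  rcases Nat.even_or_odd' m with ⟨t, rfl | rfl⟩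
  · have := aux_central t
    rw [Nat.centralBinom_eq_two_mul_choose] at this
    rw [show 2 * t / 2 = t by omega, pow_mul]
    simpa using this
  · have h := aux_central (t + 1)
    rw [Nat.centralBinom_eq_two_mul_choose] at h
    rw [show (2 * t + 1) / 2 = t by omega]
    have h1 : (2 * (t + 1)).choose (t + 1) = 2 * (2 * t + 1).choose t := by
      rw [show 2 * (t + 1) = (2 * t + 1) + 1 by ring, Nat.choose_succ_succ, Nat.choose_symm_half]
      ring
    rw [h1] at h
    have h4 : (4 : ℕ) ^ (2 * t + 1) * 4 = 16 ^ (t + 1) := by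
      rw [← pow_succ, show 2 * t + 1 + 1 = 2 * (t + 1) by ring, pow_mul]; norm_num
    nlinarith

/-- Littlewood-Offord via Sperner. -/
lemma aux_LO {ι : Type*} [Fintype ι] [DecidableEq ι] (d : ι → ℝ) (hd : ∀ i, d i ≠ 0) (c : ℝ) :
    (Finset.univ.filter (fun S : Finset ι => ∑ i ∈ S, d i = c)).card ≤
      (Fintype.card ι).choose (Fintype.card ι / 2) := by
  classical
  set N : Finset ι := Finset.univ.filter (fun i => d i < 0)
  set B := (Finset.univ.filter (fun S : Finset ι => ∑ i ∈ S, d i = c))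
  have key : ∀ S : Finset ι, ∑ i ∈ symmDiff S N, |d i| = ∑ i ∈ S, d i + ∑ i ∈ N, |d i| := by
    intro S
    have e : ∀ T : Finset ι, ∀ f : ι → ℝ, ∑ i ∈ T, f i = ∑ i, if i ∈ T then f i else 0 := by
      intro T f; simp
    rw [e, e S, e N, ← Finset.sum_add_distrib]
    apply Finset.sum_congr rfl
    intro i _
    by_cases h1 : d i < 0
    · have : i ∈ N := by simp [N, h1]
      by_cases h2 : i ∈ S <;> simp [Finset.mem_symmDiff, this, h2, abs_of_neg h1]
    · have : i ∉ N := by simpa [N] using h1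
      by_cases h2 : i ∈ S <;> simp [Finset.mem_symmDiff, this, h2, abs_of_nonneg (not_lt.1 h1)]
  have hinj : Set.InjOn (fun S : Finset ι => symmDiff S N) (B : Set (Finset ι)) := by
    intro S _ T _ h
    exact symmDiff_left_injective N h
  rw [← Finset.card_image_of_injOn hinj]
  apply IsAntichain.sperner
  intro X hX Y hY hne hle
  simp only [Finset.coe_image, Set.mem_image, Finset.mem_coe] at hX hY
  obtain ⟨S, hS, rfl⟩ := hX
  obtain ⟨T, hT, rfl⟩ := hY
  have hS' : ∑ i ∈ S, d i = c := (Finset.mem_filter.1 hS).2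
  have hT' : ∑ i ∈ T, d i = c := (Finset.mem_filter.1 hT).2
  have hss : symmDiff S N ⊂ symmDiff T N := lt_of_le_of_ne hle hne
  obtain ⟨j, hj, hj'⟩ := Finset.exists_of_ssubset hss
  have : ∑ i ∈ symmDiff S N, |d i| < ∑ i ∈ symmDiff T N, |d i| :=
    Finset.sum_lt_sum_of_subset hss.1 hj hj' (abs_pos.2 (hd j)) (fun _ _ _ => abs_nonneg _)
  rw [key, key, hS', hT'] at this
  exact lt_irrefl _ this

noncomputable def badSets {n : ℕ} (d : Fin n → ℝ) : Finset (Finset (Fin n)) :=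
  Finset.univ.filter (fun S : Finset (Fin n) => ∑ i ∈ S, d i = 0)

lemma aux_bad {n : ℕ} (d : Fin n → ℝ) :
    ((Finset.univ.filter (fun i => d i ≠ 0)).card + 1) * (badSets d).card ^ 2 ≤ 4 ^ n := by
  classical
  set A := {i : Fin n // d i ≠ 0}
  set A' := {i : Fin n // ¬ d i ≠ 0}
  have hA : Fintype.card A = (Finset.univ.filter (fun i => d i ≠ 0)).card :=
    Fintype.card_subtype _
  have hAA : Fintype.card A + Fintype.card A' = n := by
    have h3 := Finset.card_filter_add_card_filter_not (s := (Finset.univ : Finset (Fin n)))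
      (fun i : Fin n => d i ≠ 0)
    rw [Finset.card_univ, Fintype.card_fin] at h3
    have hA' : Fintype.card A' = (Finset.univ.filter (fun i => ¬ d i ≠ 0)).card :=
      Fintype.card_subtype _
    rw [hA, hA']
    exact h3
  have hle : (badSets d).card ≤
      ((Finset.univ.filter (fun S : Finset A => ∑ i ∈ S, d i = 0)) ×ˢ
        (Finset.univ : Finset (Finset A'))).card := by
    apply Finset.card_le_card_of_injOn
      (fun S => (S.subtype (fun i => d i ≠ 0), S.subtype (fun i => ¬ d i ≠ 0)))
    · intro S hS
      have hS' : ∑ i ∈ S, d i = 0 := (Finset.mem_filter.1 hS).2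
      simp only [Finset.coe_product, Set.mem_prod, Finset.mem_coe, Finset.mem_filter,
        Finset.mem_univ, true_and, and_true]
      rw [Finset.sum_subtype_eq_sum_filter (f := d), Finset.sum_filter_ne_zero, hS']
    · intro S _ T _ h
      simp only [Prod.mk.injEq] at h
      ext i
      by_cases hi : d i ≠ 0
      · have := Finset.ext_iff.1 h.1 ⟨i, hi⟩
        simpa using this
      · have := Finset.ext_iff.1 h.2 ⟨i, hi⟩
        simpa using this
  rw [Finset.card_product, Finset.card_univ, Fintype.card_finset] at hle
  have h1 := aux_LO (fun i : A => d i) (fun i => i.2) 0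
  have h2 := aux_middle (Fintype.card A)
  rw [← hA]
  calc (Fintype.card A + 1) * (badSets d).card ^ 2
      ≤ (Fintype.card A + 1) *
        ((Fintype.card A).choose (Fintype.card A / 2) * 2 ^ Fintype.card A') ^ 2 := by
        gcongr
        exact hle.trans (Nat.mul_le_mul_right _ h1)
    _ = ((Fintype.card A + 1) * (Fintype.card A).choose (Fintype.card A / 2) ^ 2) *
        4 ^ Fintype.card A' := by
        rw [mul_pow, ← pow_mul, mul_comm _ 2, pow_mul]; norm_num; ring
    _ ≤ 4 ^ Fintype.card A * 4 ^ Fintype.card A' := Nat.mul_le_mul_right _ h2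
    _ = 4 ^ n := by rw [← pow_add, hAA]

lemma aux_half {α : Type*} (D : Finset α) (a : α → ℕ) (q M u : ℕ) (hM : 0 < M)
    (h : ∀ d ∈ D, q * a d ^ 4 ≤ M) (hu : 2 * D.card < q ^ u) :
    2 * ∑ d ∈ D, a d ^ (4 * u) < M ^ u := by
  have h1 : q ^ u * ∑ d ∈ D, a d ^ (4 * u) ≤ D.card * M ^ u := by
    rw [Finset.mul_sum, ← smul_eq_mul (D.card)]
    apply Finset.sum_le_card_nsmul
    intro d hd
    rw [pow_mul, ← mul_pow]
    exact Nat.pow_le_pow_left (h d hd) u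
  have hMu : 0 < M ^ u := by positivity
  by_contra hcon
  push Not at hcon
  have h3 : q ^ u * M ^ u ≤ 2 * D.card * M ^ u := by nlinarith
  have := Nat.le_of_mul_le_mul_right h3 hMu
  omega

lemma aux_union {n u q₁ q₂ : ℕ} (D₁ D₂ : Finset (Fin n → ℝ))
    (h₁ : ∀ d ∈ D₁, q₁ * (badSets d).card ^ 4 ≤ 16 ^ n)
    (h₂ : ∀ d ∈ D₂, q₂ * (badSets d).card ^ 4 ≤ 16 ^ n)
    (hc₁ : 2 * D₁.card < q₁ ^ u) (hc₂ : 2 * D₂.card < q₂ ^ u) :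
    ∃ F : Fin (4 * u) → Finset (Fin n), ∀ d, (d ∈ D₁ ∨ d ∈ D₂) →
      ∃ j, ∑ i ∈ F j, d i ≠ 0 := by
  classical
  by_contra hcon
  push Not at hcon
  have e1 := aux_half D₁ (fun d => (badSets d).card) q₁ (16 ^ n) u (by positivity) h₁ hc₁
  have e2 := aux_half D₂ (fun d => (badSets d).card) q₂ (16 ^ n) u (by positivity) h₂ hc₂
  set P : (Fin n → ℝ) → Finset (Fin (4 * u) → Finset (Fin n)) :=
    fun d => Fintype.piFinset (fun _ => badSets d)
  have hP : ∀ d, (P d).card = (badSets d).card ^ (4 * u) := by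
    intro d; simp [P, Fintype.card_piFinset]
  have hsub : (Finset.univ : Finset (Fin (4 * u) → Finset (Fin n))) ⊆
      D₁.biUnion P ∪ D₂.biUnion P := by
    intro F _
    obtain ⟨d, hd, hF⟩ := hcon F
    have hm : F ∈ P d := by
      simp only [P, Fintype.mem_piFinset, badSets, Finset.mem_filter, Finset.mem_univ, true_and]
      exact hF
    rcases hd with hd | hd
    · exact Finset.mem_union_left _ (Finset.mem_biUnion.2 ⟨d, hd, hm⟩)
    · exact Finset.mem_union_right _ (Finset.mem_biUnion.2 ⟨d, hd, hm⟩)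
  have hcard := Finset.card_le_card hsub
  have hu1 := Finset.card_union_le (D₁.biUnion P) (D₂.biUnion P)
  have hb1 : (D₁.biUnion P).card ≤ ∑ d ∈ D₁, (badSets d).card ^ (4 * u) :=
    Finset.card_biUnion_le.trans (by simp [hP])
  have hb2 : (D₂.biUnion P).card ≤ ∑ d ∈ D₂, (badSets d).card ^ (4 * u) :=
    Finset.card_biUnion_le.trans (by simp [hP])
  have htot : (Finset.univ : Finset (Fin (4 * u) → Finset (Fin n))).card = (16 ^ n) ^ u := by
    simp only [Finset.card_univ, Fintype.card_fun, Fintype.card_finset, Fintype.card_fin]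
    rw [show (16 : ℕ) = 2 ^ 4 by norm_num]
    simp only [← pow_mul]
    congr 1
    ring
  omega

/-- Separation for an arbitrary injective weight. -/
lemma aux_sep {V : Type*} [Fintype V] [Nonempty V] [DecidableEq V] (g : V → ℝ)
    (hg : Function.Injective g) (n u r : ℕ) (hn : 0 < n) (hr : n < (r + 1) * (r + 1))
    (hc₁ : 2 * (n * Fintype.card V ^ 2) ^ r < 4 ^ u)
    (hc₂ : 2 * Fintype.card V ^ (2 * n) < n ^ u) :
    ∃ F : Fin (4 * u) → Finset (Fin n), ∀ y z : Fin n → V, y ≠ z →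
      ∃ j, ∑ i ∈ F j, g (y i) ≠ ∑ i ∈ F j, g (z i) := by
  classical
  have : NeZero n := ⟨hn.ne'⟩
  let dec : (Fin r → Fin n × (V × V)) → Fin n → ℝ := fun a i =>
    if h : ∃ t, (a t).1 = i then g (a h.choose).2.1 - g (a h.choose).2.2 else 0
  let df : (Fin n → V × V) → Fin n → ℝ := fun w i => g (w i).1 - g (w i).2
  let D₁ := (Finset.univ.image dec).filter (fun d => d ≠ 0)
  let D₂ := (Finset.univ.image df).filter
    (fun d => r < (Finset.univ.filter (fun i => d i ≠ 0)).card)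
  have c1 : D₁.card ≤ (n * Fintype.card V ^ 2) ^ r := by
    refine (Finset.card_filter_le _ _).trans (Finset.card_image_le.trans ?_)
    simp [sq]
  have c2 : D₂.card ≤ Fintype.card V ^ (2 * n) := by
    refine (Finset.card_filter_le _ _).trans (Finset.card_image_le.trans ?_)
    simp [pow_mul, sq]
  have h16 : (16 : ℕ) ^ n = (4 ^ n) ^ 2 := by rw [← pow_mul, mul_comm, pow_mul]; norm_num
  have pw : ∀ (m b : ℕ), m * b ^ 2 ≤ 4 ^ n → m ^ 2 * b ^ 4 ≤ 16 ^ n := by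
    intro m b h
    rw [h16]
    calc m ^ 2 * b ^ 4 = (m * b ^ 2) ^ 2 := by ring
      _ ≤ _ := Nat.pow_le_pow_left h 2
  obtain ⟨F, hF⟩ := aux_union (n := n) (u := u) (q₁ := 4) (q₂ := n) D₁ D₂
    (by
      intro d hd
      have hd0 : d ≠ 0 := (Finset.mem_filter.1 hd).2
      obtain ⟨i, hi⟩ := Function.ne_iff.1 hd0
      have hpos : 0 < (Finset.univ.filter (fun i => d i ≠ 0)).card :=
        Finset.card_pos.2 ⟨i, by simpa using hi⟩
      have := aux_bad d
      exact pw 2 _ (le_trans (Nat.mul_le_mul_right _ (by omega)) this))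
    (by
      intro d hd
      have hm := (Finset.mem_filter.1 hd).2
      have := pw _ _ (aux_bad d)
      refine le_trans (Nat.mul_le_mul_right _ ?_) this
      nlinarith)
    (by omega) (by omega)
  refine ⟨F, fun y z hyz => ?_⟩
  have : (df (fun i => (y i, z i))) ∈ D₁ ∨ (df (fun i => (y i, z i))) ∈ D₂ := by
    set d := df (fun i => (y i, z i)) with hd
    by_cases hs : r < (Finset.univ.filter (fun i => d i ≠ 0)).card
    · right
      exact Finset.mem_filter.2 ⟨Finset.mem_image_of_mem _ (Finset.mem_univ _), hs⟩
    · left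
      have hd0 : d ≠ 0 := by
        obtain ⟨i, hi⟩ := Function.ne_iff.1 hyz
        intro h0
        have := congrFun h0 i
        simp only [hd, df, Pi.zero_apply] at this
        exact hi (hg (by linarith))
      refine Finset.mem_filter.2 ⟨?_, hd0⟩
      set A := Finset.univ.filter (fun i => d i ≠ 0)
      obtain ⟨e, he⟩ : ∃ e : Fin r → Fin n, ∀ i ∈ A, ∃ t, e t = i := by
        refine ⟨fun t => if h : t.1 < A.card then A.equivFin.symm ⟨t.1, h⟩ else 0, ?_⟩
        intro i hi
        have hlt := (A.equivFin ⟨i, hi⟩).2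
        refine ⟨⟨(A.equivFin ⟨i, hi⟩).1, by omega⟩, ?_⟩
        simp
      refine Finset.mem_image.2 ⟨fun t => (e t, (y (e t), z (e t))), Finset.mem_univ _, ?_⟩
      funext i
      simp only [dec]
      split_ifs with h
      · rw [h.choose_spec]
      · by_contra h0
        exact h (he i (by simpa [A] using Ne.symm h0))
  obtain ⟨j, hj⟩ := hF _ this
  refine ⟨j, fun h => hj ?_⟩
  simp only [df, Finset.sum_sub_distrib, h, sub_self]

noncomputable def gw (p : ℝ) (k : ℕ) (v : ℤ) : ℝ :=
  ((k : ℝ) - v) ^ p - ((k : ℝ) + v) ^ p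

lemma gw_inj (p : ℝ) (hp : 1 ≤ p) (k : ℕ) :
    Set.InjOn (gw p k) {v : ℤ | |v| ≤ (k : ℤ)} := by
  have lt : ∀ a b : ℤ, |a| ≤ (k : ℤ) → |b| ≤ (k : ℤ) → a < b → gw p k b < gw p k a := by
    intro a b ha hb hab
    have ha1 : -(k : ℝ) ≤ a := by exact_mod_cast (abs_le.1 ha).1
    have hb1 : (b : ℝ) ≤ k := by exact_mod_cast (abs_le.1 hb).2
    have hab' : (a : ℝ) < b := by exact_mod_cast hab
    have h1 : ((k : ℝ) - b) ^ p < ((k : ℝ) - a) ^ p :=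
      Real.rpow_lt_rpow (by linarith) (by linarith) (by linarith)
    have h2 : ((k : ℝ) + a) ^ p < ((k : ℝ) + b) ^ p :=
      Real.rpow_lt_rpow (by linarith) (by linarith) (by linarith)
    unfold gw
    linarith
  intro a ha b hb h
  rcases lt_trichotomy a b with hab | hab | hab
  · have := lt a b ha hb hab; rw [h] at this; exact absurd this (lt_irrefl _)
  · exact hab
  · have := lt b a hb ha hab; rw [h] at this; exact absurd this (lt_irrefl _)

lemma aux_query (p : ℝ) (hp : 1 ≤ p) (n k m : ℕ) (F : Fin m → Finset (Fin n))
    (hF : ∀ y z : Fin n → ℤ, (∀ i, |y i| ≤ (k : ℤ)) → (∀ i, |z i| ≤ (k : ℤ)) → y ≠ z →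
      ∃ j, ∑ i ∈ F j, gw p k (y i) ≠ ∑ i ∈ F j, gw p k (z i)) :
    ∃ x : Fin (m + 1) → Fin n → ℤ, (∀ j i, |x j i| ≤ (k : ℤ)) ∧
        Set.InjOn
          (fun y : Fin n → ℤ => fun j : Fin (m + 1) =>
            (∑ i, |(y i : ℝ) - (x j i : ℝ)| ^ p) ^ (1 / p))
          {y : Fin n → ℤ | ∀ i, |y i| ≤ (k : ℤ)} := by
  classical
  let G : Fin (m + 1) → Finset (Fin n) := Fin.cons ∅ F
  refine ⟨fun j i => if i ∈ G j then (k : ℤ) else -k, ?_, ?_⟩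
  · intro j i
    dsimp only
    split_ifs <;> simp
  · intro y hy z hz h
    by_contra hne
    obtain ⟨j, hj⟩ := hF y z hy hz hne
    have key : ∀ w : Fin n → ℤ, (∀ i, |w i| ≤ (k : ℤ)) → ∀ t : Fin (m + 1),
        ∑ i, |(w i : ℝ) - ((if i ∈ G t then (k : ℤ) else -k : ℤ) : ℝ)| ^ p
          = ∑ i, ((k : ℝ) + w i) ^ p + ∑ i ∈ G t, gw p k (w i) := by
      intro w hw t
      have e : ∑ i ∈ G t, gw p k (w i) = ∑ i, if i ∈ G t then gw p k (w i) else 0 := by simp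
      rw [e, ← Finset.sum_add_distrib]
      apply Finset.sum_congr rfl
      intro i _
      have h1 : -(k : ℝ) ≤ w i := by exact_mod_cast (abs_le.1 (hw i)).1
      have h2 : (w i : ℝ) ≤ k := by exact_mod_cast (abs_le.1 (hw i)).2
      split_ifs
      · rw [Int.cast_natCast, abs_of_nonpos (by linarith)]
        unfold gw
        rw [neg_sub]; ring
      · push_cast
        rw [abs_of_nonneg (by linarith), add_zero]
        congr 1
        ring
    have heq : ∀ t : Fin (m + 1),
        ∑ i, ((k : ℝ) + y i) ^ p + ∑ i ∈ G t, gw p k (y i)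
          = ∑ i, ((k : ℝ) + z i) ^ p + ∑ i ∈ G t, gw p k (z i) := by
      intro t
      rw [← key y hy t, ← key z hz t]
      have ht := congrFun h t
      have hp' : (1 / p) ≠ 0 := by positivity
      exact (Real.rpow_left_inj (Finset.sum_nonneg fun i _ => by positivity)
        (Finset.sum_nonneg fun i _ => by positivity) hp').1 ht
    have h0 := heq 0
    have h1 := heq j.succ
    simp only [G, Fin.cons_zero, Finset.sum_empty, add_zero, Fin.cons_succ] at h0 h1
    apply hj
    linarith

lemma aux_num (n K : ℕ) (hn : 2 ≤ n) (hK : 3 ≤ K) :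
    ∃ u : ℕ, (u : ℝ) ≤ 21 * ((n : ℝ) * Real.log K / Real.log n) + 1 ∧
      2 * (n * K ^ 2) ^ (Nat.sqrt n) < 4 ^ u ∧ 2 * K ^ (2 * n) < n ^ u := by
  have hn' : (2 : ℝ) ≤ n := by exact_mod_cast hn
  have hK' : (3 : ℝ) ≤ K := by exact_mod_cast hK
  have hL : 0 < Real.log n := Real.log_pos (by linarith)
  have hk1 : 1 < Real.log K := by
    rw [Real.lt_log_iff_exp_lt (by linarith)]
    linarith [Real.exp_one_lt_three]
  have hl2 : Real.log 2 < 1 := by linarith [Real.log_two_lt_d9]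
  have hl2' : 1 / 2 < Real.log 2 := by linarith [Real.log_two_gt_d9]
  set L := Real.log n
  set q := Real.log K
  refine ⟨⌈21 * ((n : ℝ) * q / L)⌉₊, (Nat.ceil_lt_add_one (by positivity)).le, ?_, ?_⟩
  all_goals
    set u := ⌈21 * ((n : ℝ) * q / L)⌉₊
    have hu : 21 * (n * q) ≤ u * L := by
      have h := Nat.le_ceil (21 * ((n : ℝ) * q / L))
      calc 21 * (n * q) = 21 * ((n : ℝ) * q / L) * L := by field_simp
        _ ≤ u * L := by gcongr
  · set r := Nat.sqrt n
    have hr : (r : ℝ) ^ 2 ≤ n := by exact_mod_cast Nat.sqrt_le' n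
    have hr0 : (0 : ℝ) ≤ r := by positivity
    set a := Real.sqrt (Real.sqrt n) with ha
    have ha0 : 0 ≤ a := Real.sqrt_nonneg _
    have ha2 : a ^ 2 = Real.sqrt n := Real.sq_sqrt (Real.sqrt_nonneg _)
    have ha4 : a ^ 4 = n := by
      rw [show a ^ 4 = (a ^ 2) ^ 2 by ring, ha2, Real.sq_sqrt (by linarith)]
    have hapos : 0 < a := by
      rw [ha]; exact Real.sqrt_pos.2 (Real.sqrt_pos.2 (by linarith))
    have hLa : L ≤ 4 * a := by
      have h1 : L = 4 * Real.log a := by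
        simp only [L]
        rw [← ha4, Real.log_pow]; norm_num
      have := Real.log_le_sub_one_of_pos hapos
      linarith
    have hra : (r : ℝ) ≤ a ^ 2 := by
      rw [ha2]; exact Real.le_sqrt_of_sq_le hr
    have hLa2 : L ≤ 2 * a ^ 2 := by
      have h1 : L = 2 * Real.log (a ^ 2) := by
        simp only [L]
        rw [← ha4, Real.log_pow, Real.log_pow]; push_cast; ring
      have := Real.log_le_sub_one_of_pos (show 0 < a ^ 2 by positivity)
      linarith
    have e1 : r * L * L ≤ 16 * n := by
      calc r * L * L ≤ a ^ 2 * (4 * a) * (4 * a) := by gcongr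
        _ = 16 * a ^ 4 := by ring
        _ = _ := by rw [ha4]
    have e2 : r * L ≤ 2 * n := by
      calc r * L ≤ a ^ 2 * (2 * a ^ 2) := by gcongr
        _ = 2 * a ^ 4 := by ring
        _ = _ := by rw [ha4]
    have hLn : L ≤ n := by
      have := Real.log_le_sub_one_of_pos (show (0 : ℝ) < n by linarith)
      simp only [L]; linarith
    have hlog : Real.log 2 + r * (L + 2 * q) < u * Real.log 4 := by
      have h4 : Real.log 4 = 2 * Real.log 2 := by
        rw [show (4 : ℝ) = 2 ^ 2 by norm_num, Real.log_pow]; norm_num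
      have h5 : (Real.log 2 + r * (L + 2 * q)) * L < 21 * (n * q) := by
        have f1 : Real.log 2 * L < n * q := by
          calc Real.log 2 * L < 1 * L := by gcongr
            _ ≤ n := by linarith
            _ ≤ n * q := by nlinarith
        have f2 : r * L * L ≤ 16 * (n * q) := by nlinarith
        have f3 : r * L * q ≤ 2 * (n * q) := by nlinarith
        nlinarith
      have h6 : (Real.log 2 + r * (L + 2 * q)) < u := lt_of_mul_lt_mul_right (h5.trans_le hu) hL.le
      have hu0 : (0 : ℝ) ≤ u := by positivity
      nlinarith
    have : (2 * ((n : ℝ) * K ^ 2) ^ r) < 4 ^ u := by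
      rw [← Real.log_lt_log_iff (by positivity) (by positivity),
        Real.log_mul (by norm_num) (by positivity), Real.log_pow, Real.log_pow,
        Real.log_mul (by positivity) (by positivity), Real.log_pow]
      exact_mod_cast hlog
    exact_mod_cast this
  · have : (2 * (K : ℝ) ^ (2 * n)) < n ^ u := by
      rw [← Real.log_lt_log_iff (by positivity) (by positivity),
        Real.log_mul (by norm_num) (by positivity), Real.log_pow, Real.log_pow]
      push_cast
      have : (2 : ℝ) < n * q := by nlinarith
      change Real.log 2 + 2 * n * q < u * L
      nlinarith
    exact_mod_cast this

/-- Nonadaptive ℓ_p-query Mastermind upper bound for any real `1 ≤ p < ∞`: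
a constant `C_p > 0` depending only on `p` such that for all `n ≥ 2`, `k ≥ 1`,
some `s ≤ C_p·(1 + min{n, n·log(2k+1)/log n})` queries in `{-k,…,k}^n` have an
injective ℓ_p-distance answer map on `{-k,…,k}^n`. -/
theorem mastermind_lp_upper (p : ℝ) (hp : 1 ≤ p) :
    ∃ C : ℝ, 0 < C ∧ ∀ n k : ℕ, 2 ≤ n → 1 ≤ k →
      ∃ (s : ℕ) (x : Fin s → Fin n → ℤ),
        (s : ℝ) ≤ C * (1 + min (n : ℝ)
            ((n : ℝ) * Real.log (2 * (k : ℝ) + 1) / Real.log (n : ℝ))) ∧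
        (∀ j i, |x j i| ≤ (k : ℤ)) ∧
        Set.InjOn
          (fun y : Fin n → ℤ => fun j : Fin s =>
            (∑ i, |(y i : ℝ) - (x j i : ℝ)| ^ p) ^ (1 / p))
          {y : Fin n → ℤ | ∀ i, |y i| ≤ (k : ℤ)} := by
  refine ⟨100, by norm_num, fun n k hn hk => ?_⟩
  have hL : 0 < Real.log n := Real.log_pos (by exact_mod_cast (by omega : 1 < n))
  rcases le_total (n : ℝ) ((n : ℝ) * Real.log (2 * (k : ℝ) + 1) / Real.log (n : ℝ)) with h | h
  · obtain ⟨x, hx1, hx2⟩ := aux_query p hp n k n (fun j => {j}) (by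
      intro y z hy hz hne
      obtain ⟨i, hi⟩ := Function.ne_iff.1 hne
      refine ⟨i, ?_⟩
      simp only [Finset.sum_singleton]
      exact fun he => hi (gw_inj p hp k (hy i) (hz i) he))
    refine ⟨n + 1, x, ?_, hx1, hx2⟩
    rw [min_eq_left h]
    push_cast
    have : (0 : ℝ) ≤ n := by positivity
    linarith
  · obtain ⟨u, hu, hu1, hu2⟩ := aux_num n (2 * k + 1) hn (by omega)
    let V := Finset.Icc (-(k : ℤ)) k
    have hV : Fintype.card V = 2 * k + 1 := by
      rw [Fintype.card_coe, Int.card_Icc]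
      omega
    have hne : Nonempty V := ⟨⟨0, by simp [V]⟩⟩
    obtain ⟨F, hF⟩ := aux_sep (V := V) (fun v => gw p k v.1)
      (by
        intro a b hab
        apply Subtype.ext
        exact gw_inj p hp k (abs_le.2 (Finset.mem_Icc.1 a.2)) (abs_le.2 (Finset.mem_Icc.1 b.2)) hab)
      n u (Nat.sqrt n) (by omega) (Nat.lt_succ_sqrt n) (by rw [hV]; exact hu1)
      (by rw [hV]; exact hu2)
    obtain ⟨x, hx1, hx2⟩ := aux_query p hp n k (4 * u) F (by
      intro y z hy hz hne
      refine hF (fun i => ⟨y i, Finset.mem_Icc.2 (abs_le.1 (hy i))⟩)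
        (fun i => ⟨z i, Finset.mem_Icc.2 (abs_le.1 (hz i))⟩) ?_
      intro he
      apply hne
      funext i
      exact congrArg Subtype.val (congrFun he i))
    refine ⟨4 * u + 1, x, ?_, hx1, hx2⟩
    rw [min_eq_right h]
    push_cast at hu ⊢
    have h0 : 0 ≤ (n : ℝ) * Real.log (2 * (k : ℝ) + 1) / Real.log (n : ℝ) := by
      have : 0 ≤ Real.log (2 * (k : ℝ) + 1) := Real.log_nonneg (by linarith [Nat.cast_nonneg (α := ℝ) k])
      positivity
    linarith
end

section
/- There is an absolute constant C > 0 such that for all integers n ≥ 2 and k ≥ 1, there exist an integer s with s ≤ C·(1 + min{n, n·log(2k+1)/log n}) and query vectors x₁,…,x_s ∈ {−k,…,k}^n such that the map y ↦ (‖y−x₁‖_M, …, ‖y−x_s‖_M) is injective on {−k,−k+1,…,k−1,k}^n, where ‖z‖_M = Σᵢ M(|z_i|) and M is the ℓ₁-ℓ₂ loss M(x) = 2(√(1 + x²/2) − 1). -/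
open Finset in
theorem mm_choose_bound (d : ℕ) : (d + 1) * (d.choose (d / 2)) ^ 2 ≤ 4 ^ d := by
  have key : ∀ m : ℕ, (2 * m + 1) * (Nat.centralBinom m) ^ 2 ≤ 16 ^ m := by
    intro m
    induction m with
    | zero => simp
    | succ m ih =>
      have h := Nat.succ_mul_centralBinom_succ m
      have h2 : (m + 1) ^ 2 * ((2 * (m + 1) + 1) * (Nat.centralBinom (m + 1)) ^ 2)
          ≤ (m + 1) ^ 2 * 16 ^ (m + 1) := by
        calc (m + 1) ^ 2 * ((2 * (m + 1) + 1) * (Nat.centralBinom (m + 1)) ^ 2)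
            = (2 * m + 3) * ((m + 1) * Nat.centralBinom (m + 1)) ^ 2 := by ring
          _ = (4 * ((2 * m + 3) * (2 * m + 1))) * ((2 * m + 1) * (Nat.centralBinom m) ^ 2) := by
              rw [h]; ring
          _ ≤ (4 * (4 * (m + 1) ^ 2)) * 16 ^ m := by
              apply Nat.mul_le_mul _ ih
              nlinarith
          _ = (m + 1) ^ 2 * 16 ^ (m + 1) := by ring
      exact Nat.le_of_mul_le_mul_left h2 (by positivity)
  rcases Nat.even_or_odd' d with ⟨m, rfl | rfl⟩
  · have := key m
    rw [Nat.centralBinom_eq_two_mul_choose] at this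
    rw [Nat.mul_div_cancel_left _ (by norm_num : 0 < 2), pow_mul]
    simpa using this
  · have h1 := key (m + 1)
    have h2 : Nat.centralBinom (m + 1) = 2 * (2 * m + 1).choose m := by
      rw [Nat.centralBinom_eq_two_mul_choose, show 2 * (m + 1) = (2 * m + 1) + 1 by ring,
        Nat.choose_succ_succ, Nat.choose_symm_half]
      ring
    have h3 : (2 * m + 1) / 2 = m := by omega
    rw [h3]
    rw [h2] at h1
    have e : (4 : ℕ) ^ (2 * m + 1) = 4 * 16 ^ m := by
      rw [pow_succ, pow_mul]; norm_num; ring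
    rw [e]
    have e2 : (16 : ℕ) ^ (m + 1) = 16 * 16 ^ m := by ring
    rw [e2] at h1
    nlinarith

open Finset in
theorem mm_lo_s5 {α : Type*} [Fintype α] [DecidableEq α] (f : α → Bool → ℝ)
    (h : ∀ i, f i true ≠ f i false) (c : ℝ) :
    #{x : α → Bool | ∑ i, f i (x i) = c} ≤
      (Fintype.card α).choose (Fintype.card α / 2) := by
  classical
  let up : α → Bool := fun i => decide (f i false < f i true)
  let φ : (α → Bool) → Finset α := fun x => univ.filter (fun i => x i = up i)
  have hφ : Function.Injective φ := by
    intro x y hxy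
    funext i
    have : i ∈ φ x ↔ i ∈ φ y := by rw [hxy]
    simp only [φ, mem_filter, mem_univ, true_and] at this
    revert this
    cases x i <;> cases y i <;> cases up i <;> simp
  have hlo : ∀ i b b', (b = up i → b' = up i) → f i b ≤ f i b' := by
    intro i b b' hb
    by_cases hlt : f i false < f i true
    · have hu : up i = true := by simp [up, hlt]
      rw [hu] at hb
      cases b <;> cases b' <;> simp_all [le_of_lt]
    · have hu : up i = false := by simp [up, hlt]
      rw [hu] at hb
      have := not_lt.1 hlt
      cases b <;> cases b' <;> simp_all
  rw [← card_image_of_injective _ hφ]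
  apply IsAntichain.sperner
  intro S hS T hT hne hsub
  simp only [coe_image, coe_filter, mem_univ, true_and, Set.mem_image, Set.mem_ofPred_eq] at hS hT
  obtain ⟨x, hx, rfl⟩ := hS
  obtain ⟨y, hy, rfl⟩ := hT
  apply hne
  have hle : ∀ i ∈ (univ : Finset α), f i (x i) ≤ f i (y i) := by
    intro i _
    apply hlo
    intro hi
    have : i ∈ φ x := by simp [φ, hi]
    have := hsub this
    simpa [φ] using this
  have heq := (sum_eq_sum_iff_of_le hle).1 (hx.trans hy.symm)
  congr 1
  funext i
  have h1 := heq i (mem_univ i)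
  have h2 := h i
  revert h1
  cases x i <;> cases y i <;> simp [h2, h2.symm]

open Finset in
theorem mm_lo2 {n : ℕ} (D : Finset (Fin n)) (f : Fin n → Bool → ℝ)
    (h : ∀ i ∈ D, f i true ≠ f i false) (c : ℝ) :
    (#{x : Fin n → Bool | ∑ i, f i (x i) = c}) ^ 2 * (#D + 1) ≤ 4 ^ n := by
  classical
  have hN : #{x : Fin n → Bool | ∑ i, f i (x i) = c} ≤
      (#D).choose (#D / 2) * 2 ^ (n - #D) := by
    have hcard : #(univ : Finset ({i // i ∉ D} → Bool)) = 2 ^ (n - #D) := by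
      rw [card_univ, Fintype.card_fun, Fintype.card_bool]
      congr 1
      rw [Fintype.card_subtype_compl]
      simp
    rw [← hcard]
    apply card_le_mul_card_image_of_maps_to
      (f := fun (x : Fin n → Bool) (i : {i // i ∉ D}) => x i) (fun _ _ => mem_univ _)
    intro z _
    have hl := mm_lo_s5 (α := {i // i ∈ D}) (fun i => f i) (fun i => h i i.2)
      (c - ∑ i : {i // i ∉ D}, f i (z i))
    simp only [Fintype.card_coe] at hl
    refine le_trans ?_ hl
    apply card_le_card_of_injOn (fun (x : Fin n → Bool) (i : {i // i ∈ D}) => x i)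
    · intro x hx
      simp only [coe_filter, mem_filter, mem_univ, true_and, Set.mem_ofPred_eq] at hx ⊢
      obtain ⟨hx, rfl⟩ := hx
      rw [eq_sub_iff_add_eq, ← hx]
      convert Fintype.sum_subtype_add_sum_subtype (fun i => i ∈ D) (fun i => f i (x i))
    · intro x hx y hy hxy
      simp only [coe_filter, mem_filter, mem_univ, true_and, Set.mem_ofPred_eq] at hx hy
      have h2 := hx.2.trans hy.2.symm
      funext i
      by_cases hi : i ∈ D
      · exact congrFun hxy ⟨i, hi⟩
      · exact congrFun h2 ⟨i, hi⟩
  have hd : #D ≤ n := by simpa using card_le_univ D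
  have hb := mm_choose_bound (#D)
  calc _ ≤ ((#D).choose (#D / 2) * 2 ^ (n - #D)) ^ 2 * (#D + 1) := by gcongr
    _ = ((#D + 1) * (#D).choose (#D / 2) ^ 2) * (2 ^ 2) ^ (n - #D) := by
        rw [← pow_mul, mul_comm 2, pow_mul]; ring
    _ ≤ 4 ^ #D * 4 ^ (n - #D) := by
        norm_num only
        gcongr
    _ = 4 ^ n := by rw [← pow_add]; congr 1; omega

theorem mm_analytic (n q d t : ℕ) (hn : 2 ≤ n) (hq : 3 ≤ q) (hqn : q ≤ n) (hd : 1 ≤ d)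
    (hdn : d ≤ n) (ht : 200 * (n : ℝ) * Real.log q / Real.log n ≤ t) :
    (n + 1) * (n.choose d * (q ^ 2) ^ d) ≤ (d + 1) ^ t := by
  have hn0 : (0 : ℝ) < n := by positivity
  have hlogn : 0 < Real.log n := Real.log_pos (by exact_mod_cast (by omega : 1 < n))
  have hq0 : (0 : ℝ) < q := by exact_mod_cast (by omega : 0 < q)
  have hlogq : 1 ≤ Real.log q := by
    rw [Real.le_log_iff_exp_le hq0]
    have : (3 : ℝ) ≤ q := by exact_mod_cast hq
    linarith [Real.exp_one_lt_d9]
  have ht' : 200 * (n : ℝ) * Real.log q ≤ t * Real.log n := (div_le_iff₀ hlogn).1 ht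
  have ht0 : (0 : ℝ) ≤ t := by positivity
  by_cases hs : (d + 1) ^ 2 ≤ n
  · have h1 : (n + 1) * (n.choose d * (q ^ 2) ^ d) ≤ n ^ (5 * d) := by
      calc (n + 1) * (n.choose d * (q ^ 2) ^ d) ≤ n ^ 2 * (n ^ d * (n ^ 2) ^ d) := by
            gcongr
            · nlinarith
            · exact Nat.choose_le_pow n d
        _ = n ^ (2 + 3 * d) := by rw [← pow_mul, ← pow_add, ← pow_add]; congr 1; ring
        _ ≤ n ^ (5 * d) := Nat.pow_le_pow_right (by omega) (by omega)
    have h2 : n ^ (5 * d) ≤ 2 ^ t := by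
      have : ((n : ℝ)) ^ (5 * d) ≤ 2 ^ t := by
        rw [← Real.log_le_log_iff (by positivity) (by positivity), Real.log_pow, Real.log_pow]
        push_cast
        have hl2 : (0.69 : ℝ) ≤ Real.log 2 := by linarith [Real.log_two_gt_d9]
        have hdd : (d : ℝ) ≤ Real.sqrt n := by
          apply Real.le_sqrt_of_sq_le
          have : ((d : ℝ) + 1) ^ 2 ≤ n := by exact_mod_cast hs
          nlinarith [(by positivity : (0 : ℝ) ≤ d)]
        set r := Real.sqrt (Real.sqrt n) with hr
        have hr2 : r ^ 2 = Real.sqrt n := Real.sq_sqrt (Real.sqrt_nonneg _)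
        have hr4 : (r ^ 2) ^ 2 = n := by rw [hr2]; exact Real.sq_sqrt hn0.le
        have hr0 : 0 < r := by positivity
        have hlog : Real.log n ≤ 4 * r := by
          rw [← hr4, ← pow_mul, Real.log_pow]
          have := Real.log_le_sub_one_of_pos hr0
          push_cast
          linarith
        rw [← hr2] at hdd
        have hA : 5 * (d : ℝ) * Real.log n * Real.log n ≤ 80 * n := by
          calc 5 * (d : ℝ) * Real.log n * Real.log n ≤ 5 * (r ^ 2) * (4 * r) * (4 * r) := by
                gcongr
            _ = 80 * (r ^ 2) ^ 2 := by ring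
            _ = 80 * n := by rw [hr4]
        have hB : 80 * (n : ℝ) ≤ (t * Real.log 2) * Real.log n := by
          calc 80 * (n : ℝ) ≤ 0.69 * (200 * n * 1) := by linarith
            _ ≤ Real.log 2 * (200 * n * Real.log q) := by gcongr
            _ ≤ Real.log 2 * (t * Real.log n) := by gcongr
            _ = _ := by ring
        exact le_of_mul_le_mul_right (hA.trans hB) hlogn
      exact_mod_cast this
    exact h1.trans (h2.trans (Nat.pow_le_pow_left (by omega) t))
  · push Not at hs
    have h1 : (n + 1) * (n.choose d * (q ^ 2) ^ d) ≤ q ^ (4 * n) := by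
      calc (n + 1) * (n.choose d * (q ^ 2) ^ d) ≤ 2 ^ n * (2 ^ n * (q ^ 2) ^ n) := by
            gcongr
            · exact Nat.lt_two_pow_self
            · exact Nat.choose_le_two_pow n d
            · exact Nat.one_le_pow _ _ (by omega)
        _ ≤ q ^ n * (q ^ n * (q ^ 2) ^ n) := by gcongr <;> omega
        _ = q ^ (4 * n) := by rw [← pow_mul, ← pow_add, ← pow_add]; congr 1; ring
    refine h1.trans ?_
    have : ((q : ℝ)) ^ (4 * n) ≤ ((d : ℝ) + 1) ^ t := by
      rw [← Real.log_le_log_iff (by positivity) (by positivity), Real.log_pow, Real.log_pow]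
      push_cast
      have hL : Real.log n ≤ 2 * Real.log ((d : ℝ) + 1) := by
        have : Real.log n ≤ Real.log (((d : ℝ) + 1) ^ 2) := by
          apply Real.log_le_log hn0
          exact_mod_cast hs.le
        rwa [Real.log_pow] at this
      have := mul_le_mul_of_nonneg_left hL ht0
      have hp : 0 ≤ (n : ℝ) * Real.log q := by positivity
      nlinarith
    exact_mod_cast this

open Finset in
/-- The counting argument. -/
theorem mm_exists (n q t : ℕ) (V : Finset ℤ) (F : ℤ → Bool → ℝ) (hV : #V = q)
    (hF : ∀ a ∈ V, ∀ b ∈ V, a ≠ b → F a true - F b true ≠ F a false - F b false)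
    (hb : ∀ d, 1 ≤ d → d ≤ n → (n + 1) * (n.choose d * (q ^ 2) ^ d) ≤ (d + 1) ^ t) :
    ∃ X : Fin (2 * t) → Fin n → Bool, ∀ y y' : Fin n → ℤ, (∀ i, y i ∈ V) → (∀ i, y' i ∈ V) →
      (∀ j, ∑ i, F (y i) (X j i) = ∑ i, F (y' i) (X j i)) → y = y' := by
  classical
  let P : Finset (Fin n) → Finset (Fin n → ℤ × ℤ) := fun D =>
    Fintype.piFinset (fun i => if i ∈ D then V.offDiag else {(0, 0)})
  let Z : (Fin n → ℤ × ℤ) → Finset (Fin n → Bool) := fun g =>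
    {x : Fin n → Bool | ∑ i, (F (g i).1 (x i) - F (g i).2 (x i)) = 0}
  let B : (Fin n → ℤ × ℤ) → Finset (Fin (2 * t) → Fin n → Bool) := fun g =>
    Fintype.piFinset (fun _ => Z g)
  let S : Finset (Finset (Fin n)) := univ.powerset.erase ∅
  let W := S.biUnion (fun D => (P D).biUnion B)
  have hPcard : ∀ D, #(P D) ≤ (q ^ 2) ^ #D := by
    intro D
    simp only [P, Fintype.card_piFinset]
    calc ∏ i, #(if i ∈ D then V.offDiag else {(0, 0)})
        = ∏ i, (if i ∈ D then #V.offDiag else 1) := by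
          apply prod_congr rfl; intro i _; split_ifs <;> simp
      _ = #V.offDiag ^ #D := by
          rw [prod_ite]; simp
      _ ≤ (q ^ 2) ^ #D := by
          gcongr
          rw [offDiag_card, hV, sq]; omega
  have hBcard : ∀ D, ∀ g ∈ P D, (#(B g) : ℝ) ≤ ((2 : ℝ) ^ n) ^ (2 * t) / ((#D : ℝ) + 1) ^ t := by
    intro D g hg
    have hz : (#(Z g)) ^ 2 * (#D + 1) ≤ 4 ^ n := by
      apply mm_lo2 D (fun i b => F (g i).1 b - F (g i).2 b)
      intro i hi
      have := Fintype.mem_piFinset.1 hg i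
      simp only [hi, if_true, mem_offDiag] at this
      exact hF _ this.1 _ this.2.1 this.2.2
    rw [le_div_iff₀ (by positivity)]
    have : #(B g) * (#D + 1) ^ t ≤ (2 ^ n) ^ (2 * t) := by
      simp only [B, Fintype.card_piFinset, prod_const, card_univ, Fintype.card_fin]
      rw [pow_mul, ← mul_pow]
      calc _ ≤ (4 ^ n) ^ t := by gcongr
        _ = _ := by rw [← pow_mul, ← pow_mul,
                      show (4 : ℕ) = 2 ^ 2 by norm_num, ← pow_mul]; congr 1; ring
    exact_mod_cast this
  set N : ℝ := ((2 : ℝ) ^ n) ^ (2 * t) with hNdef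
  have hN0 : 0 < N := by positivity
  have hW : (#W : ℝ) < N := by
    let w : ℕ → ℝ := fun d => if d = 0 then 0 else ((q : ℝ) ^ 2) ^ d * (N / ((d : ℝ) + 1) ^ t)
    have hw0 : ∀ d, 0 ≤ w d := by
      intro d
      simp only [w]
      split_ifs <;> positivity
    have h1 : (#W : ℝ) ≤ ∑ D ∈ (univ : Finset (Fin n)).powerset, w #D := by
      calc (#W : ℝ) ≤ ∑ D ∈ S, (#((P D).biUnion B) : ℝ) := by exact_mod_cast card_biUnion_le
        _ ≤ ∑ D ∈ S, w #D := by
            apply sum_le_sum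
            intro D hD
            have hD0 : #D ≠ 0 := by
              have := (mem_erase.1 hD).1
              simpa using this
            calc (#((P D).biUnion B) : ℝ) ≤ ∑ g ∈ P D, (#(B g) : ℝ) := by
                  exact_mod_cast card_biUnion_le
              _ ≤ ∑ g ∈ P D, N / ((#D : ℝ) + 1) ^ t := sum_le_sum (hBcard D)
              _ = (#(P D) : ℝ) * (N / ((#D : ℝ) + 1) ^ t) := by simp
              _ ≤ ((q : ℝ) ^ 2) ^ #D * (N / ((#D : ℝ) + 1) ^ t) := by
                  gcongr
                  exact_mod_cast hPcard D
              _ = w #D := by simp [w, hD0]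
        _ ≤ _ := sum_le_sum_of_subset_of_nonneg (erase_subset _ _) (fun _ _ _ => hw0 _)
    rw [sum_powerset_apply_card] at h1
    simp only [card_univ, Fintype.card_fin] at h1
    rw [sum_range_succ'] at h1
    have h2 : ∑ d ∈ range n, n.choose (d + 1) • w (d + 1) ≤ ∑ d ∈ range n, N / ((n : ℝ) + 1) := by
      apply sum_le_sum
      intro d hd
      have := hb (d + 1) (by omega) (by have := mem_range.1 hd; omega)
      have h3 : ((n : ℝ) + 1) * (n.choose (d + 1) * ((q : ℝ) ^ 2) ^ (d + 1))
          ≤ (((d + 1 : ℕ) : ℝ) + 1) ^ t := by exact_mod_cast this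
      simp only [w, Nat.succ_ne_zero, if_false, nsmul_eq_mul]
      rw [le_div_iff₀ (by positivity), mul_div_assoc', mul_div_assoc', div_mul_eq_mul_div,
        div_le_iff₀ (by positivity)]
      nlinarith
    have h4 : w 0 = 0 := by simp [w]
    rw [h4] at h1
    simp only [sum_const, card_range, nsmul_eq_mul, mul_zero, add_zero] at h1 h2
    have h5 : (n : ℝ) * (N / (n + 1)) < N := by
      rw [mul_div_assoc', div_lt_iff₀ (by positivity)]
      nlinarith
    linarith
  have hex : ∃ X, X ∉ W := by
    by_contra hcon
    push Not at hcon
    have : W = univ := eq_univ_of_forall hcon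
    rw [this] at hW
    simp [card_univ, hNdef] at hW
  obtain ⟨X, hX⟩ := hex
  refine ⟨X, fun y y' hy hy' hsum => ?_⟩
  by_contra hne
  apply hX
  let D : Finset (Fin n) := univ.filter (fun i => y i ≠ y' i)
  have hD : D ∈ S := by
    simp only [S, mem_erase, mem_powerset, subset_univ, and_true]
    intro h0
    apply hne
    funext i
    by_contra hi
    have : i ∈ D := by simp [D, hi]
    rw [h0] at this
    simp at this
  refine mem_biUnion.2 ⟨D, hD, mem_biUnion.2
    ⟨fun i => if i ∈ D then (y i, y' i) else (0, 0), ?_, ?_⟩⟩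
  · apply Fintype.mem_piFinset.2
    intro i
    split_ifs with hi
    · simp only [mem_offDiag]
      exact ⟨hy i, hy' i, by simpa [D] using hi⟩
    · simp
  · apply Fintype.mem_piFinset.2
    intro j
    simp only [Z, mem_filter, mem_univ, true_and]
    have := hsum j
    rw [← sub_eq_zero, ← sum_sub_distrib] at this
    rw [← this]
    apply sum_congr rfl
    intro i _
    by_cases hi : i ∈ D
    · simp [hi]
    · have : y i = y' i := by simpa [D] using hi
      simp [hi, this]

/-- The loss against the query value `k` or `-k`. -/
noncomputable def mmF (k : ℕ) (a : ℤ) (b : Bool) : ℝ :=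
  2 * (Real.sqrt (1 + |(a : ℝ) - (((if b then (k : ℤ) else -(k : ℤ)) : ℤ) : ℝ)| ^ 2 / 2) - 1)

theorem mmF_lt (k : ℕ) (a b : ℤ) (ha : -(k : ℤ) ≤ a) (hb : b ≤ k) (hab : a < b) :
    mmF k b true < mmF k a true ∧ mmF k a false < mmF k b false := by
  have ha' : -(k : ℝ) ≤ a := by exact_mod_cast ha
  have hb' : (b : ℝ) ≤ k := by exact_mod_cast hb
  have hab' : (a : ℝ) < b := by exact_mod_cast hab
  constructor
  · simp only [mmF, sq_abs, if_true, Int.cast_natCast]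
    have : Real.sqrt (1 + ((b : ℝ) - k) ^ 2 / 2) < Real.sqrt (1 + ((a : ℝ) - k) ^ 2 / 2) := by
      apply Real.sqrt_lt_sqrt (by positivity)
      nlinarith
    linarith
  · simp only [mmF, sq_abs, Bool.false_eq_true, if_false, Int.cast_neg, Int.cast_natCast]
    have : Real.sqrt (1 + ((a : ℝ) - -k) ^ 2 / 2) < Real.sqrt (1 + ((b : ℝ) - -k) ^ 2 / 2) := by
      apply Real.sqrt_lt_sqrt (by positivity)
      nlinarith
    linarith

theorem mmF_ne (k : ℕ) (a : ℤ) (ha : a ∈ Finset.Icc (-(k : ℤ)) k) (b : ℤ)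
    (hb : b ∈ Finset.Icc (-(k : ℤ)) k) (hab : a ≠ b) :
    mmF k a true - mmF k b true ≠ mmF k a false - mmF k b false := by
  rw [Finset.mem_Icc] at ha hb
  rcases lt_or_gt_of_ne hab with h | h
  · have := mmF_lt k a b ha.1 hb.2 h
    intro h'
    linarith [this.1, this.2]
  · have := mmF_lt k b a hb.1 ha.2 h
    intro h'
    linarith [this.1, this.2]

theorem mm_reduce (n k s : ℕ) (X : Fin s → Fin n → Bool)
    (hX : ∀ y y' : Fin n → ℤ, (∀ i, y i ∈ Finset.Icc (-(k : ℤ)) k) →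
      (∀ i, y' i ∈ Finset.Icc (-(k : ℤ)) k) →
      (∀ j, ∑ i, mmF k (y i) (X j i) = ∑ i, mmF k (y' i) (X j i)) → y = y') :
    ∃ x : Fin s → Fin n → ℤ, (∀ j i, |x j i| ≤ (k : ℤ)) ∧
        Set.InjOn
          (fun y : Fin n → ℤ => fun j : Fin s =>
            ∑ i, 2 * (Real.sqrt (1 + |(y i : ℝ) - (x j i : ℝ)| ^ 2 / 2) - 1))
          {y : Fin n → ℤ | ∀ i, |y i| ≤ (k : ℤ)} := by
  refine ⟨fun j i => if X j i then (k : ℤ) else -(k : ℤ), ?_, ?_⟩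
  · intro j i
    dsimp only
    split_ifs <;> simp
  · intro y hy y' hy' h
    apply hX y y'
    · intro i; exact Finset.mem_Icc.2 (abs_le.1 (hy i))
    · intro i; exact Finset.mem_Icc.2 (abs_le.1 (hy' i))
    · intro j; exact congrFun h j

theorem mm_linear (n k : ℕ) : ∃ X : Fin (n + 1) → Fin n → Bool,
    ∀ y y' : Fin n → ℤ, (∀ i, y i ∈ Finset.Icc (-(k : ℤ)) k) →
      (∀ i, y' i ∈ Finset.Icc (-(k : ℤ)) k) →
      (∀ j, ∑ i, mmF k (y i) (X j i) = ∑ i, mmF k (y' i) (X j i)) → y = y' := by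
  refine ⟨fun j i => decide (j ≠ i.castSucc), ?_⟩
  intro y y' hy hy' h
  funext i
  by_contra hne
  have key : ∀ z : Fin n → ℤ,
      (∑ l, mmF k (z l) (decide (Fin.last n ≠ l.castSucc))) -
        (∑ l, mmF k (z l) (decide (i.castSucc ≠ l.castSucc))) =
      mmF k (z i) true - mmF k (z i) false := by
    intro z
    rw [← Finset.sum_sub_distrib, Finset.sum_eq_single i]
    · simp [(Fin.castSucc_lt_last i).ne']
    · intro l _ hl
      simp [(Fin.castSucc_lt_last l).ne', hl.symm]
    · simp
  have h1 := key y
  have h2 := key y'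
  have h3 := h (Fin.last n)
  have h4 := h i.castSucc
  apply mmF_ne k (y i) (hy i) (y' i) (hy' i) hne
  linarith

/-- Nonadaptive Mastermind upper bound for the ℓ₁-ℓ₂ loss
`M(x) = 2(√(1 + x²/2) − 1)`, queries answered by `‖y−x‖_M = Σᵢ M(|yᵢ−xᵢ|)`. -/
theorem mastermind_l1l2_upper :
    ∃ C : ℝ, 0 < C ∧ ∀ n k : ℕ, 2 ≤ n → 1 ≤ k →
      ∃ (s : ℕ) (x : Fin s → Fin n → ℤ),
        (s : ℝ) ≤ C * (1 + min (n : ℝ)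
            ((n : ℝ) * Real.log (2 * (k : ℝ) + 1) / Real.log (n : ℝ))) ∧
        (∀ j i, |x j i| ≤ (k : ℤ)) ∧
        Set.InjOn
          (fun y : Fin n → ℤ => fun j : Fin s =>
            ∑ i, 2 * (Real.sqrt (1 + |(y i : ℝ) - (x j i : ℝ)| ^ 2 / 2) - 1))
          {y : Fin n → ℤ | ∀ i, |y i| ≤ (k : ℤ)} := by
  refine ⟨400, by norm_num, ?_⟩
  intro n k hn hk
  have hn0 : (0 : ℝ) < n := by positivity
  have hlogn : 0 < Real.log n := Real.log_pos (by exact_mod_cast (by omega : 1 < n))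
  have hq0 : (0 : ℝ) < 2 * (k : ℝ) + 1 := by positivity
  by_cases hqn : 2 * k + 1 ≤ n
  · have hqn' : 2 * (k : ℝ) + 1 ≤ n := by exact_mod_cast hqn
    have hlog : Real.log (2 * (k : ℝ) + 1) ≤ Real.log n := Real.log_le_log hq0 hqn'
    have hlog0 : 0 ≤ Real.log (2 * (k : ℝ) + 1) := Real.log_nonneg (by linarith [(by positivity : (0 : ℝ) ≤ k)])
    set Y := (n : ℝ) * Real.log (2 * (k : ℝ) + 1) / Real.log (n : ℝ) with hY
    have hYn : Y ≤ n := by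
      rw [hY, div_le_iff₀ hlogn]
      gcongr
    have hY0 : 0 ≤ Y := by positivity
    obtain ⟨X, hX⟩ := mm_exists n (2 * k + 1) ⌈200 * Y⌉₊ (Finset.Icc (-(k : ℤ)) k) (mmF k)
      (by simp; omega) (mmF_ne k) (by
        intro d hd hdn
        apply mm_analytic n (2 * k + 1) d _ hn (by omega) hqn hd hdn
        refine le_trans (le_of_eq ?_) (Nat.le_ceil _)
        rw [hY]
        push_cast
        ring)
    obtain ⟨x, hx⟩ := mm_reduce n k _ X hX
    refine ⟨_, x, ?_, hx⟩
    rw [min_eq_right hYn]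
    have := Nat.ceil_lt_add_one (by positivity : 0 ≤ 200 * Y)
    push_cast
    linarith
  · push Not at hqn
    have hqn' : (n : ℝ) ≤ 2 * (k : ℝ) + 1 := by exact_mod_cast hqn.le
    have hlog : Real.log n ≤ Real.log (2 * (k : ℝ) + 1) := Real.log_le_log hn0 hqn'
    obtain ⟨X, hX⟩ := mm_linear n k
    obtain ⟨x, hx⟩ := mm_reduce n k _ X hX
    refine ⟨_, x, ?_, hx⟩
    rw [min_eq_left]
    · push_cast
      linarith
    · rw [le_div_iff₀ hlogn]
      gcongr
end

section
/- For every real τ > 0 there is a constant C_τ > 0 such that for all integers n ≥ 2 and k ≥ 1, there exist an integer s with s ≤ C_τ·(1 + min{n, n·log(2k+1)/log n}) and query vectors x₁,…,x_s ∈ {−k,…,k}^n such that the map y ↦ (‖y−x₁‖_M, …, ‖y−x_s‖_M) is injective on {−k,−k+1,…,k−1,k}^n, where ‖z‖_M = Σᵢ M(|z_i|) and M is the Huber loss: M(x) = x²/(2τ) if |x| ≤ τ and M(x) = |x| − τ/2 otherwise. -/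
namespace MHub

open Finset

lemma centralBinom_sq (m : ℕ) : (Nat.centralBinom m)^2 * (2*m+1) ≤ 16^m := by
  induction m with
  | zero => simp
  | succ m ih =>
    have h := Nat.succ_mul_centralBinom_succ m
    have h2 : (m+1)^2 * ((Nat.centralBinom (m+1))^2 * (2*(m+1)+1)) ≤ (m+1)^2 * 16^(m+1) := by
      calc (m+1)^2 * ((Nat.centralBinom (m+1))^2 * (2*(m+1)+1))
          = ((m+1) * Nat.centralBinom (m+1))^2 * (2*m+3) := by ring
        _ = ((Nat.centralBinom m)^2 * (2*m+1)) * (4 * ((2*m+1)*(2*m+3))) := by rw [h]; ring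
        _ ≤ 16^m * (4 * (4*(m+1)^2)) := by
            have e : (2*m+1)*(2*m+3) ≤ 4*(m+1)^2 := by nlinarith
            exact Nat.mul_le_mul ih (Nat.mul_le_mul_left 4 e)
        _ = (m+1)^2 * 16^(m+1) := by ring
    exact Nat.le_of_mul_le_mul_left h2 (by positivity)

lemma choose_sq (w : ℕ) : (w.choose (w/2))^2 * w ≤ 4^w := by
  rcases Nat.even_or_odd' w with ⟨m, rfl | rfl⟩
  · have := centralBinom_sq m
    rw [Nat.centralBinom] at this
    have e : 2*m/2 = m := by omega
    rw [e, pow_mul]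
    norm_num
    nlinarith [Nat.zero_le (((2*m).choose m)^2)]
  · have := centralBinom_sq (m+1)
    have h3 : Nat.centralBinom (m+1) = 2 * (2*m+1).choose m := by
      rw [Nat.centralBinom, show 2*(m+1) = (2*m+1)+1 by ring, Nat.choose_succ_succ]
      rw [Nat.choose_symm_half]; ring
    have e : (2*m+1)/2 = m := by omega
    rw [h3] at this
    rw [e, pow_succ 4, pow_mul]
    norm_num
    rw [pow_succ 16] at this
    nlinarith [Nat.zero_le (((2*m+1).choose m)^2)]

lemma choose_half (w : ℕ) (hw : 1 ≤ w) : w.choose (w/2) * 2 ≤ 2^w := by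
  obtain ⟨v, rfl⟩ : ∃ v, w = v+1 := ⟨w-1, by omega⟩
  rw [pow_succ]
  apply Nat.mul_le_mul_right
  rcases Nat.eq_zero_or_pos ((v+1)/2) with h | h
  · rw [h]; simpa using Nat.one_le_two_pow
  · obtain ⟨r, hr⟩ : ∃ r, (v+1)/2 = r+1 := ⟨(v+1)/2-1, by omega⟩
    rw [hr, Nat.choose_succ_succ, ← Nat.sum_range_choose]
    have : ({r, r+1} : Finset ℕ) ⊆ range (v+1) := by
      intro i hi; simp at hi ⊢; omega
    calc _ = ∑ i ∈ ({r, r+1} : Finset ℕ), v.choose i := by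
            rw [Finset.sum_pair (by omega)]
      _ ≤ _ := Finset.sum_le_sum_of_subset this

/-- Littlewood-Offord, all coefficients nonzero. -/
lemma lo_full {α : Type*} [Fintype α] [DecidableEq α] (d : α → ℝ) (hd : ∀ i, d i ≠ 0) :
    #{S : Finset α | ∑ i ∈ S, d i = 0} ≤ (Fintype.card α).choose (Fintype.card α / 2) := by
  classical
  set N : Finset α := {i | d i < 0} with hN
  have key : ∀ S : Finset α, ∑ i ∈ symmDiff S N, |d i| = ∑ i ∈ S, d i - ∑ i ∈ N, d i := by
    intro S
    have h1 : ∑ i ∈ symmDiff S N, |d i| = ∑ i ∈ S \ N, |d i| + ∑ i ∈ N \ S, |d i| := by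
      rw [symmDiff_def]; exact Finset.sum_union (by exact disjoint_sdiff_sdiff)
    have h2 : ∑ i ∈ S \ N, |d i| = ∑ i ∈ S \ N, d i := by
      apply Finset.sum_congr rfl; intro i hi
      simp [hN] at hi; exact abs_of_nonneg hi.2
    have h3 : ∑ i ∈ N \ S, |d i| = - ∑ i ∈ N \ S, d i := by
      rw [← Finset.sum_neg_distrib]
      apply Finset.sum_congr rfl; intro i hi
      simp [hN] at hi; exact abs_of_neg hi.1
    have h4 := Finset.sum_sdiff_sub_sum_sdiff (s₁ := S) (s₂ := N) (f := d)
    rw [h1, h2, h3]; linarith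
  have hinj : Function.Injective (fun S : Finset α => symmDiff S N) := symmDiff_left_injective N
  rw [← Finset.card_image_of_injective _ hinj]
  apply IsAntichain.sperner
  intro A hA B hB hne hle
  simp only [Finset.coe_image, Set.mem_image, Finset.mem_coe, Finset.mem_filter, Finset.mem_univ,
    true_and] at hA hB
  obtain ⟨S, hS, rfl⟩ := hA
  obtain ⟨T, hT, rfl⟩ := hB
  have hss : symmDiff S N ⊂ symmDiff T N := lt_of_le_of_ne hle hne
  obtain ⟨hsub, i, hi, hi'⟩ : _ ∧ ∃ i, i ∈ symmDiff T N ∧ i ∉ symmDiff S N :=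
    ⟨hss.1, Finset.exists_of_ssubset hss⟩
  have := Finset.sum_lt_sum_of_subset hsub hi hi' (abs_pos.mpr (hd i)) (fun j _ _ => abs_nonneg (d j))
  rw [key, key, hS, hT] at this
  exact lt_irrefl _ this

lemma lo {n : ℕ} (d : Fin n → ℝ) (w : ℕ) (hw : #{i | d i ≠ 0} = w) :
    #{S : Finset (Fin n) | ∑ i ∈ S, d i = 0} * 2^w ≤ w.choose (w/2) * 2^n := by
  classical
  set T : Finset (Fin n) := {i | d i ≠ 0} with hT
  have h1 := lo_full (fun i : T => d i) (fun i => (Finset.mem_filter.mp i.2).2)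
  rw [Fintype.card_coe, hw] at h1
  have h2 : #{S : Finset (Fin n) | ∑ i ∈ S, d i = 0} ≤
      #((Finset.univ.filter (fun S : Finset T => ∑ i ∈ S, d i = 0)) ×ˢ (Tᶜ).powerset) := by
    apply Finset.card_le_card_of_injOn (fun S => (S.subtype (· ∈ T), S \ T))
    · intro S hS
      simp only [coe_filter, mem_univ, true_and, Set.mem_ofPred_eq] at hS
      simp only [coe_product, Set.mem_prod, mem_coe, mem_filter, mem_univ, true_and, mem_powerset]
      constructor
      · rw [Finset.sum_subtype_eq_sum_filter, Finset.sum_filter]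
        refine Eq.trans ?_ hS
        apply Finset.sum_congr rfl
        intro i _
        by_cases h : d i = 0 <;> simp [hT, h]
      · intro i; simp
    · intro S _ S' _ h
      simp only [Prod.mk.injEq] at h
      ext i
      by_cases hi : i ∈ T
      · have := congrArg (fun Q => (⟨i, hi⟩ : T) ∈ Q) h.1
        simpa using this
      · have := congrArg (fun Q => i ∈ Q) h.2
        simpa [hi] using this
  rw [Finset.card_product, Finset.card_powerset, Finset.card_compl, hw, Fintype.card_fin] at h2
  have hwn : w ≤ n := by rw [← hw]; simpa using Finset.card_le_univ T
  calc _ ≤ (w.choose (w/2) * 2^(n-w)) * 2^w := by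
        gcongr; exact h2.trans (Nat.mul_le_mul_right _ h1)
    _ = _ := by rw [mul_assoc, ← pow_add, Nat.sub_add_cancel hwn]

lemma lo_small {n : ℕ} (d : Fin n → ℝ) (hd : d ≠ 0) :
    #{S : Finset (Fin n) | ∑ i ∈ S, d i = 0} * 2 ≤ 2^n := by
  have h := lo d _ rfl
  set w := #{i | d i ≠ 0} with hw
  have h1 : 1 ≤ w := by
    rw [hw, Nat.one_le_iff_ne_zero, Finset.card_ne_zero]
    obtain ⟨i, hi⟩ := Function.ne_iff.mp hd
    exact ⟨i, by simpa using hi⟩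
  have h2 := choose_half w h1
  have : (#{S : Finset (Fin n) | ∑ i ∈ S, d i = 0} * 2) * 2^w ≤ 2^n * 2^w := by nlinarith [Nat.zero_le (2^n)]
  exact Nat.le_of_mul_le_mul_right this (by positivity)

lemma lo_large {n : ℕ} (d : Fin n → ℝ) (hd : Nat.sqrt n < #{i | d i ≠ 0}) :
    (#{S : Finset (Fin n) | ∑ i ∈ S, d i = 0})^4 * n ≤ (2^n)^4 := by
  have h := lo d _ rfl
  set w := #{i | d i ≠ 0} with hw
  set F := #{S : Finset (Fin n) | ∑ i ∈ S, d i = 0}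
  have h2 := choose_sq w
  have h3 : n ≤ w^2 := by
    have := Nat.sqrt_lt'.mp hd
    omega
  have : (F^4 * n) * (2^w)^4 ≤ (2^n)^4 * (2^w)^4 := by
    calc (F^4 * n) * (2^w)^4 = (F * 2^w)^4 * n := by ring
      _ ≤ (w.choose (w/2) * 2^n)^4 * w^2 := by gcongr
      _ = (w.choose (w/2) ^2 * w)^2 * (2^n)^4 := by ring
      _ ≤ (4^w)^2 * (2^n)^4 := by gcongr
      _ = _ := by rw [show (4:ℕ)^w = (2^w)^2 by rw [← pow_mul, mul_comm, pow_mul]; norm_num]; ring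
  exact Nat.le_of_mul_le_mul_right this (by positivity)

lemma count_small {n : ℕ} (D : Finset ℝ) (W : ℕ) :
    #{d ∈ Fintype.piFinset (fun _ : Fin n => D) | d ≠ 0 ∧ #{i | d i ≠ 0} ≤ W} ≤ (n * #D)^W := by
  classical
  have hc : (n * #D)^W = #(Finset.univ : Finset (Fin W → Fin n × D)) := by
    simp
  rw [hc]
  apply Finset.card_le_card_of_surjOn (fun c : Fin W → Fin n × D => fun i =>
    if h : ∃ j, (c j).1 = i then ((c h.choose).2 : ℝ) else 0)
  intro d hd
  simp only [coe_filter, Fintype.mem_piFinset, Set.mem_ofPred_eq] at hd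
  obtain ⟨hD, hne, hW⟩ := hd
  obtain ⟨i0, hi0⟩ := Function.ne_iff.mp hne
  set T : Finset (Fin n) := {i | d i ≠ 0} with hT
  have : Nonempty T := ⟨⟨i0, by simpa [hT] using hi0⟩⟩
  have : Nonempty (T ↪ Fin W) := by
    apply Function.Embedding.nonempty_of_card_le
    simpa using hW
  obtain ⟨e⟩ := this
  let f : Fin W → T := Function.invFun e
  have hf : Function.Surjective f := Function.invFun_surjective e.injective
  refine ⟨fun j => ((f j : Fin n), ⟨d (f j), hD _⟩), by simp, ?_⟩
  funext i
  dsimp only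
  split_ifs with h
  · have := h.choose_spec
    exact congrArg d this
  · by_contra h0
    apply h
    obtain ⟨j, hj⟩ := hf ⟨i, by simp [hT]; exact fun h => h0 h.symm⟩
    exact ⟨j, by simp [hj]⟩

lemma detect (n K m : ℕ) (D : Finset ℝ) (hn : 1 ≤ n) (hD : #D ≤ K^2)
    (h1 : 2 * (n * K^2)^(Nat.sqrt n) ≤ 2^(4*m)) (h2 : 2 * K^(2*n) < n^m) :
    ∃ A : Fin (4*m) → Finset (Fin n), ∀ d : Fin n → ℝ, (∀ i, d i ∈ D) →
      (∀ j, ∑ i ∈ A j, d i = 0) → d = 0 := by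
  classical
  set W := Nat.sqrt n
  set P := Fintype.piFinset (fun _ : Fin n => D) with hP
  let F : (Fin n → ℝ) → Finset (Finset (Fin n)) := fun d => {S | ∑ i ∈ S, d i = 0}
  let B : (Fin n → ℝ) → Finset (Fin (4*m) → Finset (Fin n)) :=
    fun d => Fintype.piFinset (fun _ => F d)
  have hB : ∀ d, #(B d) = #(F d)^(4*m) := by intro d; simp [B]
  set P1 := {d ∈ P | d ≠ 0 ∧ #{i | d i ≠ 0} ≤ W} with hP1
  set P2 := {d ∈ P | W < #{i | d i ≠ 0}} with hP2
  set Tot : ℕ := (2^n)^(4*m) with hTot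
  have c1 : 2 * (#(P1.biUnion B)) ≤ Tot := by
    have hc := count_small (n := n) D W
    have hs : #(P1.biUnion B) * 2^(4*m) ≤ #P1 * Tot := by
      calc _ ≤ (∑ d ∈ P1, #(B d)) * 2^(4*m) := by gcongr; exact Finset.card_biUnion_le
        _ = ∑ d ∈ P1, #(B d) * 2^(4*m) := Finset.sum_mul _ _ _
        _ ≤ ∑ d ∈ P1, Tot := by
            apply Finset.sum_le_sum; intro d hd
            rw [hB, ← mul_pow]
            apply Nat.pow_le_pow_left
            exact lo_small d (Finset.mem_filter.mp hd).2.1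
        _ = _ := by simp
    have hc' : 2 * #P1 ≤ 2^(4*m) := by
      refine le_trans ?_ h1
      gcongr
      exact hc.trans (by gcongr)
    have : (2 * #(P1.biUnion B)) * 2^(4*m) ≤ Tot * 2^(4*m) := by nlinarith
    exact Nat.le_of_mul_le_mul_right this (by positivity)
  have c2 : 2 * (#(P2.biUnion B)) < Tot := by
    have hs : #(P2.biUnion B) * n^m ≤ #P2 * Tot := by
      calc _ ≤ (∑ d ∈ P2, #(B d)) * n^m := by gcongr; exact Finset.card_biUnion_le
        _ = ∑ d ∈ P2, #(B d) * n^m := Finset.sum_mul _ _ _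
        _ ≤ ∑ d ∈ P2, Tot := by
            apply Finset.sum_le_sum; intro d hd
            rw [hB, hTot, pow_mul, pow_mul, ← mul_pow]
            apply Nat.pow_le_pow_left
            exact lo_large d (Finset.mem_filter.mp hd).2
        _ = _ := by simp
    have hc : #P2 ≤ K^(2*n) := by
      calc #P2 ≤ #P := Finset.card_filter_le _ _
        _ = #D^n := by simp [hP]
        _ ≤ (K^2)^n := by gcongr
        _ = _ := by rw [pow_mul]
    have hTp : 0 < Tot := by positivity
    have : (2 * #(P2.biUnion B)) * n^m < Tot * n^m := by
      calc _ = 2 * (#(P2.biUnion B) * n^m) := by ring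
        _ ≤ 2 * (K^(2*n) * Tot) := Nat.mul_le_mul_left 2 (hs.trans (Nat.mul_le_mul_right _ hc))
        _ = (2 * K^(2*n)) * Tot := by ring
        _ < n^m * Tot := by gcongr
        _ = _ := by ring
    exact Nat.lt_of_mul_lt_mul_right this
  have hU : #(P1.biUnion B ∪ P2.biUnion B) < #(Finset.univ : Finset (Fin (4*m) → Finset (Fin n))) := by
    have : #(Finset.univ : Finset (Fin (4*m) → Finset (Fin n))) = Tot := by simp [hTot]
    rw [this]
    have := Finset.card_union_le (P1.biUnion B) (P2.biUnion B)
    omega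
  obtain ⟨A, -, hA⟩ := Finset.exists_mem_notMem_of_card_lt_card hU
  refine ⟨A, fun d hd hz => ?_⟩
  by_contra hne
  apply hA
  have hAB : A ∈ B d := by simp [B, F, hz]
  have hdP : d ∈ P := by simp [hP, hd]
  rw [Finset.mem_union, Finset.mem_biUnion, Finset.mem_biUnion]
  rcases le_or_gt (#{i | d i ≠ 0}) W with h | h
  · exact Or.inl ⟨d, Finset.mem_filter.mpr ⟨hdP, hne, h⟩, hAB⟩
  · exact Or.inr ⟨d, Finset.mem_filter.mpr ⟨hdP, h⟩, hAB⟩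

noncomputable def H (τ t : ℝ) : ℝ := if |t| ≤ τ then |t|^2/(2*τ) else |t| - τ/2

lemma H_lt (τ : ℝ) (hτ : 0 < τ) (a b : ℝ) (h : |a| < |b|) : H τ a < H τ b := by
  unfold H
  have ha := abs_nonneg a
  generalize |a| = u at *
  generalize |b| = v at *
  split_ifs with h1 h2 h2
  · gcongr
  · rw [div_lt_iff₀ (by positivity)]; push Not at h2; nlinarith
  · linarith
  · linarith

noncomputable def g (τ : ℝ) (k : ℕ) (y : ℤ) : ℝ := H τ (y - k) - H τ (y + k)

lemma g_lt (τ : ℝ) (hτ : 0 < τ) (k : ℕ) (a b : ℤ) (ha : |a| ≤ k) (hb : |b| ≤ k) (hab : a < b) :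
    g τ k b < g τ k a := by
  unfold g
  rw [abs_le] at ha hb
  have a1 : (-(k:ℝ)) ≤ a := by exact_mod_cast ha.1
  have b2 : (b:ℝ) ≤ k := by exact_mod_cast hb.2
  have ab : (a:ℝ) < b := by exact_mod_cast hab
  have h1 : H τ (b - k) < H τ (a - k) := by
    apply H_lt τ hτ
    rw [abs_of_nonpos (by linarith), abs_of_nonpos (by linarith)]; linarith
  have h2 : H τ (a + k) < H τ (b + k) := by
    apply H_lt τ hτ
    rw [abs_of_nonneg (by linarith), abs_of_nonneg (by linarith)]; linarith
  linarith

lemma g_inj (τ : ℝ) (hτ : 0 < τ) (k : ℕ) (a b : ℤ) (ha : |a| ≤ k) (hb : |b| ≤ k)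
    (h : g τ k a - g τ k b = 0) : a = b := by
  rcases lt_trichotomy a b with h' | h' | h'
  · have := g_lt τ hτ k a b ha hb h'; linarith
  · exact h'
  · have := g_lt τ hτ k b a hb ha h'; linarith

noncomputable def DD (τ : ℝ) (k : ℕ) : Finset ℝ :=
  ((Finset.Icc (-(k:ℤ)) k) ×ˢ (Finset.Icc (-(k:ℤ)) k)).image (fun p => g τ k p.1 - g τ k p.2)

lemma DD_card (τ : ℝ) (k : ℕ) : #(MHub.DD τ k) ≤ (2*k+1)^2 := by
  refine Finset.card_image_le.trans ?_
  rw [Finset.card_product, Int.card_Icc, sq]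
  have : ((k:ℤ) + 1 - -(k:ℤ)).toNat = 2*k+1 := by omega
  rw [this]

lemma core (τ : ℝ) (hτ : 0 < τ) (n k m : ℕ) (A : Fin m → Finset (Fin n))
    (hA : ∀ d : Fin n → ℝ, (∀ i, d i ∈ MHub.DD τ k) → (∀ j, ∑ i ∈ A j, d i = 0) → d = 0) :
    ∃ x : Fin (m+1) → Fin n → ℤ, (∀ j i, |x j i| ≤ (k : ℤ)) ∧
        Set.InjOn
          (fun y : Fin n → ℤ => fun j : Fin (m+1) => ∑ i, H τ ((y i : ℝ) - (x j i : ℝ)))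
          {y : Fin n → ℤ | ∀ i, |y i| ≤ (k : ℤ)} := by
  classical
  let A' : Fin (m+1) → Finset (Fin n) := Fin.cons ∅ A
  refine ⟨fun j i => if i ∈ A' j then (k:ℤ) else -k, ?_, ?_⟩
  · intro j i; dsimp only; split_ifs <;> simp
  have key : ∀ (y : Fin n → ℤ) (S : Finset (Fin n)),
      ∑ i, H τ ((y i : ℝ) - ((if i ∈ S then (k:ℤ) else -k : ℤ) : ℝ))
       = ∑ i, H τ (y i + k) + ∑ i ∈ S, g τ k (y i) := by
    intro y S
    have e : ∑ i ∈ S, g τ k (y i) = ∑ i, if i ∈ S then g τ k (y i) else 0 := by simp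
    rw [e, ← Finset.sum_add_distrib]
    apply Finset.sum_congr rfl
    intro i _
    split_ifs
    · simp [g]
    · simp
  intro y hy z hz h
  have hj : ∀ j, _ := fun j => congrFun h j
  dsimp only at hj
  simp only [key] at hj
  have h0 := hj 0
  simp only [A', Fin.cons_zero, Finset.sum_empty, add_zero] at h0
  have hd := hA (fun i => g τ k (y i) - g τ k (z i)) ?_ ?_
  · funext i
    exact g_inj τ hτ k _ _ (hy i) (hz i) (congrFun hd i)
  · intro i
    refine Finset.mem_image.mpr ⟨(y i, z i), ?_, rfl⟩
    have := abs_le.mp (hy i)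
    have := abs_le.mp (hz i)
    simp only [Finset.mem_product, Finset.mem_Icc]
    tauto
  · intro j
    have := hj j.succ
    simp only [A', Fin.cons_succ] at this
    rw [Finset.sum_sub_distrib]
    linarith

/-- Numerical bounds for the number of random queries. -/
lemma numerics (n K m : ℕ) (hn : 2 ≤ n) (hK : 3 ≤ K) (hKn : K ≤ n)
    (hm : 100 * ((n:ℝ) * Real.log K / Real.log n) ≤ m) :
    2 * (n * K^2)^(Nat.sqrt n) ≤ 2^(4*m) ∧ 2 * K^(2*n) < n^m := by
  have hn' : (2:ℝ) ≤ n := by exact_mod_cast hn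
  have hK' : (3:ℝ) ≤ K := by exact_mod_cast hK
  have hKn' : (K:ℝ) ≤ n := by exact_mod_cast hKn
  have hln : 0 < Real.log n := Real.log_pos (by linarith)
  have hlK : 1 ≤ Real.log K := by
    rw [Real.le_log_iff_exp_le (by linarith)]
    linarith [Real.exp_one_lt_d9]
  have hl2 := Real.log_two_gt_d9
  have hl2' := Real.log_two_lt_d9
  have hmn : 100 * (n * Real.log K) ≤ m * Real.log n := by
    have := mul_le_mul_of_nonneg_right hm hln.le
    calc _ = 100 * ((n:ℝ) * Real.log K / Real.log n) * Real.log n := by field_simp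
      _ ≤ _ := this
  constructor
  · have hq : Real.log n ≤ 4 * (n:ℝ)^((1:ℝ)/4) := by
      have := Real.log_le_rpow_div (x := (n:ℝ)) (by linarith) (ε := 1/4) (by norm_num)
      linarith
    have hq2 : (Real.log n)^2 ≤ 16 * Real.sqrt n := by
      have e : ((n:ℝ)^((1:ℝ)/4))^2 = Real.sqrt n := by
        rw [Real.sqrt_eq_rpow, ← Real.rpow_natCast, ← Real.rpow_mul (by linarith)]
        norm_num
      calc (Real.log n)^2 ≤ (4 * (n:ℝ)^((1:ℝ)/4))^2 := by gcongr
        _ = _ := by rw [mul_pow, e]; norm_num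
    have hsq : Real.sqrt n * Real.sqrt n = n := Real.mul_self_sqrt (by linarith)
    have hs1 : 1 ≤ Real.sqrt n := by rw [Real.one_le_sqrt]; linarith
    have hW : ((Nat.sqrt n : ℕ) : ℝ) ≤ Real.sqrt n := Real.nat_sqrt_le_real_sqrt
    have hlK' : Real.log K ≤ Real.log n := Real.log_le_log (by linarith) hKn'
    have hln2 : Real.log n ≤ n := (Real.log_le_sub_one_of_pos (by linarith)).trans (by linarith)
    have big : Real.log 2 + Nat.sqrt n * (3 * Real.log n) ≤ 4 * m * Real.log 2 := by
      have t1 : (Nat.sqrt n : ℝ) * (3 * Real.log n) ≤ Real.sqrt n * (3 * Real.log n) := by gcongr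
      refine (add_le_add_right t1 _).trans ?_
      apply le_of_mul_le_mul_right _ hln
      have t2 : Real.sqrt n * (Real.log n)^2 ≤ 16 * n := by
        calc _ ≤ Real.sqrt n * (16 * Real.sqrt n) := by gcongr
          _ = 16 * (Real.sqrt n * Real.sqrt n) := by ring
          _ = _ := by rw [hsq]
      have t3 : (100:ℝ) * n ≤ m * Real.log n := by nlinarith
      have t4 : (m * Real.log n) * (1/2) ≤ (m * Real.log n) * Real.log 2 := by
        gcongr; linarith
      have t5 : Real.log 2 * Real.log n ≤ 1 * n := by gcongr; linarith
      nlinarith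
    have hr : (2 * ((n:ℝ) * K^2)^(Nat.sqrt n)) ≤ 2^(4*m) := by
      have hKp : (0:ℝ) < K := by linarith
      have hnp : (0:ℝ) < n := by linarith
      rw [← Real.log_le_log_iff (by positivity) (by positivity),
        Real.log_mul (by norm_num) (by positivity), Real.log_pow, Real.log_pow,
        Real.log_mul (by positivity) (by positivity), Real.log_pow]
      push_cast
      refine le_trans ?_ big
      gcongr
      linarith
    exact_mod_cast hr
  · have hr : (2 * (K:ℝ)^(2*n)) < n^m := by
      have hKp : (0:ℝ) < K := by linarith
      have hnp : (0:ℝ) < n := by linarith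
      rw [← Real.log_lt_log_iff (by positivity) (by positivity),
        Real.log_mul (by norm_num) (by positivity), Real.log_pow, Real.log_pow]
      push_cast
      nlinarith
    exact_mod_cast hr

end MHub


/-- Nonadaptive Mastermind upper bound for the Huber loss with parameter `τ > 0`:
`M(x) = x²/(2τ)` if `|x| ≤ τ` and `M(x) = |x| − τ/2` otherwise, with queries
answered by `‖y−x‖_M = Σᵢ M(|yᵢ−xᵢ|)`. -/
theorem mastermind_huber_upper (τ : ℝ) (hτ : 0 < τ) :
    ∃ C : ℝ, 0 < C ∧ ∀ n k : ℕ, 2 ≤ n → 1 ≤ k →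
      ∃ (s : ℕ) (x : Fin s → Fin n → ℤ),
        (s : ℝ) ≤ C * (1 + min (n : ℝ)
            ((n : ℝ) * Real.log (2 * (k : ℝ) + 1) / Real.log (n : ℝ))) ∧
        (∀ j i, |x j i| ≤ (k : ℤ)) ∧
        Set.InjOn
          (fun y : Fin n → ℤ => fun j : Fin s =>
            ∑ i, if |(y i : ℝ) - (x j i : ℝ)| ≤ τ
              then |(y i : ℝ) - (x j i : ℝ)| ^ 2 / (2 * τ)
              else |(y i : ℝ) - (x j i : ℝ)| - τ / 2)
          {y : Fin n → ℤ | ∀ i, |y i| ≤ (k : ℤ)} := by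
  have red : ∀ n k m : ℕ, (∃ A : Fin m → Finset (Fin n),
      ∀ d : Fin n → ℝ, (∀ i, d i ∈ MHub.DD τ k) → (∀ j, ∑ i ∈ A j, d i = 0) → d = 0) →
      ∃ x : Fin (m+1) → Fin n → ℤ, (∀ j i, |x j i| ≤ (k : ℤ)) ∧
        Set.InjOn
          (fun y : Fin n → ℤ => fun j : Fin (m+1) =>
            ∑ i, if |(y i : ℝ) - (x j i : ℝ)| ≤ τ
              then |(y i : ℝ) - (x j i : ℝ)| ^ 2 / (2 * τ)
              else |(y i : ℝ) - (x j i : ℝ)| - τ / 2)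
          {y : Fin n → ℤ | ∀ i, |y i| ≤ (k : ℤ)} := by
    rintro n k m ⟨A, hA⟩
    exact MHub.core τ hτ n k m A hA
  refine ⟨405, by norm_num, fun n k hn hk => ?_⟩
  have hn' : (2:ℝ) ≤ n := by exact_mod_cast hn
  have hk' : (1:ℝ) ≤ k := by exact_mod_cast hk
  have hln : 0 < Real.log n := Real.log_pos (by linarith)
  have hlK : 0 ≤ Real.log (2 * (k:ℝ) + 1) := Real.log_nonneg (by linarith)
  rcases le_or_gt (2*k+1) n with h | h
  · have hKn : (2 * (k:ℝ) + 1) ≤ n := by exact_mod_cast h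
    set X := (n : ℝ) * Real.log (2 * (k : ℝ) + 1) / Real.log (n : ℝ) with hX
    have hX0 : 0 ≤ X := by positivity
    have hmin : min (n:ℝ) X = X := by
      apply min_eq_right
      rw [hX, div_le_iff₀ hln]
      gcongr
    obtain ⟨h1, h2⟩ := MHub.numerics n (2*k+1) ⌈100 * X⌉₊ hn (by omega) h
      (by push_cast; exact Nat.le_ceil _)
    obtain ⟨x, hx, hinj⟩ := red n k (4 * ⌈100 * X⌉₊)
      (MHub.detect n (2*k+1) ⌈100 * X⌉₊ (MHub.DD τ k) (by omega) (MHub.DD_card τ k) h1 h2)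
    refine ⟨_, x, ?_, hx, hinj⟩
    rw [hmin]
    push_cast
    have := Nat.ceil_lt_add_one (a := 100 * X) (by positivity)
    linarith
  · have hKn : (n:ℝ) ≤ 2 * (k:ℝ) + 1 := by exact_mod_cast h.le
    obtain ⟨x, hx, hinj⟩ := red n k n ⟨fun j => {j}, fun d _ hd => by
      funext j; simpa using hd j⟩
    refine ⟨_, x, ?_, hx, hinj⟩
    have hmin : min (n:ℝ) ((n : ℝ) * Real.log (2 * (k : ℝ) + 1) / Real.log (n : ℝ)) = n := by
      apply min_eq_left
      rw [le_div_iff₀ hln]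
      gcongr
    rw [hmin]
    push_cast
    linarith
end

section
/- For every real c > 0 there is a constant C_c > 0 such that for all integers n ≥ 2 and k ≥ 1, there exist an integer s with s ≤ C_c·(1 + min{n, n·log(2k+1)/log n}) and query vectors x₁,…,x_s ∈ {−k,…,k}^n such that the map y ↦ (‖y−x₁‖_M, …, ‖y−x_s‖_M) is injective on {−k,−k+1,…,k−1,k}^n, where ‖z‖_M = Σᵢ M(|z_i|) and M is the Fair estimator loss M(x) = c²(|x|/c − log(1 + |x|/c)). -/
open Finset

lemma cb_bound (j : ℕ) : (2*j+1) * (Nat.centralBinom j)^2 ≤ 16^j := by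
  induction j with
  | zero => simp
  | succ j ih =>
    have h := Nat.succ_mul_centralBinom_succ j
    have h2 : (j+1)^2 * ((2*(j+1)+1) * (Nat.centralBinom (j+1))^2) ≤ (j+1)^2 * 16^(j+1) := by
      calc (j+1)^2 * ((2*(j+1)+1) * (Nat.centralBinom (j+1))^2)
          = (2*j+3) * ((j+1) * Nat.centralBinom (j+1))^2 := by ring
        _ = (4*(2*j+3)*(2*j+1)) * ((2*j+1) * (Nat.centralBinom j)^2) := by rw [h]; ring
        _ ≤ (16 * (j+1)^2) * 16^j := by
          apply Nat.mul_le_mul _ ih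
          nlinarith
        _ = _ := by ring
    exact Nat.le_of_mul_le_mul_left h2 (by positivity)

lemma choose_half_sq (m : ℕ) : m * (m.choose (m/2))^2 ≤ 4^m := by
  obtain ⟨j, rfl | rfl⟩ := Nat.even_or_odd' m
  · have h := cb_bound j
    rw [Nat.centralBinom] at h
    have : 2*j/2 = j := by omega
    rw [this, pow_mul]
    norm_num
    nlinarith [sq_nonneg ((2*j).choose j)]
  · have h := cb_bound (j+1)
    have e : (2*j+1)/2 = j := by omega
    have e2 : Nat.centralBinom (j+1) = 2 * (2*j+1).choose j := by
      rw [Nat.centralBinom, show 2*(j+1) = (2*j+1)+1 by ring, Nat.choose_succ_succ,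
        show (2*j+1).choose j.succ = (2*j+1).choose j from Nat.choose_symm_half j]
      ring
    rw [e2] at h
    rw [e]
    have : (4:ℕ)^(2*j+1) = 4 * 16^j := by rw [pow_succ, pow_mul]; norm_num; ring
    rw [this]
    have h3 : (16:ℕ)^(j+1) = 16 * 16^j := by ring
    rw [h3] at h
    nlinarith [sq_nonneg ((2*j+1).choose j)]

lemma choose_half_two (m : ℕ) (hm : 1 ≤ m) : 2 * (m.choose (m/2)) ≤ 2^m := by
  by_cases h : m < 4
  · interval_cases m <;> decide
  · have h1 := choose_half_sq m
    have h2 : (2 * (m.choose (m/2)))^2 ≤ (2^m)^2 := by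
      rw [← pow_mul, mul_comm m 2, pow_mul]
      norm_num
      nlinarith [sq_nonneg (m.choose (m/2))]
    exact (Nat.pow_le_pow_iff_left (by norm_num)).1 h2

lemma littlewood_offord {α : Type*} [Fintype α] [DecidableEq α] (v : α → ℝ) (hv : ∀ i, v i ≠ 0)
    (a : ℝ) :
    #{A : Finset α | ∑ i ∈ A, v i = a} ≤ (Fintype.card α).choose (Fintype.card α / 2) := by
  classical
  set N : Finset α := {i | v i < 0} with hN
  have key : ∀ A : Finset α, ∑ i ∈ symmDiff A N, |v i| = ∑ i ∈ A, v i + ∑ i ∈ N, |v i| := by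
    intro A
    have e1 : ∀ B : Finset α, ∀ f : α → ℝ, ∑ i ∈ B, f i = ∑ i, if i ∈ B then f i else 0 := by
      intro B f; simp
    rw [e1, e1 A, e1 N, ← Finset.sum_add_distrib]
    apply Finset.sum_congr rfl
    intro i _
    by_cases h1 : i ∈ A <;> by_cases h2 : v i < 0 <;> simp [Finset.mem_symmDiff, hN, h1, h2]
    · rw [abs_of_neg h2]; ring
    · exact not_lt.1 h2
  rw [← Finset.card_image_of_injective _ (symmDiff_left_injective N)]
  apply IsAntichain.sperner
  intro X hX Y hY hne hsub
  simp only [coe_image, Set.mem_image, mem_coe, mem_filter, mem_univ, true_and] at hX hY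
  obtain ⟨A, hA, rfl⟩ := hX
  obtain ⟨B, hB, rfl⟩ := hY
  have hss : symmDiff A N ⊂ symmDiff B N := Finset.ssubset_iff_subset_ne.2 ⟨hsub, hne⟩
  obtain ⟨i, hi, hi2⟩ := Finset.exists_of_ssubset hss
  have : ∑ i ∈ symmDiff A N, |v i| < ∑ i ∈ symmDiff B N, |v i| :=
    Finset.sum_lt_sum_of_subset hsub hi hi2 (abs_pos.2 (hv i)) (fun _ _ _ => abs_nonneg _)
  rw [key, key, hA, hB] at this
  exact lt_irrefl _ this

lemma lo_count {α : Type*} [Fintype α] [DecidableEq α] (v : α → ℝ) (m : ℕ)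
    (hm : #{i | v i ≠ 0} = m) :
    #{A : Finset α | ∑ i ∈ A, v i = 0} * 2^m ≤ 2^(Fintype.card α) * m.choose (m/2) := by
  classical
  have h1 := littlewood_offord (α := {i // v i ≠ 0}) (fun i => v i) (fun i => i.2) 0
  have hc : Fintype.card {i // v i ≠ 0} = m := by rw [Fintype.card_subtype, hm]
  have hc2 : Fintype.card {i // ¬ v i ≠ 0} = Fintype.card α - m := by
    rw [Fintype.card_subtype_compl, hc]
  have hle : m ≤ Fintype.card α := by rw [← hm]; exact Finset.card_le_univ _
  rw [hc] at h1
  have h2 : #{A : Finset α | ∑ i ∈ A, v i = 0} ≤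
      #(({A : Finset {i // v i ≠ 0} | ∑ i ∈ A, v i = 0} : Finset (Finset {i // v i ≠ 0})) ×ˢ
        (Finset.univ : Finset (Finset {i // ¬ v i ≠ 0}))) := by
    apply Finset.card_le_card_of_injOn
      (fun A => (A.subtype (fun i => v i ≠ 0), A.subtype (fun i => ¬ v i ≠ 0)))
    · intro A hA
      simp only [coe_filter, mem_univ, true_and, Set.mem_ofPred_eq] at hA
      simp only [coe_product, Set.mem_prod, mem_coe, mem_filter, mem_univ, true_and, and_true]
      rw [Finset.sum_subtype_eq_sum_filter, Finset.sum_filter_ne_zero, hA]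
    · intro A _ B _ h
      simp only [Prod.mk.injEq] at h
      ext i
      by_cases hi : v i ≠ 0
      · have := Finset.ext_iff.1 h.1 ⟨i, hi⟩
        simpa using this
      · have := Finset.ext_iff.1 h.2 ⟨i, hi⟩
        simpa using this
  rw [Finset.card_product, Finset.card_univ, Fintype.card_finset, hc2] at h2
  calc _ ≤ (m.choose (m/2) * 2^(Fintype.card α - m)) * 2^m := by gcongr; exact h2.trans (by gcongr)
    _ = (2^(Fintype.card α - m) * 2^m) * m.choose (m/2) := by ring
    _ = _ := by rw [← pow_add, Nat.sub_add_cancel hle]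

noncomputable def pv {n : ℕ} (v : Fin n → ℝ) : ℝ :=
  (#{A : Finset (Fin n) | ∑ i ∈ A, v i = 0} : ℝ) / 2^n

lemma pv_nonneg {n : ℕ} (v : Fin n → ℝ) : 0 ≤ pv v := by unfold pv; positivity

lemma pv_le {n : ℕ} (v : Fin n → ℝ) :
    pv v ≤ ((#{i | v i ≠ 0}).choose (#{i | v i ≠ 0}/2) : ℝ) / 2^(#{i | v i ≠ 0}) := by
  have h := lo_count v _ rfl
  rw [Fintype.card_fin] at h
  unfold pv
  rw [div_le_div_iff₀ (by positivity) (by positivity), mul_comm (Nat.cast (Nat.choose _ _))]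
  exact_mod_cast h

lemma pv_le_half {n : ℕ} (v : Fin n → ℝ) (hv : v ≠ 0) : pv v ≤ 1/2 := by
  refine (pv_le v).trans ?_
  have hm : 1 ≤ #{i | v i ≠ 0} := by
    obtain ⟨i, hi⟩ := Function.ne_iff.1 hv
    exact Finset.card_pos.2 ⟨i, by simpa using hi⟩
  have := choose_half_two _ hm
  rw [div_le_div_iff₀ (by positivity) (by positivity)]
  rw [mul_comm, one_mul]
  exact_mod_cast this

lemma pv_sq {n : ℕ} (v : Fin n → ℝ) : (#{i | v i ≠ 0} : ℝ) * pv v ^2 ≤ 1 := by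
  have h1 := pv_le v
  have h2 := choose_half_sq #{i | v i ≠ 0}
  calc _ ≤ (#{i | v i ≠ 0} : ℝ) *
        (((#{i | v i ≠ 0}).choose (#{i | v i ≠ 0}/2) : ℝ) / 2^(#{i | v i ≠ 0}))^2 := by
        have := pv_nonneg v
        gcongr
    _ ≤ 1 := by
      rw [div_pow, ← mul_div_assoc, div_le_one (by positivity), ← pow_mul, mul_comm _ 2, pow_mul]
      norm_num
      exact_mod_cast h2

lemma exists_family {n : ℕ} (D : Finset ℝ) (s : ℕ)
    (h : ∑ v ∈ (Fintype.piFinset (fun _ : Fin n => D)).filter (· ≠ 0), pv v ^ s < 1) :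
    ∃ A : Fin s → Finset (Fin n), ∀ v : Fin n → ℝ, (∀ i, v i ∈ D) →
      (∀ j, ∑ i ∈ A j, v i = 0) → v = 0 := by
  classical
  by_contra! hcon
  set V := (Fintype.piFinset (fun _ : Fin n => D)).filter (· ≠ 0) with hV
  have h1 : (Finset.univ : Finset (Fin s → Finset (Fin n))) ⊆ V.biUnion (fun v =>
      Fintype.piFinset (fun _ : Fin s => ({A : Finset (Fin n) | ∑ i ∈ A, v i = 0} : Finset _))) := by
    intro A _
    obtain ⟨v, hv, hA, hne⟩ := hcon A
    simp only [mem_biUnion, Fintype.mem_piFinset, mem_filter, mem_univ, true_and]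
    exact ⟨v, by simp [hV, hne, hv], hA⟩
  have h2 := (Finset.card_le_card h1).trans Finset.card_biUnion_le
  simp only [Fintype.card_piFinset_const, Finset.card_univ, Fintype.card_fun, Fintype.card_finset,
    Fintype.card_fin] at h2
  have h3 : ((2:ℝ)^n)^s ≤ ∑ v ∈ V, (#{A : Finset (Fin n) | ∑ i ∈ A, v i = 0} : ℝ)^s := by
    exact_mod_cast h2
  have h4 : ∑ v ∈ V, pv v ^ s =
      (∑ v ∈ V, (#{A : Finset (Fin n) | ∑ i ∈ A, v i = 0} : ℝ)^s) / (2^n)^s := by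
    rw [Finset.sum_div]; simp only [pv, div_pow]
  rw [h4, div_lt_one (by positivity)] at h
  linarith

lemma small_count {n : ℕ} (hn : 1 ≤ n) (D : Finset ℝ) (q : ℝ) (hq : 1 ≤ q) (hD : (#D : ℝ) ≤ q)
    (t : ℕ) :
    (#((Fintype.piFinset (fun _ : Fin n => D)).filter (fun v => #{i | v i ≠ 0} ≤ t)) : ℝ)
      ≤ 3 * (n * q)^t := by
  classical
  have hn' : (1:ℝ) ≤ n := by exact_mod_cast hn
  set z : ℝ := 1 / (n * q) with hz
  have hnq : 1 ≤ n * q := by nlinarith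
  have hz0 : 0 < z := by positivity
  have hz1 : z ≤ 1 := by rw [hz, div_le_one (by positivity)]; exact hnq
  set P := Fintype.piFinset (fun _ : Fin n => D)
  have h1 : ∑ v ∈ P, z ^ #{i | v i ≠ 0} ≤ 3 := by
    have : ∀ v : Fin n → ℝ, z ^ #{i | v i ≠ 0} = ∏ i, if v i ≠ 0 then z else 1 := by
      intro v
      rw [Finset.prod_ite]; simp
    simp_rw [this]
    rw [← Finset.prod_univ_sum (fun _ : Fin n => D) (fun _ x => if x ≠ 0 then z else 1)]
    rw [Finset.prod_const, Finset.card_univ, Fintype.card_fin]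
    have h2 : ∑ x ∈ D, (if x ≠ 0 then z else 1) ≤ 1 + 1 / n := by
      calc _ ≤ ∑ x ∈ D, (z + if x = 0 then 1 else 0) := by
            apply Finset.sum_le_sum; intro x _; by_cases hx : x = 0 <;> simp [hx, hz0.le]
        _ = #D * z + if (0:ℝ) ∈ D then 1 else 0 := by
            rw [Finset.sum_add_distrib]; simp
        _ ≤ q * z + 1 := by
            gcongr
            split_ifs <;> norm_num
        _ = 1 + 1 / n := by
            rw [hz]; field_simp; ring
    have h0 : 0 ≤ ∑ x ∈ D, (if x ≠ 0 then z else 1) := by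
      apply Finset.sum_nonneg; intro x _; split_ifs <;> linarith
    calc _ ≤ (1 + 1 / (n:ℝ))^n := by gcongr
      _ ≤ (Real.exp (1/n))^n := by
        gcongr; linarith [Real.add_one_le_exp (1/(n:ℝ))]
      _ = Real.exp 1 := by
        rw [← Real.exp_nat_mul]; congr 1; field_simp
      _ ≤ 3 := by linarith [Real.exp_one_lt_d9]
  have h2 : (#(P.filter (fun v => #{i | v i ≠ 0} ≤ t)) : ℝ) * z^t ≤ 3 := by
    calc _ = ∑ v ∈ P.filter (fun v => #{i | v i ≠ 0} ≤ t), z^t := by simp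
      _ ≤ ∑ v ∈ P.filter (fun v => #{i | v i ≠ 0} ≤ t), z ^ #{i | v i ≠ 0} := by
        apply Finset.sum_le_sum; intro v hv
        exact pow_le_pow_of_le_one hz0.le hz1 (Finset.mem_filter.1 hv).2
      _ ≤ ∑ v ∈ P, z ^ #{i | v i ≠ 0} := by
        apply Finset.sum_le_sum_of_subset_of_nonneg (Finset.filter_subset _ _)
        intros; positivity
      _ ≤ 3 := h1
  rw [hz, div_pow, one_pow, mul_one_div, div_le_iff₀ (by positivity)] at h2
  exact h2

lemma sum_bound {n : ℕ} (hn : 1 ≤ n) (D : Finset ℝ) (q : ℝ) (hq : 1 ≤ q) (hD : (#D : ℝ) ≤ q)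
    (s : ℕ) (r : ℝ) (hr : 0 < r) (hr4 : r^4 * n = 1) :
    ∑ v ∈ (Fintype.piFinset (fun _ : Fin n => D)).filter (· ≠ 0), pv v ^ s
      ≤ 3 * (n * q)^(Nat.sqrt n) * (1/2)^s + q^n * r^s := by
  classical
  set P := Fintype.piFinset (fun _ : Fin n => D)
  have hpt : ∀ v ∈ P.filter (· ≠ 0), pv v ^ s ≤
      (if #{i | v i ≠ 0} ≤ Nat.sqrt n then (1/2:ℝ)^s else 0) + r^s := by
    intro v hv
    have hv0 := (Finset.mem_filter.1 hv).2
    have hp := pv_nonneg v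
    split_ifs with h
    · have := pow_le_pow_left₀ hp (pv_le_half v hv0) s
      have : 0 ≤ r^s := by positivity
      linarith
    · rw [zero_add]
      apply pow_le_pow_left₀ hp
      have h1 := pv_sq v
      set m := #{i | v i ≠ 0}
      have hm : n < m * m := Nat.sqrt_lt.1 (not_le.1 h)
      have hm' : (n:ℝ) < m * m := by exact_mod_cast hm
      by_contra! hlt
      have h2 : r^4 < pv v ^4 := by gcongr
      have h3 : ((m:ℝ) * pv v^2)^2 ≤ 1 := by
        apply pow_le_one₀ (by positivity) h1
      have hn0 : (0:ℝ) < n := by exact_mod_cast hn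
      have : r^4 * n < pv v^4 * (m*m) := by
        apply mul_lt_mul'' h2 hm' (by positivity) (by positivity)
      nlinarith
  refine (Finset.sum_le_sum hpt).trans ?_
  rw [Finset.sum_add_distrib]
  apply add_le_add
  · calc _ ≤ ∑ v ∈ P, (if #{i | v i ≠ 0} ≤ Nat.sqrt n then (1/2:ℝ)^s else 0) := by
          apply Finset.sum_le_sum_of_subset_of_nonneg (Finset.filter_subset _ _)
          intros; split_ifs <;> positivity
      _ = #(P.filter (fun v => #{i | v i ≠ 0} ≤ Nat.sqrt n)) * (1/2:ℝ)^s := by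
          rw [← Finset.sum_filter]; simp
      _ ≤ _ := by
          gcongr
          exact small_count hn D q hq hD _
  · calc _ ≤ ∑ v ∈ P, r^s := by
          apply Finset.sum_le_sum_of_subset_of_nonneg (Finset.filter_subset _ _)
          intros; positivity
      _ = (#D:ℝ)^n * r^s := by simp [P]
      _ ≤ _ := by gcongr

lemma numeric (n : ℕ) (hn : 3 ≤ n) (w : ℝ) (hw : 3 ≤ w) (hwn : w ≤ n) (s : ℕ)
    (hs : 100 * (n * Real.log w / Real.log n) ≤ s) :
    3 * (n * w^2)^(Nat.sqrt n) * (1/2:ℝ)^s + (w^2)^n * (Real.exp (-(Real.log n / 4)))^s < 1 := by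
  have hn' : (3:ℝ) ≤ n := by exact_mod_cast hn
  have hL : 1 ≤ Real.log w := by
    rw [Real.le_log_iff_exp_le (by linarith)]
    linarith [Real.exp_one_lt_d9]
  have hLn : Real.log w ≤ Real.log n := Real.log_le_log (by linarith) hwn
  set L := Real.log w
  set l := Real.log n
  have hl : 1 ≤ l := hL.trans hLn
  have ew : w = Real.exp L := (Real.exp_log (by linarith)).symm
  have en : (n:ℝ) = Real.exp l := (Real.exp_log (by linarith)).symm
  have hls : l^2 ≤ 16 * √n := by
    have e1 : √n = Real.exp (l/4)^2 := by
      rw [Real.sqrt_eq_iff_mul_self_eq (by positivity) (by positivity), en, ← pow_two, ← pow_mul,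
        ← Real.exp_nat_mul]
      congr 1; push_cast; ring
    have e2 : l/4 ≤ Real.exp (l/4) := by linarith [Real.add_one_le_exp (l/4)]
    have : (l/4)^2 ≤ Real.exp (l/4)^2 := by gcongr
    rw [e1]; linarith
  have hsq : √n * √n = n := Real.mul_self_sqrt (by positivity)
  have hn1 : 1 ≤ √(n:ℝ) := by rw [Real.one_le_sqrt]; linarith
  have hQ : √n * l ≤ 16 * (n / l) := by
    rw [mul_div_assoc', le_div_iff₀ (by linarith)]
    nlinarith
  have hQ1 : 1 ≤ √n * l := by nlinarith
  have hs' : 100 * (n / l * L) ≤ s := by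
    have : n * L / l = n / l * L := by ring
    rw [← this]; exact hs
  have hQ0 : 0 < n / l := by positivity
  have hQ2 : 1 ≤ n / l := by
    rw [le_div_iff₀ (by linarith), en]; linarith [Real.add_one_le_exp l]
  have hlog2 := Real.log_two_gt_d9
  have ht : (Nat.sqrt n : ℝ) ≤ √n := Real.nat_sqrt_le_real_sqrt
  have hnw : (n:ℝ) * w^2 ≤ Real.exp (3*l) := by
    have : Real.exp (3*l) = n * (n:ℝ)^2 := by
      rw [show 3 * l = ((3:ℕ):ℝ) * l by norm_num, Real.exp_nat_mul, ← en]; ring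
    rw [this]; gcongr
  have A1 : 3 * (n * w^2)^(Nat.sqrt n) * (1/2:ℝ)^s ≤ 3 * Real.exp (-2) := by
    have a : ((n:ℝ) * w^2)^(Nat.sqrt n) ≤ Real.exp (3*(√n * l)) := by
      calc _ ≤ (Real.exp (3*l))^(Nat.sqrt n) := by gcongr
        _ = Real.exp (Nat.sqrt n * (3*l)) := by rw [Real.exp_nat_mul]
        _ ≤ _ := by
          apply Real.exp_le_exp.2; nlinarith
    have b : (1/2:ℝ)^s = Real.exp (-(s * Real.log 2)) := by
      rw [Real.exp_neg, Real.exp_nat_mul, Real.exp_log (by norm_num)]; simp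
    rw [b, mul_assoc]
    gcongr
    calc _ ≤ Real.exp (3*(√n * l)) * Real.exp (-(s * Real.log 2)) := by gcongr
      _ = Real.exp (3*(√n * l) + -(s * Real.log 2)) := by rw [Real.exp_add]
      _ ≤ _ := by
        apply Real.exp_le_exp.2
        have : n / l ≤ n / l * L := by nlinarith
        have h5 : (s:ℝ) * (1/2) ≤ s * Real.log 2 := by gcongr; linarith
        nlinarith
  have A2 : (w^2)^n * (Real.exp (-(l / 4)))^s ≤ Real.exp (-2) := by
    rw [ew, ← pow_mul, ← Real.exp_nat_mul, ← Real.exp_nat_mul, ← Real.exp_add]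
    apply Real.exp_le_exp.2
    push_cast
    have : 100 * (n * L) ≤ s * l := by
      have := mul_le_mul_of_nonneg_right hs' (by linarith : 0 ≤ l)
      have e : 100 * (n / l * L) * l = 100 * (n * L) := by field_simp
      linarith
    nlinarith
  have h2 : Real.exp (-2) < 1/4 := by
    rw [Real.exp_neg, inv_lt_comm₀ (Real.exp_pos _) (by norm_num)]
    have : Real.exp 2 = Real.exp 1 * Real.exp 1 := by rw [← Real.exp_add]; norm_num
    rw [this]; nlinarith [Real.exp_one_gt_d9]
  linarith

noncomputable def phi (c u : ℝ) : ℝ := c^2 * (|u| / c - Real.log (1 + |u| / c))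

lemma phi_conv_pos (c : ℝ) (hc : 0 < c) (u : ℝ) (hu : 1 ≤ u) :
    2 * phi c u < phi c (u+1) + phi c (u-1) := by
  unfold phi
  rw [abs_of_nonneg (by linarith : 0 ≤ u), abs_of_nonneg (by linarith : 0 ≤ u+1),
    abs_of_nonneg (by linarith : 0 ≤ u-1)]
  have p1 : 0 < 1 + u/c := by positivity
  have p2 : 0 < 1 + (u+1)/c := by positivity
  have p3 : 0 < 1 + (u-1)/c := by have := div_nonneg (by linarith : 0 ≤ u-1) hc.le; linarith
  have h : Real.log (1 + (u+1)/c) + Real.log (1 + (u-1)/c) < 2 * Real.log (1 + u/c) := by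
    rw [← Real.log_mul p2.ne' p3.ne', two_mul, ← Real.log_mul p1.ne' p1.ne']
    apply Real.log_lt_log (by positivity)
    have : (1 + u/c) * (1+u/c) = (1 + (u+1)/c) * (1 + (u-1)/c) + (1/c)^2 := by field_simp; ring
    rw [this]; have : 0 < (1/c)^2 := by positivity
    linarith
  have e : (u+1)/c + (u-1)/c = 2 * (u/c) := by ring
  have : 0 < c^2 := by positivity
  nlinarith

lemma phi_conv (c : ℝ) (hc : 0 < c) (z : ℤ) :
    2 * phi c z < phi c (z+1) + phi c (z-1) := by
  have hneg : ∀ u, phi c (-u) = phi c u := by intro u; simp [phi]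
  rcases lt_trichotomy z 0 with h | h | h
  · have h1 : (1:ℝ) ≤ -z := by exact_mod_cast (by omega : (1:ℤ) ≤ -z)
    have := phi_conv_pos c hc (-z) h1
    rw [hneg, show -(z:ℝ)+1 = -(z-1) by ring, show -(z:ℝ)-1 = -(z+1) by ring, hneg, hneg] at this
    linarith
  · subst h
    have h0 : phi c 0 = 0 := by simp [phi]
    have h1 : 0 < phi c 1 := by
      unfold phi
      have : Real.log (1 + |1|/c) < |1|/c := by
        have hp : 0 < |(1:ℝ)|/c := by positivity
        have := Real.log_lt_sub_one_of_pos (x := 1 + |1|/c) (by positivity) (by linarith)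
        linarith
      have : 0 < c^2 := by positivity
      apply mul_pos this; linarith
    have := hneg 1
    norm_num at *
    linarith
  · exact phi_conv_pos c hc z (by exact_mod_cast h)

noncomputable def gg (c : ℝ) (z : ℤ) : ℝ := phi c (z - 1) - phi c z

lemma gg_inj (c : ℝ) (hc : 0 < c) : Function.Injective (gg c) := by
  apply StrictAnti.injective
  apply strictAnti_int_of_succ_lt
  intro z
  have := phi_conv c hc z
  unfold gg
  push_cast
  rw [add_sub_cancel_right]
  linarith

lemma main_reduce (c : ℝ) (hc : 0 < c) (n k : ℕ) (hk : 1 ≤ k) (s : ℕ) (A : Fin s → Finset (Fin n))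
    (hA : ∀ v : Fin n → ℝ,
      (∀ i, v i ∈ ((Finset.Icc (-(k:ℤ)) k) ×ˢ (Finset.Icc (-(k:ℤ)) k)).image
        (fun p => gg c p.1 - gg c p.2)) → (∀ j, ∑ i ∈ A j, v i = 0) → v = 0) :
    ∃ x : Fin (s+1) → Fin n → ℤ,
        (∀ j i, |x j i| ≤ (k : ℤ)) ∧
        Set.InjOn
          (fun y : Fin n → ℤ => fun j : Fin (s+1) =>
            ∑ i, c ^ 2 * (|(y i : ℝ) - (x j i : ℝ)| / c -
              Real.log (1 + |(y i : ℝ) - (x j i : ℝ)| / c)))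
          {y : Fin n → ℤ | ∀ i, |y i| ≤ (k : ℤ)} := by
  refine ⟨Fin.cons 0 (fun j i => if i ∈ A j then 1 else 0), ?_, ?_⟩
  · intro j i
    refine Fin.cases ?_ (fun j => ?_) j
    · simp
    · simp only [Fin.cons_succ]
      split_ifs <;> simp
      omega
  · intro y hy y' hy' h
    have h0 : ∑ i, phi c (y i) = ∑ i, phi c (y' i) := by
      have := congrFun h 0
      simpa [phi] using this
    have h1 : ∀ j, ∑ i ∈ A j, (gg c (y i) - gg c (y' i)) = 0 := by
      intro j
      have h2 := congrFun h j.succ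
      simp only [Fin.cons_succ] at h2
      have e : ∀ y : Fin n → ℤ, ∑ i, phi c ((y i:ℝ) - ((if i ∈ A j then 1 else 0 : ℤ) : ℝ)) =
          ∑ i, phi c (y i) + ∑ i ∈ A j, gg c (y i) := by
        intro y
        have : ∑ i ∈ A j, gg c (y i) = ∑ i, if i ∈ A j then gg c (y i) else 0 := by simp
        rw [this, ← Finset.sum_add_distrib]
        apply Finset.sum_congr rfl
        intro i _
        split_ifs <;> simp [gg]
      have h3 := (e y).symm.trans (Eq.trans h2 (e y'))
      rw [Finset.sum_sub_distrib]
      linarith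
    have h4 := hA (fun i => gg c (y i) - gg c (y' i)) ?_ h1
    · funext i
      have := congrFun h4 i
      simp only [Pi.zero_apply] at this
      exact gg_inj c hc (by linarith)
    · intro i
      apply Finset.mem_image.2
      refine ⟨(y i, y' i), ?_, rfl⟩
      simp only [Finset.mem_product, Finset.mem_Icc]
      exact ⟨abs_le.1 (hy i), abs_le.1 (hy' i)⟩


/-- Nonadaptive Mastermind upper bound for the Fair estimator loss with parameter `c > 0`:
`M(x) = c²(|x|/c − log(1 + |x|/c))`, queries answered by `‖y−x‖_M = Σᵢ M(|yᵢ−xᵢ|)`. -/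
theorem mastermind_fair_upper (c : ℝ) (hc : 0 < c) :
    ∃ C : ℝ, 0 < C ∧ ∀ n k : ℕ, 2 ≤ n → 1 ≤ k →
      ∃ (s : ℕ) (x : Fin s → Fin n → ℤ),
        (s : ℝ) ≤ C * (1 + min (n : ℝ)
            ((n : ℝ) * Real.log (2 * (k : ℝ) + 1) / Real.log (n : ℝ))) ∧
        (∀ j i, |x j i| ≤ (k : ℤ)) ∧
        Set.InjOn
          (fun y : Fin n → ℤ => fun j : Fin s =>
            ∑ i, c ^ 2 * (|(y i : ℝ) - (x j i : ℝ)| / c -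
              Real.log (1 + |(y i : ℝ) - (x j i : ℝ)| / c)))
          {y : Fin n → ℤ | ∀ i, |y i| ≤ (k : ℤ)} := by
  refine ⟨100, by norm_num, ?_⟩
  intro n k hn hk
  have hn' : (2:ℝ) ≤ n := by exact_mod_cast hn
  have hk' : (1:ℝ) ≤ k := by exact_mod_cast hk
  have hl : 0 < Real.log n := Real.log_pos (by linarith)
  by_cases hkn : (2 * (k:ℝ) + 1) ≤ n
  · have hmin : min (n : ℝ) ((n : ℝ) * Real.log (2 * (k : ℝ) + 1) / Real.log (n : ℝ)) =
        (n : ℝ) * Real.log (2 * (k : ℝ) + 1) / Real.log (n : ℝ) := by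
      apply min_eq_right
      rw [div_le_iff₀ hl]
      gcongr
    rw [hmin]
    set T := (n : ℝ) * Real.log (2 * (k : ℝ) + 1) / Real.log (n : ℝ) with hT
    have hT0 : 0 ≤ T := by
      have : 0 ≤ Real.log (2 * (k : ℝ) + 1) := Real.log_nonneg (by linarith)
      positivity
    set s := ⌈100 * T⌉₊ with hs
    have hs1 : 100 * T ≤ s := Nat.le_ceil _
    have hs2 : (s:ℝ) < 100 * T + 1 := Nat.ceil_lt_add_one (by positivity)
    set D := ((Finset.Icc (-(k:ℤ)) k) ×ˢ (Finset.Icc (-(k:ℤ)) k)).image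
        (fun p => gg c p.1 - gg c p.2) with hDdef
    have hD : (#D : ℝ) ≤ (2 * (k:ℝ) + 1)^2 := by
      have h1 : #D ≤ (2*k+1)^2 := by
        refine Finset.card_image_le.trans ?_
        rw [Finset.card_product, Int.card_Icc, pow_two]
        apply le_of_eq
        congr 1 <;> omega
      exact_mod_cast h1
    have hn3 : 3 ≤ n := by exact_mod_cast (by linarith : (3:ℝ) ≤ n)
    have hb := sum_bound (n := n) (by omega) D ((2 * (k:ℝ) + 1)^2) (by nlinarith) hD s
      (Real.exp (-(Real.log n / 4))) (Real.exp_pos _) (by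
        rw [← Real.exp_nat_mul]
        push_cast
        rw [show 4 * -(Real.log n / 4) = - Real.log n by ring, Real.exp_neg,
          Real.exp_log (by linarith)]
        field_simp)
    have hnum := numeric n hn3 (2*(k:ℝ)+1) (by linarith) hkn s hs1
    obtain ⟨A, hA⟩ := exists_family D s (hb.trans_lt hnum)
    obtain ⟨x, hx1, hx2⟩ := main_reduce c hc n k hk s A hA
    refine ⟨s+1, x, ?_, hx1, hx2⟩
    push_cast
    linarith
  · have hmin : min (n : ℝ) ((n : ℝ) * Real.log (2 * (k : ℝ) + 1) / Real.log (n : ℝ)) = n := by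
      apply min_eq_left
      rw [le_div_iff₀ hl]
      gcongr
      linarith
    rw [hmin]
    obtain ⟨x, hx1, hx2⟩ := main_reduce c hc n k hk n (fun j => {j}) (by
      intro v _ h
      funext i
      simpa using h i)
    refine ⟨n+1, x, ?_, hx1, hx2⟩
    push_cast
    linarith
end

section
/- There is an absolute constant C > 0 such that for all integers n ≥ 2 and k ≥ 1, there exist an integer s with s ≤ C·(1 + min{n, n·k/log n}) and query vectors x₁,…,x_s ∈ {−k,…,k}^n such that the map y ↦ (Σᵢ exp(|y_i − (x₁)_i|), …, Σᵢ exp(|y_i − (x_s)_i|)) is injective on {−k,−k+1,…,k−1,k}^n. (That is, s nonadaptive smooth max queries suffice to determine y exactly.) -/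
/-- One sparse coin-weighing step: three copies of a detecting matrix plus an identity block. -/
theorem detecting_exists (j : ℕ) :
    ∃ (R C : Type) (_ : Fintype R) (_ : Fintype C) (A : R → C → ℤ),
      Fintype.card R = 3 ^ j ∧ 3 * Fintype.card C = 3 ^ j * (3 + j) ∧
      (∀ r c, A r c = 0 ∨ A r c = 1 ∨ A r c = -1) ∧
      ∀ δ : C → ℤ, (∀ c, |δ c| ≤ 2) → (∀ r, ∑ c, A r c * δ c = 0) → ∀ c, δ c = 0 := by
  classical
  induction j with
  | zero =>
    refine ⟨Unit, Unit, inferInstance, inferInstance, fun _ _ => 1, by simp, by simp, by simp, ?_⟩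
    intro δ _ h c
    simpa using h ()
  | succ j ih =>
    obtain ⟨R, C, fR, fC, A, hR, hC, hA, hdet⟩ := ih
    let B : (R ⊕ R ⊕ R) → (C ⊕ C ⊕ C ⊕ R) → ℤ := fun r c =>
      match r, c with
      | .inl r, .inl c => A r c
      | .inl r, .inr (.inl c) => A r c
      | .inl r, .inr (.inr (.inl c)) => A r c
      | .inl r, .inr (.inr (.inr s)) => if r = s then 1 else 0
      | .inr (.inl r), .inl c => A r c
      | .inr (.inl r), .inr (.inl c) => - A r c
      | .inr (.inl _), .inr (.inr _) => 0
      | .inr (.inr r), .inl c => A r c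
      | .inr (.inr _), .inr (.inl _) => 0
      | .inr (.inr r), .inr (.inr (.inl c)) => - A r c
      | .inr (.inr _), .inr (.inr (.inr _)) => 0
    refine ⟨R ⊕ R ⊕ R, C ⊕ C ⊕ C ⊕ R, inferInstance, inferInstance, B, ?_, ?_, ?_, ?_⟩
    · simp only [Fintype.card_sum, hR]; ring
    · simp only [Fintype.card_sum, hR]
      have : 3 * (Fintype.card C + (Fintype.card C + (Fintype.card C + 3 ^ j)))
          = 3 * (3 * Fintype.card C) + 3 * 3 ^ j := by ring
      rw [this, hC]; ring
    · rintro (r | r | r) (c | c | c | c) <;> simp only [B] <;>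
        first
          | (simp; done)
          | (split_ifs <;> simp; done)
          | exact hA r c
          | (rcases hA r c with h | h | h <;> simp [h]; done)
          | simp
    · intro δ hb h
      have h1 : ∀ r, ∑ c, A r c * δ (.inl c) + (∑ c, A r c * δ (.inr (.inl c)) +
          (∑ c, A r c * δ (.inr (.inr (.inl c))) + δ (.inr (.inr (.inr r))))) = 0 := by
        intro r
        have := h (.inl r)
        simpa [B, Fintype.sum_sum_type] using this
      have h2 : ∀ r, ∑ c, A r c * δ (.inl c) - ∑ c, A r c * δ (.inr (.inl c)) = 0 := by
        intro r
        have := h (.inr (.inl r))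
        simpa [B, Fintype.sum_sum_type, sub_eq_add_neg] using this
      have h3 : ∀ r, ∑ c, A r c * δ (.inl c) - ∑ c, A r c * δ (.inr (.inr (.inl c))) = 0 := by
        intro r
        have := h (.inr (.inr r))
        simpa [B, Fintype.sum_sum_type, sub_eq_add_neg] using this
      have h4 : ∀ r, δ (.inr (.inr (.inr r))) = 0 := by
        intro r
        have a := h1 r
        have b := h2 r
        have c := h3 r
        have d := abs_le.1 (hb (.inr (.inr (.inr r))))
        omega
      have k1 := hdet (fun c => δ (.inl c)) (fun c => hb _) (fun r => by
        have a := h1 r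
        have b := h2 r
        have c := h3 r
        have d := h4 r
        omega)
      have k2 := hdet (fun c => δ (.inr (.inl c))) (fun c => hb _) (fun r => by
        have a := h1 r
        have b := h2 r
        have c := h3 r
        have d := h4 r
        omega)
      have k3 := hdet (fun c => δ (.inr (.inr (.inl c)))) (fun c => hb _) (fun r => by
        have a := h1 r
        have b := h2 r
        have c := h3 r
        have d := h4 r
        omega)
      rintro (c | c | c | c)
      · exact k1 c
      · exact k2 c
      · exact k3 c
      · exact h4 c

/-- Detecting matrices with `n` columns and `O(n / log n)` rows. -/
theorem detecting_n (n : ℕ) (hn : 2 ≤ n) :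
    ∃ (R : Type) (_ : Fintype R) (A : R → Fin n → ℤ),
      (Fintype.card R : ℝ) ≤ 18 * ((n : ℝ) / Real.log n) ∧ 0 < Fintype.card R ∧
      (∀ r c, A r c = 0 ∨ A r c = 1 ∨ A r c = -1) ∧
      ∀ δ : Fin n → ℤ, (∀ c, |δ c| ≤ 2) → (∀ r, ∑ c, A r c * δ c = 0) → ∀ c, δ c = 0 := by
  classical
  have hex : ∃ j : ℕ, 3 * n ≤ 3 ^ j * (3 + j) := by
    refine ⟨n, ?_⟩
    have : n < 3 ^ n := Nat.lt_pow_self (by norm_num)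
    nlinarith
  obtain ⟨j, hj1, hj2⟩ : ∃ j : ℕ, 3 * n ≤ 3 ^ (j + 1) * (3 + (j + 1)) ∧
      3 ^ j * (3 + j) < 3 * n := by
    have h0 : Nat.find hex ≠ 0 := by
      intro h
      have := Nat.find_spec hex
      rw [h] at this
      simp at this
      omega
    obtain ⟨j, hj⟩ := Nat.exists_eq_succ_of_ne_zero h0
    refine ⟨j, ?_, ?_⟩
    · have := Nat.find_spec hex
      rw [hj] at this
      exact this
    · have := Nat.find_min hex (m := j) (by omega)
      omega
  obtain ⟨R, C, fR, fC, A, hR, hC, hA, hdet⟩ := detecting_exists (j + 1)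
  have hcard : Fintype.card (Fin n) ≤ Fintype.card C := by
    simp only [Fintype.card_fin]
    have : 3 * n ≤ 3 * Fintype.card C := by rw [hC]; exact hj1
    omega
  obtain ⟨f⟩ := Function.Embedding.nonempty_of_card_le hcard
  refine ⟨R, fR, fun r c => A r (f c), ?_, by rw [hR]; positivity, fun r c => hA _ _, ?_⟩
  · rw [hR]
    have hlog : 0 < Real.log n := Real.log_pos (by exact_mod_cast hn)
    rw [← mul_div_assoc, le_div_iff₀ hlog]
    have e1 : (n : ℝ) ≤ 3 ^ (j + 1) * ((j + 1 : ℝ) / 3 + 1) := by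
      have : (3 : ℝ) * n ≤ 3 ^ (j + 1) * (3 + (j + 1)) := by exact_mod_cast hj1
      have e : (3 : ℝ) ^ (j + 1) * ((j + 1 : ℝ) / 3 + 1) = (3 ^ (j + 1) * (3 + (j + 1))) / 3 := by
        ring
      rw [e]; linarith
    have e2 : (3 : ℝ) ^ j * (3 + j) < 3 * n := by exact_mod_cast hj2
    have e3 : Real.log n ≤ 2 * (j + 1) := by
      have hlt : (n : ℝ) ≤ Real.exp (2 * (j + 1)) := by
        refine e1.trans ?_
        have a1 : (j + 1 : ℝ) / 3 + 1 ≤ Real.exp ((j + 1 : ℝ) / 3) := Real.add_one_le_exp _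
        have a2 : (3 : ℝ) ≤ Real.exp (5 / 3) := by
          have h1 := Real.quadratic_le_exp_of_nonneg (x := 5 / 3) (by norm_num)
          norm_num at h1 ⊢
          linarith
        have a3 : (3 : ℝ) ^ (j + 1) ≤ Real.exp (5 / 3 * (j + 1)) := by
          calc (3 : ℝ) ^ (j + 1) ≤ (Real.exp (5 / 3)) ^ (j + 1) := by gcongr
            _ = Real.exp (5 / 3 * (j + 1)) := by
              rw [← Real.exp_nat_mul]; push_cast; ring_nf
        calc (3 : ℝ) ^ (j + 1) * ((j + 1 : ℝ) / 3 + 1)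
            ≤ Real.exp (5 / 3 * (j + 1)) * Real.exp ((j + 1 : ℝ) / 3) := by gcongr
          _ = Real.exp (2 * (j + 1)) := by rw [← Real.exp_add]; ring_nf
      calc Real.log n ≤ Real.log (Real.exp (2 * (j + 1))) :=
            Real.log_le_log (by positivity) hlt
        _ = _ := Real.log_exp _
    push_cast
    have hp : (0 : ℝ) < 3 ^ j := by positivity
    have hj0 : (0 : ℝ) ≤ j := by positivity
    calc (3 : ℝ) ^ (j + 1) * Real.log n ≤ 3 ^ (j + 1) * (2 * (j + 1)) := by gcongr
      _ = 6 * (3 ^ j * (j + 1)) := by ring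
      _ ≤ 6 * (3 ^ j * (3 + j)) := by
        have : (j + 1 : ℝ) ≤ 3 + j := by linarith
        gcongr
      _ ≤ 18 * n := by linarith
  · intro δ hb h
    let δ' : C → ℤ := Function.extend f δ 0
    have hfe : ∀ c, δ' (f c) = δ c := fun c => f.injective.extend_apply _ _ _
    have hne : ∀ c, (¬ ∃ a, f a = c) → δ' c = 0 := fun c hc => by
      simp [δ', Function.extend_apply' _ _ _ hc]
    have := hdet δ' (fun c => by
      by_cases hc : ∃ a, f a = c
      · obtain ⟨a, rfl⟩ := hc
        rw [hfe]; exact hb a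
      · rw [hne c hc]; norm_num) (fun r => by
      rw [← h r]
      symm
      have : ∀ c, A r (f c) * δ c = A r (f c) * δ' (f c) := fun c => by rw [hfe]
      simp only [this]
      exact Fintype.sum_of_injective f f.injective (fun c => A r (f c) * δ' (f c))
        (fun c => A r c * δ' c)
        (fun c hc => by rw [hne c (fun ⟨a, ha⟩ => hc ⟨a, ha⟩), mul_zero]) (fun c => rfl))
    intro c
    rw [← hfe]; exact this _

/-- Linear query scheme. -/
theorem scheme_linear (n k : ℕ) (hk : 1 ≤ k) (y y' : Fin n → ℤ)
    (h : ∀ o : Option (Fin n),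
      ∑ i, Real.exp |(y i : ℝ) - ((if o = some i then -(k : ℤ) else k : ℤ) : ℝ)| =
      ∑ i, Real.exp |(y' i : ℝ) - ((if o = some i then -(k : ℤ) else k : ℤ) : ℝ)|)
    (hy : ∀ i, |y i| ≤ (k : ℤ)) (hy' : ∀ i, |y' i| ≤ (k : ℤ)) : y = y' := by
  classical
  have key : ∀ z : Fin n → ℤ, (∀ i, |z i| ≤ (k : ℤ)) → ∀ j,
      ∑ i, Real.exp |(z i : ℝ) - ((if some j = some i then -(k : ℤ) else k : ℤ) : ℝ)| -
      ∑ i, Real.exp |(z i : ℝ) - ((if none = some i then -(k : ℤ) else k : ℤ) : ℝ)| =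
      Real.exp (k + z j) - Real.exp (k - z j) := by
    intro z hz j
    rw [← Finset.sum_sub_distrib, Finset.sum_eq_single j]
    · have := abs_le.1 (hz j)
      have h1 : -(k : ℝ) ≤ z j := by exact_mod_cast this.1
      have h2 : (z j : ℝ) ≤ k := by exact_mod_cast this.2
      simp only [if_true, reduceCtorEq, if_false]
      push_cast
      rw [abs_of_nonneg (by linarith), abs_of_nonpos (by linarith)]
      ring_nf
    · intro b _ hb
      simp [Ne.symm hb]
    · simp
  funext j
  have e := key y hy j
  rw [h, h, key y' hy' j] at e
  have mono : ∀ a b : ℤ, a < b → Real.exp (k + a) - Real.exp (k - a) <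
      Real.exp (k + b) - Real.exp (k - b) := by
    intro a b hab
    have hab' : (a : ℝ) < b := by exact_mod_cast hab
    have h1 : Real.exp (k + a) < Real.exp (k + b) := Real.exp_lt_exp.2 (by linarith)
    have h2 : Real.exp (k - b) < Real.exp (k - a) := Real.exp_lt_exp.2 (by linarith)
    linarith
  rcases lt_trichotomy (y j) (y' j) with hlt | heq | hlt
  · have := mono _ _ hlt; linarith
  · exact heq
  · have := mono _ _ hlt; linarith

theorem exp_second (a d : ℤ) :
    Real.exp |(a : ℝ) - (d + 1 : ℤ)| + Real.exp |(a : ℝ) - (d - 1 : ℤ)|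
      - (Real.exp 1 + Real.exp (-1)) * Real.exp |(a : ℝ) - (d : ℤ)| =
      (Real.exp 1 - Real.exp (-1)) * (if a = d then 1 else 0 : ℤ) := by
  rcases lt_trichotomy a d with h | h | h
  · have h' : (a : ℝ) + 1 ≤ d := by exact_mod_cast h
    push_cast
    rw [abs_of_nonpos (by linarith), abs_of_nonpos (by linarith), abs_of_nonpos (by linarith),
      if_neg h.ne, add_mul, ← Real.exp_add, ← Real.exp_add]
    simp only [Int.cast_zero, mul_zero]
    ring_nf
  · subst h
    simp
    try ring
  · have h' : (d : ℝ) + 1 ≤ a := by exact_mod_cast h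
    push_cast
    rw [abs_of_nonneg (by linarith), abs_of_nonneg (by linarith), abs_of_nonneg (by linarith),
      if_neg h.ne', add_mul, ← Real.exp_add, ← Real.exp_add]
    simp only [Int.cast_zero, mul_zero]
    ring_nf

theorem exp_top (a k : ℤ) (h : a ≤ k) :
    Real.exp |(a : ℝ) - (k : ℤ)| - Real.exp 1 * Real.exp |(a : ℝ) - (k - 1 : ℤ)| =
      (1 - Real.exp 1 * Real.exp 1) * (if a = k then 1 else 0 : ℤ) := by
  rcases h.eq_or_lt with h | h
  · subst h; simp
  · have h' : (a : ℝ) + 1 ≤ k := by exact_mod_cast h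
    push_cast
    rw [abs_of_nonpos (by linarith), abs_of_nonpos (by linarith),
      if_neg h.ne, ← Real.exp_add]
    simp only [Int.cast_zero, mul_zero]
    ring_nf

theorem exp_bot (a k : ℤ) (h : -k ≤ a) :
    Real.exp |(a : ℝ) - (-k : ℤ)| - Real.exp 1 * Real.exp |(a : ℝ) - (-k + 1 : ℤ)| =
      (1 - Real.exp 1 * Real.exp 1) * (if a = -k then 1 else 0 : ℤ) := by
  rcases h.eq_or_lt with h | h
  · subst h; simp
  · have h' : -(k : ℝ) + 1 ≤ a := by exact_mod_cast h
    push_cast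
    rw [abs_of_nonneg (by linarith), abs_of_nonneg (by linarith),
      if_neg h.ne', ← Real.exp_add]
    simp only [Int.cast_zero, mul_zero]
    ring_nf

/-- Coin weighing scheme. -/
theorem scheme_weigh (n k : ℕ) (hk : 1 ≤ k) (R : Type) [Nonempty R] (A : R → Fin n → ℤ)
    (hA : ∀ r c, A r c = 0 ∨ A r c = 1 ∨ A r c = -1)
    (hdet : ∀ δ : Fin n → ℤ, (∀ c, |δ c| ≤ 2) → (∀ r, ∑ c, A r c * δ c = 0) → ∀ c, δ c = 0)
    (y y' : Fin n → ℤ)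
    (h : ∀ (r : R) (b : Bool) (d : ℤ), |d| ≤ k →
      ∑ i, Real.exp |(y i : ℝ) - ((if A r i = (if b then 1 else -1) then d else k : ℤ) : ℝ)| =
      ∑ i, Real.exp |(y' i : ℝ) - ((if A r i = (if b then 1 else -1) then d else k : ℤ) : ℝ)|)
    (hy : ∀ i, |y i| ≤ (k : ℤ)) (hy' : ∀ i, |y' i| ≤ (k : ℤ)) : y = y' := by
  classical
  let D : ℤ → Fin n → ℝ := fun d i => Real.exp |(y i : ℝ) - (d : ℤ)| - Real.exp |(y' i : ℝ) - (d : ℤ)|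
  have hS : ∀ (r : R) (b : Bool) (d : ℤ), |d| ≤ k →
      ∑ i, (if A r i = (if b then 1 else -1) then D d i else D k i) = 0 := by
    intro r b d hd
    have := h r b d hd
    rw [← sub_eq_zero, ← Finset.sum_sub_distrib] at this
    rw [← this]
    refine Finset.sum_congr rfl fun i _ => ?_
    split_ifs <;> rfl
  have hkk : |(k : ℤ)| ≤ k := by simp
  have hall : ∑ i, D k i = 0 := by
    obtain ⟨r⟩ := ‹Nonempty R›
    have := hS r true k hkk
    simpa using this
  have hG : ∀ (r : R) (d : ℤ), |d| ≤ k → ∑ i, (A r i : ℝ) * (D d i - D k i) = 0 := by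
    intro r d hd
    have h1 := hS r true d hd
    have h2 := hS r false d hd
    have : ∑ i, (A r i : ℝ) * (D d i - D k i) =
      ∑ i, (if A r i = (if true then 1 else -1) then D d i else D k i) -
      ∑ i, (if A r i = (if false then 1 else -1) then D d i else D k i) := by
      rw [← Finset.sum_sub_distrib]
      refine Finset.sum_congr rfl fun i _ => ?_
      rcases hA r i with h | h | h <;> simp [h]
    rw [this, h1, h2, sub_zero]
  have use : ∀ (c : ℝ), c ≠ 0 → ∀ δ : Fin n → ℤ, (∀ i, |δ i| ≤ 2) →
      (∀ r, ∑ i, (A r i : ℝ) * (c * δ i) = 0) → ∀ i, δ i = 0 := by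
    intro c hc δ hb hs
    refine hdet δ hb fun r => ?_
    have := hs r
    have e : ∑ i, (A r i : ℝ) * (c * δ i) = c * ((∑ i, A r i * δ i : ℤ) : ℝ) := by
      push_cast
      rw [Finset.mul_sum]
      exact Finset.sum_congr rfl fun i _ => by ring
    rw [e] at this
    exact_mod_cast (mul_eq_zero.1 this).resolve_left hc
  have he1 : (1 : ℝ) < Real.exp 1 := by simp
  have hbd := fun i => abs_le.1 (hy i)
  have hbd' := fun i => abs_le.1 (hy' i)
  have hc1 : (1 - Real.exp 1 * Real.exp 1 : ℝ) ≠ 0 := by nlinarith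
  have km1 : |(k : ℤ) - 1| ≤ k := by rw [abs_le]; omega
  have km2 : |-(k : ℤ)| ≤ k := by rw [abs_le]; omega
  have km3 : |-(k : ℤ) + 1| ≤ k := by rw [abs_le]; omega
  have top : ∀ i, D k i - Real.exp 1 * D (k - 1) i = (1 - Real.exp 1 * Real.exp 1) *
      (((if y i = k then 1 else 0) - (if y' i = k then 1 else 0) : ℤ) : ℝ) := by
    intro i
    have a := exp_top (y i) k (hbd i).2
    have b := exp_top (y' i) k (hbd' i).2
    simp only [D, Int.cast_sub] at a b ⊢
    linear_combination a - b
  have bot : ∀ i, D (-k) i - Real.exp 1 * D (-k + 1) i = (1 - Real.exp 1 * Real.exp 1) *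
      (((if y i = -k then 1 else 0) - (if y' i = -k then 1 else 0) : ℤ) : ℝ) := by
    intro i
    have a := exp_bot (y i) k (hbd i).1
    have b := exp_bot (y' i) k (hbd' i).1
    simp only [D, Int.cast_sub] at a b ⊢
    linear_combination a - b
  have step1 := use _ hc1 (fun i => ((if y i = k then 1 else 0) - (if y' i = k then 1 else 0)) -
      ((if y i = -k then 1 else 0) - (if y' i = -k then 1 else 0)))
      (fun i => by rw [abs_le]; split_ifs <;> omega)
      (fun r => by
        have g1 := hG r _ km1
        have g2 := hG r _ km2
        have g3 := hG r _ km3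
        have : ∀ i, (A r i : ℝ) * ((1 - Real.exp 1 * Real.exp 1) *
          ((((if y i = k then 1 else 0) - (if y' i = k then 1 else 0)) -
            ((if y i = -k then 1 else 0) - (if y' i = -k then 1 else 0)) : ℤ) : ℝ)) =
            -Real.exp 1 * ((A r i : ℝ) * (D (k - 1) i - D k i))
            - (A r i : ℝ) * (D (-k) i - D k i)
            + Real.exp 1 * ((A r i : ℝ) * (D (-k + 1) i - D k i)) := by
          intro i
          rw [Int.cast_sub, mul_sub, ← top, ← bot]
          ring
        simp only [this]
        rw [Finset.sum_add_distrib, Finset.sum_sub_distrib, ← Finset.mul_sum, ← Finset.mul_sum,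
          g1, g2, g3]
        simp)
  have htop : ∀ i, (y i = k ↔ y' i = k) := by
    intro i
    have := step1 i
    split_ifs at this <;> omega
  have hbot : ∀ i, (y i = -k ↔ y' i = -k) := by
    intro i
    have := step1 i
    split_ifs at this <;> omega
  have hDk : ∀ (r : R), ∑ i, (A r i : ℝ) * D k i = 0 := by
    intro r
    have g1 := hG r _ km1
    have : ∀ i, (A r i : ℝ) * (D (k - 1) i - D k i) =
        ((1 - Real.exp 1) / Real.exp 1) * ((A r i : ℝ) * D k i) := by
      intro i
      have t := top i
      simp only [htop, sub_self, Int.cast_zero, mul_zero] at t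
      have : D k i = Real.exp 1 * D (k - 1) i := by linarith
      rw [this]
      field_simp
    simp only [this] at g1
    rw [← Finset.mul_sum] at g1
    refine (mul_eq_zero.1 g1).resolve_left ?_
    refine div_ne_zero (by linarith) (by positivity)
  have hD : ∀ (r : R) (d : ℤ), |d| ≤ k → ∑ i, (A r i : ℝ) * D d i = 0 := by
    intro r d hd
    have a := hG r d hd
    simp only [mul_sub] at a
    rw [Finset.sum_sub_distrib, hDk, sub_zero] at a
    exact a
  have hc2 : (Real.exp 1 - Real.exp (-1) : ℝ) ≠ 0 := by
    have : Real.exp (-1) < Real.exp 1 := Real.exp_lt_exp.2 (by norm_num)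
    linarith
  have hint : ∀ d : ℤ, -k < d → d < k → ∀ i, (y i = d ↔ y' i = d) := by
    intro d hd1 hd2 i
    have st := use _ hc2 (fun i => ((if y i = d then 1 else 0) - (if y' i = d then 1 else 0)))
      (fun i => by rw [abs_le]; split_ifs <;> omega)
      (fun r => by
        have g1 := hD r (d + 1) (by rw [abs_le]; omega)
        have g2 := hD r (d - 1) (by rw [abs_le]; omega)
        have g3 := hD r d (by rw [abs_le]; omega)
        have : ∀ i, (A r i : ℝ) * ((Real.exp 1 - Real.exp (-1)) *
          (((if y i = d then 1 else 0) - (if y' i = d then 1 else 0) : ℤ) : ℝ)) =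
            (A r i : ℝ) * D (d + 1) i + (A r i : ℝ) * D (d - 1) i
            - (Real.exp 1 + Real.exp (-1)) * ((A r i : ℝ) * D d i) := by
          intro i
          rw [Int.cast_sub, mul_sub, ← exp_second, ← exp_second]
          simp only [D]
          ring
        simp only [this]
        rw [Finset.sum_sub_distrib, Finset.sum_add_distrib, ← Finset.mul_sum,
          g1, g2, g3]
        simp) i
    split_ifs at st <;> omega
  funext i
  have b := hbd i
  by_cases c1 : y i = k
  · rw [c1, (htop i).1 c1]
  by_cases c2 : y i = -k
  · rw [c2, (hbot i).1 c2]
  exact ((hint (y i) (by omega) (by omega) i).1 rfl).symm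

/-- Nonadaptive Mastermind upper bound for smooth max (LogSumExp-type) queries:
queries `x ∈ {-k,…,k}^n` are answered by `Σᵢ exp(|yᵢ − xᵢ|)`, and
`O(1 + min{n, n·k/log n})` such queries determine `y ∈ {-k,…,k}^n` exactly. -/
theorem mastermind_smoothmax_upper :
    ∃ C : ℝ, 0 < C ∧ ∀ n k : ℕ, 2 ≤ n → 1 ≤ k →
      ∃ (s : ℕ) (x : Fin s → Fin n → ℤ),
        (s : ℝ) ≤ C * (1 + min (n : ℝ) ((n : ℝ) * (k : ℝ) / Real.log (n : ℝ))) ∧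
        (∀ j i, |x j i| ≤ (k : ℤ)) ∧
        Set.InjOn
          (fun y : Fin n → ℤ => fun j : Fin s =>
            ∑ i, Real.exp |(y i : ℝ) - (x j i : ℝ)|)
          {y : Fin n → ℤ | ∀ i, |y i| ≤ (k : ℤ)} := by
  classical
  refine ⟨108, by norm_num, fun n k hn hk => ?_⟩
  rcases le_total (n : ℝ) ((n : ℝ) * (k : ℝ) / Real.log (n : ℝ)) with hmin | hmin
  · rw [min_eq_left hmin]
    let e := Fintype.equivFin (Option (Fin n))
    refine ⟨_, fun j i => if e.symm j = some i then -(k : ℤ) else k, ?_, ?_, ?_⟩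
    · simp only [Fintype.card_option, Fintype.card_fin]
      push_cast
      have : (0 : ℝ) ≤ n := by positivity
      linarith
    · intro j i
      simp only []
      split_ifs <;> simp
    · intro y hy y' hy' h
      refine scheme_linear n k hk y y' (fun o => ?_) hy hy'
      have := congrFun h (e o)
      simpa only [Equiv.symm_apply_apply] using this
  · rw [min_eq_right hmin]
    obtain ⟨R, fR, A, hcard, hpos, hA, hdet⟩ := detecting_n n hn
    haveI : Nonempty R := Fintype.card_pos_iff.1 hpos
    let e := Fintype.equivFin (R × Bool × Fin (2 * k + 1))
    refine ⟨_, fun j i => if A (e.symm j).1 i = (if (e.symm j).2.1 then 1 else -1)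
      then (((e.symm j).2.2 : ℕ) : ℤ) - k else k, ?_, ?_, ?_⟩
    · simp only [Fintype.card_prod, Fintype.card_fin, Fintype.card_bool]
      push_cast
      have hk' : (1 : ℝ) ≤ k := by exact_mod_cast hk
      calc (Fintype.card R : ℝ) * (2 * (2 * k + 1)) ≤ (18 * ((n : ℝ) / Real.log n)) * (6 * k) :=
            mul_le_mul hcard (by linarith) (by positivity) (le_trans (by positivity) hcard)
        _ = 108 * ((n : ℝ) * k / Real.log n) := by ring
        _ ≤ _ := by linarith
    · intro j i
      simp only []
      have := (e.symm j).2.2.isLt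
      split_ifs <;> rw [abs_le] <;> omega
    · intro y hy y' hy' h
      refine scheme_weigh n k hk R A hA hdet y y' (fun r b d hd => ?_) hy hy'
      have hd' := abs_le.1 hd
      have := congrFun h (e (r, b, ⟨(d + k).toNat, by omega⟩))
      have hcast : (((d + k).toNat : ℕ) : ℤ) - k = d := by omega
      simp only [Equiv.symm_apply_apply, hcast] at this
      exact this
end

section
/- Let n ≥ 1 and let 1 < d₁ ≤ d₂ ≤ … ≤ d_n be integers with d = d₁ + d₂ + … + d_n. Then there exist an integer s ≥ 1 and a matrix M ∈ {0,1}^{s×n} such that s·(log₂ s − 4) ≤ 2n·log₂(d/n) and such that for every pair of distinct vectors u, v ∈ {0,1,…,d₁−1} × {0,1,…,d₂−1} × … × {0,1,…,d_n−1}, one has M·u ≠ M·v (as vectors in ℤ^s). -/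
namespace Bsh

/-- The set of binary digits of `a`. -/
def bs (a : ℕ) : Finset ℕ := a.bitIndices.toFinset

/-- The number of binary ones of `a`. -/
def pop (a : ℕ) : ℕ := a.bitIndices.length

lemma card_bs (a : ℕ) : (bs a).card = pop a := by
  unfold bs pop
  exact List.toFinset_card_of_nodup Nat.bitIndices_nodup

/-- The number with given set of binary digits. -/
def num (X : Finset ℕ) : ℕ := ∑ i ∈ X, 2 ^ i

lemma bs_num (X : Finset ℕ) : bs (num X) = X := Finset.toFinset_bitIndices_sum_two_pow X

lemma num_bs (a : ℕ) : num (bs a) = a := Finset.sum_toFinset_bitIndices_two_pow a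

lemma num_mono {X Y : Finset ℕ} (h : X ⊆ Y) : num X ≤ num Y :=
  Finset.sum_le_sum_of_subset h

/-- Greedy packing. -/
lemma greedy (n : ℕ) (d : Fin n → ℕ) (hd : ∀ i, 1 < d i) :
    ∃ (t p : ℕ) (b c : Fin n → ℕ),
      (∀ i, b i ≤ t ∧ c i ≤ 2 ^ (pop (b i) - 1)) ∧
      (∀ a : ℕ, ∀ w : Fin n → ℤ, (∀ i, |w i| < d i) →
        ∑ i, (if b i = a then (c i : ℤ) * w i else 0) = 0 → ∀ i, b i = a → w i = 0) ∧
      1 ≤ p ∧ p ≤ 2 ^ (pop t - 1) ∧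
      (∀ w : Fin n → ℤ, (∀ i, |w i| < d i) →
        |∑ i, (if b i = t then (c i : ℤ) * w i else 0)| < p) ∧
      p * ∏ a ∈ Finset.range t, 2 ^ (pop a - 1) ≤ ∏ i, d i := by
  induction n with
  | zero =>
    refine ⟨0, 1, fun _ => 0, fun _ => 0, fun i => i.elim0, fun _ _ _ _ i => i.elim0, le_rfl,
      Nat.one_le_two_pow, ?_, ?_⟩ <;> simp
  | succ n ih =>
    obtain ⟨t, p, b, c, h1, h2, hp1, hp2, h3, h4⟩ := ih (fun i => d i.castSucc) (fun i => hd _)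
    have key1 : ∀ i : Fin (n+1), (Fin.snoc b t : Fin (n+1) → ℕ) i ≤ t ∧
        (Fin.snoc c p : Fin (n+1) → ℕ) i ≤ 2 ^ (pop ((Fin.snoc b t : Fin (n+1) → ℕ) i) - 1) := by
      intro i
      refine Fin.lastCases ?_ (fun j => ?_) i
      · simpa using hp2
      · simpa using h1 j
    have key2 : (∀ a : ℕ, ∀ w : Fin (n+1) → ℤ, (∀ i, |w i| < d i) →
        ∑ i, (if (Fin.snoc b t : Fin (n+1) → ℕ) i = a then
          (((Fin.snoc c p : Fin (n+1) → ℕ) i : ℕ) : ℤ) * w i else 0) = 0 →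
          ∀ i, (Fin.snoc b t : Fin (n+1) → ℕ) i = a → w i = 0) := by
      intro a w hw hs
      rw [Fin.sum_univ_castSucc] at hs
      simp only [Fin.snoc_castSucc, Fin.snoc_last] at hs
      have hlast : t = a → w (Fin.last n) = 0 := by
        rintro rfl
        have h := h3 (fun i => w i.castSucc) (fun i => hw _)
        simp only [if_true] at hs
        rw [eq_neg_of_add_eq_zero_left hs, abs_neg, abs_mul, Nat.abs_cast] at h
        by_contra hne
        have : 1 ≤ |w (Fin.last n)| := Int.one_le_abs hne
        nlinarith
      have hs' : ∑ i, (if b i = a then (c i : ℤ) * w i.castSucc else 0) = 0 := by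
        by_cases hta : t = a
        · rw [hlast hta] at hs; simpa using hs
        · simpa [hta] using hs
      intro i
      refine Fin.lastCases ?_ (fun j => ?_) i
      · simpa using hlast
      · simpa using h2 a (fun i => w i.castSucc) (fun i => hw _) hs' j
    have key3 : (∀ w : Fin (n+1) → ℤ, (∀ i, |w i| < d i) →
        |∑ i, (if (Fin.snoc b t : Fin (n+1) → ℕ) i = t then
          (((Fin.snoc c p : Fin (n+1) → ℕ) i : ℕ) : ℤ) * w i else 0)|
          < ((p * d (Fin.last n) : ℕ) : ℤ)) := by
      intro w hw
      rw [Fin.sum_univ_castSucc]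
      simp only [Fin.snoc_castSucc, Fin.snoc_last, if_true]
      have h := h3 (fun i => w i.castSucc) (fun i => hw _)
      have hl := hw (Fin.last n)
      refine (abs_add_le _ _).trans_lt ?_
      rw [abs_mul, Nat.abs_cast]
      push_cast
      have : (p : ℤ) * (|w (Fin.last n)| + 1) ≤ p * d (Fin.last n) :=
        mul_le_mul_of_nonneg_left (by omega) (by positivity)
      linarith
    have key4 : p * d (Fin.last n) * ∏ a ∈ Finset.range t, 2 ^ (pop a - 1) ≤ ∏ i, d i := by
      rw [Fin.prod_univ_castSucc]
      calc _ = (p * ∏ a ∈ Finset.range t, 2 ^ (pop a - 1)) * d (Fin.last n) := by ring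
        _ ≤ _ := Nat.mul_le_mul_right _ h4
    by_cases hle : p * d (Fin.last n) ≤ 2 ^ (pop t - 1)
    · exact ⟨t, p * d (Fin.last n), Fin.snoc b t, Fin.snoc c p, key1, key2,
        Nat.mul_pos hp1 (by have := hd (Fin.last n); omega), hle, key3, key4⟩
    · refine ⟨t + 1, 1, Fin.snoc b t, Fin.snoc c p,
        fun i => ⟨(key1 i).1.trans (Nat.le_succ _), (key1 i).2⟩, key2, le_rfl,
        Nat.one_le_two_pow, ?_, ?_⟩
      · intro w hw
        rw [Finset.sum_eq_zero]
        · simp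
        · intro i _
          rw [if_neg]
          have := (key1 i).1
          omega
      · rw [Finset.prod_range_succ, one_mul, mul_comm]
        exact (Nat.mul_le_mul_right _ (by omega)).trans key4

/-- There is a 0/1 function on subsets with prescribed alternating sum. -/
lemma exists_fun (B : Finset ℕ) (c : ℕ) (hc : c ≤ 2 ^ (B.card - 1)) :
    ∃ h : Finset ℕ → ℤ, (∀ X, h X = 0 ∨ h X = 1) ∧
      ∑ X ∈ B.powerset, (-1) ^ X.card * h X = (c : ℤ) := by
  have hE : 2 ^ (B.card - 1) ≤ (B.powerset.filter (fun X => Even X.card)).card := by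
    rcases B.eq_empty_or_nonempty with rfl | hB
    · have hmem : (∅ : Finset ℕ) ∈ (∅ : Finset ℕ).powerset.filter (fun X => Even X.card) := by simp
      have hpos := Finset.card_pos.2 ⟨_, hmem⟩
      rw [Finset.card_empty, Nat.zero_sub, pow_zero]
      exact hpos
    · have h0 := Finset.sum_powerset_neg_one_pow_card_of_nonempty hB
      have hcard := Finset.card_powerset B
      have hsplit := Finset.card_filter_add_card_filter_not (s := B.powerset) (fun X => Even X.card)
      rw [← Finset.sum_filter_add_sum_filter_not _ (fun X : Finset ℕ => Even X.card)] at h0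
      rw [Finset.sum_congr rfl (g := fun _ => (1 : ℤ))
        (fun x hx => Even.neg_one_pow (Finset.mem_filter.1 hx).2)] at h0
      rw [Finset.sum_congr rfl (s₁ := B.powerset.filter (fun X => ¬ Even X.card)) (g := fun _ => (-1 : ℤ))
        (fun x hx => Odd.neg_one_pow (Nat.not_even_iff_odd.1 (Finset.mem_filter.1 hx).2))] at h0
      simp only [Finset.sum_const, nsmul_eq_mul, mul_one, mul_neg] at h0
      have : 2 ^ B.card = 2 * 2 ^ (B.card - 1) := by
        rw [← pow_succ', Nat.sub_add_cancel hB.card_pos]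
      omega
  obtain ⟨T, hT, hTc⟩ := Finset.exists_subset_card_eq (hc.trans hE)
  classical
  refine ⟨fun X => if X ∈ T then 1 else 0, fun X => by by_cases h : X ∈ T <;> simp [h], ?_⟩
  have hTs : T ⊆ B.powerset := hT.trans (Finset.filter_subset _ _)
  calc _ = ∑ X ∈ B.powerset, (if X ∈ T then (1 : ℤ) else 0) := by
        refine Finset.sum_congr rfl fun X _ => ?_
        by_cases h : X ∈ T
        · simp [h, Even.neg_one_pow (Finset.mem_filter.1 (hT h)).2]
        · simp [h]
    _ = _ := by
        rw [Finset.sum_ite_mem, Finset.inter_eq_right.2 hTs]; simp [hTc]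

lemma alt_zero (A B : Finset ℕ) (h : Finset ℕ → ℤ) (hAB : ¬ A ⊆ B) :
    ∑ X ∈ A.powerset, (-1) ^ X.card * h (X ∩ B) = 0 := by
  obtain ⟨e, heA, heB⟩ := Finset.not_subset.1 hAB
  rw [← Finset.insert_erase heA, Finset.sum_powerset_insert (Finset.notMem_erase e A),
    ← Finset.sum_add_distrib]
  refine Finset.sum_eq_zero fun X hX => ?_
  have heX : e ∉ X := fun he => Finset.notMem_erase e A (Finset.mem_powerset.1 hX he)
  rw [Finset.card_insert_of_notMem heX, Finset.insert_inter_of_notMem heB]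
  ring

lemma matrix_exists (n : ℕ) (d : Fin n → ℕ) (t : ℕ) (b c : Fin n → ℕ)
    (h1 : ∀ i, b i ≤ t ∧ c i ≤ 2 ^ (pop (b i) - 1))
    (h2 : ∀ a : ℕ, ∀ w : Fin n → ℤ, (∀ i, |w i| < d i) →
        ∑ i, (if b i = a then (c i : ℤ) * w i else 0) = 0 → ∀ i, b i = a → w i = 0) :
    ∃ M : Fin (t + 1) → Fin n → ℤ, (∀ j i, M j i = 0 ∨ M j i = 1) ∧
      ∀ w : Fin n → ℤ, (∀ i, |w i| < d i) → (∀ j, ∑ i, M j i * w i = 0) → ∀ i, w i = 0 := by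
  have hex : ∀ i, ∃ h : Finset ℕ → ℤ, (∀ X, h X = 0 ∨ h X = 1) ∧
      ∑ X ∈ (bs (b i)).powerset, (-1) ^ X.card * h X = (c i : ℤ) := fun i =>
    exists_fun _ _ (by rw [card_bs]; exact (h1 i).2)
  choose h h01 hsum using hex
  refine ⟨fun j i => h i (bs j ∩ bs (b i)), fun j i => h01 _ _, ?_⟩
  intro w hw hM
  by_contra hne
  push Not at hne
  obtain ⟨i₀, hi₀⟩ := hne
  obtain ⟨m, hm, hmax⟩ := Finset.exists_max_image (Finset.univ.filter fun i => w i ≠ 0) b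
    ⟨i₀, by simpa using hi₀⟩
  have hm' : w m ≠ 0 := (Finset.mem_filter.1 hm).2
  refine hm' (h2 (b m) w hw ?_ m rfl)
  have hrow : ∀ X ∈ (bs (b m)).powerset, ∑ i, h i (X ∩ bs (b i)) * w i = 0 := by
    intro X hX
    have hlt : num X < t + 1 := by
      have := num_mono (Finset.mem_powerset.1 hX)
      rw [num_bs] at this
      have := (h1 m).1
      omega
    have := hM ⟨num X, hlt⟩
    simpa only [bs_num] using this
  have htot : ∑ i, (∑ X ∈ (bs (b m)).powerset, (-1) ^ X.card * h i (X ∩ bs (b i))) * w i = 0 := by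
    simp_rw [Finset.sum_mul]
    rw [Finset.sum_comm]
    refine Finset.sum_eq_zero fun X hX => ?_
    simp_rw [mul_assoc]
    rw [← Finset.mul_sum, hrow X hX, mul_zero]
  refine Eq.trans ?_ htot
  refine Finset.sum_congr rfl fun i _ => ?_
  by_cases hw0 : w i = 0
  · simp [hw0]
  have hbi : b i ≤ b m := hmax i (by simpa using hw0)
  by_cases hb : b i = b m
  · rw [if_pos hb, ← hsum i, hb]
    congr 1
    refine Finset.sum_congr rfl fun X hX => ?_
    rw [Finset.inter_eq_left.2 (Finset.mem_powerset.1 hX)]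
  · rw [if_neg hb, alt_zero, zero_mul]
    intro hsub
    have := num_mono hsub
    rw [num_bs, num_bs] at this
    omega

lemma pop_two_mul (m : ℕ) : pop (2 * m) = pop m := by simp [pop]
lemma pop_two_mul_add_one (m : ℕ) : pop (2 * m + 1) = pop m + 1 := by simp [pop]

/-- Sum of digit sums. -/
def S (t : ℕ) : ℕ := ∑ a ∈ Finset.range t, pop a

lemma S_two_mul (m : ℕ) : S (2 * m) = 2 * S m + m := by
  induction m with
  | zero => simp [S]
  | succ m ih =>
    unfold S at *
    rw [show 2 * (m + 1) = 2 * m + 1 + 1 by ring, Finset.sum_range_succ, Finset.sum_range_succ, ih,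
      Finset.sum_range_succ, pop_two_mul, pop_two_mul_add_one]
    ring

lemma S_two_mul_add_one (m : ℕ) : S (2 * m + 1) = S m + S (m + 1) + m := by
  have := S_two_mul m
  unfold S at *
  rw [Finset.sum_range_succ, this, Finset.sum_range_succ, pop_two_mul]
  ring

lemma mul_logb_convex (x y : ℝ) (hx : 0 < x) (hy : 0 < y) :
    (x + y) * (Real.logb 2 (x + y) - 1) ≤ x * Real.logb 2 x + y * Real.logb 2 y := by
  have hcv := Real.convexOn_mul_log.2 (Set.mem_Ici.2 hx.le) (Set.mem_Ici.2 hy.le)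
  have h := @hcv (1/2) (1/2) (by norm_num) (by norm_num) (by norm_num)
  simp only [smul_eq_mul] at h
  rw [show (1/2 * x + 1/2 * y : ℝ) = (x + y) / 2 by ring,
    Real.log_div (by positivity) (by norm_num)] at h
  have hl : 0 < Real.log 2 := Real.log_pos (by norm_num)
  unfold Real.logb
  have e1 : (x + y) * (Real.log (x + y) / Real.log 2 - 1)
      = (x + y) * (Real.log (x + y) - Real.log 2) / Real.log 2 := by field_simp
  have e2 : x * (Real.log x / Real.log 2) + y * (Real.log y / Real.log 2)
      = (x * Real.log x + y * Real.log y) / Real.log 2 := by ring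
  rw [e1, e2]
  gcongr
  linarith

lemma S_lower (t : ℕ) (ht : 1 ≤ t) : (t : ℝ) * Real.logb 2 t - t + 1 ≤ 2 * (S t : ℝ) := by
  induction t using Nat.strong_induction_on with
  | _ t ih =>
    rcases Nat.even_or_odd' t with ⟨m, rfl | rfl⟩
    · have hm := ih m (by omega) (by omega)
      have hmp : (0 : ℝ) < m := by exact_mod_cast (show 0 < m by omega)
      have := mul_logb_convex m m hmp hmp
      rw [S_two_mul]
      push_cast
      rw [← two_mul] at this
      have h1 : (1 : ℝ) ≤ m := by exact_mod_cast (show 1 ≤ m by omega)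
      linarith
    · by_cases hm0 : m = 0
      · subst hm0; simp
      have ha := ih m (by omega) (by omega)
      have hb := ih (m + 1) (by omega) (by omega)
      have hmp : (0 : ℝ) < m := by exact_mod_cast (show 0 < m by omega)
      have := mul_logb_convex m (m + 1) hmp (by positivity)
      rw [S_two_mul_add_one]
      push_cast at hb ⊢
      rw [show (m : ℝ) + (m + 1) = 2 * m + 1 by ring] at this
      linarith

lemma final_ineq (t : ℕ) :
    ((t + 1 : ℕ) : ℝ) * (Real.logb 2 ((t + 1 : ℕ) : ℝ) - 4) ≤
      2 * ∑ a ∈ Finset.range t, ((pop a - 1 : ℕ) : ℝ) := by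
  rcases Nat.eq_zero_or_pos t with rfl | ht
  · simp
  have hS := S_lower t ht
  have hsum : (S t : ℝ) - t ≤ ∑ a ∈ Finset.range t, ((pop a - 1 : ℕ) : ℝ) := by
    have : (S t : ℝ) - t = ∑ a ∈ Finset.range t, ((pop a : ℝ) - 1) := by
      simp [S]
    rw [this]
    refine Finset.sum_le_sum fun a _ => ?_
    have : pop a ≤ (pop a - 1) + 1 := by omega
    have : (pop a : ℝ) ≤ ((pop a - 1 : ℕ) : ℝ) + 1 := by exact_mod_cast this
    linarith
  have htp : (0 : ℝ) < t := by exact_mod_cast ht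
  have hl : 0 < Real.log 2 := Real.log_pos (by norm_num)
  have hlog : Real.logb 2 (t + 1 : ℝ) ≤ t := by
    rw [Real.logb_le_iff_le_rpow (by norm_num) (by positivity), Real.rpow_natCast]
    exact_mod_cast Nat.succ_le_of_lt t.lt_two_pow_self
  have hdiff : (t : ℝ) * Real.logb 2 (t + 1) ≤ t * Real.logb 2 t + 2 := by
    have h := Real.log_le_sub_one_of_pos (x := (t + 1 : ℝ) / t) (by positivity)
    rw [Real.log_div (by positivity) (by positivity)] at h
    have h' : (t : ℝ) * (Real.log (t + 1) - Real.log t) ≤ 1 := by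
      calc _ ≤ (t : ℝ) * ((t + 1 : ℝ) / t - 1) := by gcongr
        _ = 1 := by field_simp; ring
    have h2 := Real.log_two_gt_d9
    unfold Real.logb
    rw [← sub_le_iff_le_add']
    have : (t : ℝ) * (Real.log (t + 1) / Real.log 2) - t * (Real.log t / Real.log 2)
      = t * (Real.log (t + 1) - Real.log t) / Real.log 2 := by ring
    rw [this, div_le_iff₀ hl]
    linarith
  push_cast
  linarith

lemma jensen (n : ℕ) (hn : 1 ≤ n) (d : Fin n → ℕ) (hd : ∀ i, 1 < d i) :
    Real.logb 2 ((∏ i, d i : ℕ) : ℝ) ≤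
      (n : ℝ) * Real.logb 2 (((∑ i, d i : ℕ) : ℝ) / (n : ℝ)) := by
  have hnp : (0 : ℝ) < n := by exact_mod_cast hn
  have hpos : ∀ i, (0 : ℝ) < d i := fun i => by
    have := hd i
    exact_mod_cast (show 0 < d i by omega)
  have h := strictConcaveOn_log_Ioi.concaveOn.le_map_sum (t := Finset.univ)
    (w := fun _ : Fin n => (1 / n : ℝ)) (p := fun i => (d i : ℝ))
    (fun _ _ => by positivity) (by simp; field_simp) (fun i _ => hpos i)
  simp only [smul_eq_mul, ← Finset.mul_sum] at h
  have hl : 0 < Real.log 2 := Real.log_pos (by norm_num)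
  unfold Real.logb
  rw [← mul_div_assoc]
  gcongr
  push_cast
  rw [Real.log_prod (fun i _ => (hpos i).ne')]
  rw [one_div, inv_mul_le_iff₀ hnp] at h
  rwa [div_eq_inv_mul]

end Bsh

/-- Bshouty's detecting matrix theorem: given integers `1 < d₁ ≤ … ≤ d_n` with sum `d`,
there is an `s × n` matrix `M` with entries in `{0,1}` satisfying
`s(log₂ s − 4) ≤ 2n log₂(d/n)` such that `u ↦ M·u` is injective on the box
`Πᵢ {0,…,dᵢ−1} ⊆ ℤ^n`. -/
theorem bshouty_detecting_matrix (n : ℕ) (hn : 1 ≤ n) (d : Fin n → ℕ)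
    (hd1 : ∀ i, 1 < d i) (hmono : ∀ i j : Fin n, i ≤ j → d i ≤ d j) :
    ∃ (s : ℕ) (M : Fin s → Fin n → ℤ),
      1 ≤ s ∧
      (∀ j i, M j i = 0 ∨ M j i = 1) ∧
      (s : ℝ) * (Real.logb 2 (s : ℝ) - 4) ≤
        2 * (n : ℝ) * Real.logb 2 (((∑ i, d i : ℕ) : ℝ) / (n : ℝ)) ∧
      ∀ u v : Fin n → ℤ,
        (∀ i, 0 ≤ u i ∧ u i < (d i : ℤ)) →
        (∀ i, 0 ≤ v i ∧ v i < (d i : ℤ)) →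
        u ≠ v →
        (fun j : Fin s => ∑ i, M j i * u i) ≠ (fun j : Fin s => ∑ i, M j i * v i) := by
  obtain ⟨t, p, b, c, h1, h2, hp1, hp2, h3, h4⟩ := Bsh.greedy n d hd1
  obtain ⟨M, hM01, hM⟩ := Bsh.matrix_exists n d t b c h1 h2
  refine ⟨t + 1, M, by omega, hM01, ?_, ?_⟩
  · refine (Bsh.final_ineq t).trans ?_
    rw [mul_assoc]
    refine mul_le_mul_of_nonneg_left ((?_ : _ ≤ _).trans (Bsh.jensen n hn d hd1)) (by norm_num)
    have h5 : 2 ^ (∑ a ∈ Finset.range t, (Bsh.pop a - 1)) ≤ ∏ i, d i := by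
      rw [← Finset.prod_pow_eq_pow_sum]
      exact (Nat.le_mul_of_pos_left _ hp1).trans h4
    have hpos : 0 < ∏ i, d i := lt_of_lt_of_le (by positivity) h5
    rw [Real.le_logb_iff_rpow_le (by norm_num) (by exact_mod_cast hpos), ← Nat.cast_sum,
      Real.rpow_natCast]
    exact_mod_cast h5
  · intro u v hu hv huv heq
    apply huv
    have hz := hM (fun i => u i - v i) (fun i => by
      have h6 := hu i
      have h7 := hv i
      rw [abs_lt]
      constructor <;> linarith) (fun j => by
      have h8 := congrFun heq j
      simp only [mul_sub, Finset.sum_sub_distrib, h8, sub_self])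
    funext i
    have := hz i
    linarith
end
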